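/- arXiv:2107.03118 — 2 statements merged into one kernel-verified Lean document; each statement's English description precedes it below -/
import Mathlib

section
/- There exist positive constants C and λ, depending only on β and the initial data, such that for all (x,t) ∈ [0,1]×[0,∞): C⁻¹ ≤ u(x,t)/(1+t) ≤ C and C⁻¹ ≤ θ(x,t) ≤ C, and moreover ‖u(·,t)/(1+t) − A‖_{H¹(0,1)} + ‖v(·,t) − ∫₀¹v₀(x)dx − A(· − 1/2)‖_{H¹(0,1)} + ‖θ(·,t) − A‖_{H¹(0,1)} ≤ C(1+t)^{−λ} for all t ≥ 0. -/
open MeasureTheory Real Set Filter Topology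

/-- A classical solution on `[0,1] × [0,∞)` of the stress-free
one-dimensional compressible Navier–Stokes system
`u_t = v_x`, `v_t = ((v_x - θ)/u)_x`,
`θ_t = -θ v_x/u + v_x²/u + (θ^β θ_x/u)_x` (β > 0),
with stress-free, thermally insulated boundary conditions and positive data. -/
structure NSOrigSol where
  β : ℝ
  hβ : 0 < β
  u : ℝ → ℝ → ℝ
  v : ℝ → ℝ → ℝ
  θ : ℝ → ℝ → ℝ
  ux : ℝ → ℝ → ℝ
  ut : ℝ → ℝ → ℝ
  vx : ℝ → ℝ → ℝ
  vt : ℝ → ℝ → ℝ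
  vxx : ℝ → ℝ → ℝ
  θx : ℝ → ℝ → ℝ
  θt : ℝ → ℝ → ℝ
  θxx : ℝ → ℝ → ℝ
  hu_pos : ∀ x ∈ Icc (0:ℝ) 1, ∀ t ∈ Ici (0:ℝ), 0 < u x t
  hθ_pos : ∀ x ∈ Icc (0:ℝ) 1, ∀ t ∈ Ici (0:ℝ), 0 < θ x t
  hux : ∀ x ∈ Icc (0:ℝ) 1, ∀ t ∈ Ici (0:ℝ),
    HasDerivWithinAt (fun y => u y t) (ux x t) (Icc 0 1) x
  hut : ∀ x ∈ Icc (0:ℝ) 1, ∀ t ∈ Ici (0:ℝ),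
    HasDerivWithinAt (fun s => u x s) (ut x t) (Ici 0) t
  hvx : ∀ x ∈ Icc (0:ℝ) 1, ∀ t ∈ Ici (0:ℝ),
    HasDerivWithinAt (fun y => v y t) (vx x t) (Icc 0 1) x
  hvt : ∀ x ∈ Icc (0:ℝ) 1, ∀ t ∈ Ici (0:ℝ),
    HasDerivWithinAt (fun s => v x s) (vt x t) (Ici 0) t
  hvxx : ∀ x ∈ Icc (0:ℝ) 1, ∀ t ∈ Ici (0:ℝ),
    HasDerivWithinAt (fun y => vx y t) (vxx x t) (Icc 0 1) x
  hθx : ∀ x ∈ Icc (0:ℝ) 1, ∀ t ∈ Ici (0:ℝ),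
    HasDerivWithinAt (fun y => θ y t) (θx x t) (Icc 0 1) x
  hθt : ∀ x ∈ Icc (0:ℝ) 1, ∀ t ∈ Ici (0:ℝ),
    HasDerivWithinAt (fun s => θ x s) (θt x t) (Ici 0) t
  hθxx : ∀ x ∈ Icc (0:ℝ) 1, ∀ t ∈ Ici (0:ℝ),
    HasDerivWithinAt (fun y => θx y t) (θxx x t) (Icc 0 1) x
  hu_cont : ContinuousOn (Function.uncurry u) (Icc 0 1 ×ˢ Ici 0)
  hv_cont : ContinuousOn (Function.uncurry v) (Icc 0 1 ×ˢ Ici 0)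
  hθ_cont : ContinuousOn (Function.uncurry θ) (Icc 0 1 ×ˢ Ici 0)
  hux_cont : ContinuousOn (Function.uncurry ux) (Icc 0 1 ×ˢ Ici 0)
  hut_cont : ContinuousOn (Function.uncurry ut) (Icc 0 1 ×ˢ Ici 0)
  hvx_cont : ContinuousOn (Function.uncurry vx) (Icc 0 1 ×ˢ Ici 0)
  hvt_cont : ContinuousOn (Function.uncurry vt) (Icc 0 1 ×ˢ Ici 0)
  hvxx_cont : ContinuousOn (Function.uncurry vxx) (Icc 0 1 ×ˢ Ici 0)
  hθx_cont : ContinuousOn (Function.uncurry θx) (Icc 0 1 ×ˢ Ici 0)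
  hθt_cont : ContinuousOn (Function.uncurry θt) (Icc 0 1 ×ˢ Ici 0)
  hθxx_cont : ContinuousOn (Function.uncurry θxx) (Icc 0 1 ×ˢ Ici 0)
  mass : ∀ x ∈ Icc (0:ℝ) 1, ∀ t ∈ Ici (0:ℝ), ut x t = vx x t
  momentum : ∀ x ∈ Icc (0:ℝ) 1, ∀ t ∈ Ici (0:ℝ),
    HasDerivWithinAt (fun y => (vx y t - θ y t) / u y t) (vt x t) (Icc 0 1) x
  energyEq : ∀ x ∈ Icc (0:ℝ) 1, ∀ t ∈ Ici (0:ℝ),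
    HasDerivWithinAt (fun y => θ y t ^ β * θx y t / u y t)
      (θt x t + θ x t * vx x t / u x t - (vx x t) ^ 2 / u x t) (Icc 0 1) x
  bc0 : ∀ t ∈ Ici (0:ℝ), (vx 0 t - θ 0 t) / u 0 t = 0
  bc1 : ∀ t ∈ Ici (0:ℝ), (vx 1 t - θ 1 t) / u 1 t = 0
  bcθ0 : ∀ t ∈ Ici (0:ℝ), θx 0 t = 0
  bcθ1 : ∀ t ∈ Ici (0:ℝ), θx 1 t = 0

namespace NSOrigSol

/-- The initial energy `E₀ = ∫₀¹ (v₀²/2 + θ₀) dx`. -/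
noncomputable def E₀ (S : NSOrigSol) : ℝ := ∫ x in (0:ℝ)..1, ((S.v x 0) ^ 2 / 2 + S.θ x 0)

/-- The dissipation functional
`V(t) = ∫₀¹ (θ^β θ_x²/(uθ²) + (v_x − θ)²/(uθ)) dx`. -/
noncomputable def V (S : NSOrigSol) (t : ℝ) : ℝ :=
  ∫ x in (0:ℝ)..1,
    (S.θ x t ^ S.β * (S.θx x t) ^ 2 / (S.u x t * (S.θ x t) ^ 2)
      + (S.vx x t - S.θ x t) ^ 2 / (S.u x t * S.θ x t))

/-- The auxiliary velocity
`w(x,t) = v(x,t) − ∫₀¹ v₀ dξ − ∫₀ˣ u(ξ,t) dξ + ∫₀¹∫₀^ξ u(η,t) dη dξ`,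
which satisfies `w_x = v_x − u` and `∫₀¹ w dx = 0`. -/
noncomputable def w (S : NSOrigSol) (x t : ℝ) : ℝ :=
  S.v x t - (∫ ξ in (0:ℝ)..1, S.v ξ 0) - (∫ ξ in (0:ℝ)..x, S.u ξ t)
    + ∫ ξ in (0:ℝ)..1, ∫ η in (0:ℝ)..ξ, S.u η t

/-- The asymptotic state `A = 2√(36 + 3(2E₀ − (∫₀¹ v₀ dx)²)) − 12`. -/
noncomputable def A (S : NSOrigSol) : ℝ :=
  2 * Real.sqrt (36 + 3 * (2 * S.E₀ - (∫ x in (0:ℝ)..1, S.v x 0) ^ 2)) - 12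

end NSOrigSol

namespace NSLargeTime

theorem int_mono {f g : ℝ → ℝ} (hf : Continuous f) (hg : Continuous g)
    (h : ∀ x ∈ Ioo (0:ℝ) 1, f x ≤ g x) : ∫ x in (0:ℝ)..1, f x ≤ ∫ x in (0:ℝ)..1, g x :=
  intervalIntegral.integral_mono_on_of_le_Ioo zero_le_one (hf.intervalIntegrable _ _)
    (hg.intervalIntegrable _ _) h

theorem int_congr {f g : ℝ → ℝ} (h : ∀ x ∈ Ioo (0:ℝ) 1, f x = g x) :
    ∫ x in (0:ℝ)..1, f x = ∫ x in (0:ℝ)..1, g x :=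
  intervalIntegral.integral_congr_Ioo_of_le zero_le_one h

theorem int_nonneg {f : ℝ → ℝ} (h : ∀ x, 0 ≤ f x) : 0 ≤ ∫ x in (0:ℝ)..1, f x :=
  intervalIntegral.integral_nonneg zero_le_one fun x _ => h x

theorem int_add {f g : ℝ → ℝ} (hf : Continuous f) (hg : Continuous g) :
    ∫ x in (0:ℝ)..1, (f x + g x) = (∫ x in (0:ℝ)..1, f x) + ∫ x in (0:ℝ)..1, g x :=
  intervalIntegral.integral_add (hf.intervalIntegrable _ _) (hg.intervalIntegrable _ _)

theorem int_sub {f g : ℝ → ℝ} (hf : Continuous f) (hg : Continuous g) :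
    ∫ x in (0:ℝ)..1, (f x - g x) = (∫ x in (0:ℝ)..1, f x) - ∫ x in (0:ℝ)..1, g x :=
  intervalIntegral.integral_sub (hf.intervalIntegrable _ _) (hg.intervalIntegrable _ _)

/-- Integration by parts on `[0,1]` with derivatives only in the interior. -/
theorem int_parts {f g f' g' : ℝ → ℝ} (hf : Continuous f) (hg : Continuous g)
    (hf' : Continuous f') (hg' : Continuous g')
    (df : ∀ x ∈ Ioo (0:ℝ) 1, HasDerivAt f (f' x) x)
    (dg : ∀ x ∈ Ioo (0:ℝ) 1, HasDerivAt g (g' x) x) :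
    ∫ x in (0:ℝ)..1, f x * g' x = f 1 * g 1 - f 0 * g 0 - ∫ x in (0:ℝ)..1, f' x * g x := by
  apply intervalIntegral.integral_mul_deriv_eq_deriv_mul_of_hasDerivAt hf.continuousOn
    hg.continuousOn _ _ (hf'.intervalIntegrable _ _) (hg'.intervalIntegrable _ _)
  · simpa using df
  · simpa using dg

/-- The Cauchy–Schwarz inequality with a positive weight. -/
theorem int_mul_sq_le {f g w : ℝ → ℝ} (hf : Continuous f) (hg : Continuous g) (hw : Continuous w)
    (wpos : ∀ x, 0 < w x) :
    (∫ x in (0:ℝ)..1, f x * g x) ^ 2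
      ≤ (∫ x in (0:ℝ)..1, f x ^ 2 / w x) * ∫ x in (0:ℝ)..1, g x ^ 2 * w x := by
  have hw0 : ∀ x, w x ≠ 0 := fun x => (wpos x).ne'
  have key : ∀ s : ℝ, 0 ≤ (∫ x in (0:ℝ)..1, g x ^ 2 * w x) * (s * s)
      + (2 * ∫ x in (0:ℝ)..1, f x * g x) * s + ∫ x in (0:ℝ)..1, f x ^ 2 / w x := by
    intro s
    have h : 0 ≤ ∫ x in (0:ℝ)..1, (g x ^ 2 * w x * (s * s) + 2 * (f x * g x) * s
        + f x ^ 2 / w x) := by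
      apply int_nonneg
      intro x
      have : g x ^ 2 * w x * (s * s) + 2 * (f x * g x) * s + f x ^ 2 / w x
          = (g x * w x * s + f x) ^ 2 / w x := by
        have := hw0 x
        field_simp
        ring
      rw [this]
      exact div_nonneg (sq_nonneg _) (wpos x).le
    rw [int_add (by fun_prop) (by fun_prop (disch := exact hw0 _)),
      int_add (by fun_prop) (by fun_prop), intervalIntegral.integral_mul_const,
      intervalIntegral.integral_mul_const, intervalIntegral.integral_const_mul] at h
    exact h
  have := discrim_le_zero key
  unfold discrim at this
  nlinarith

theorem sub_eq_integral {h hx : ℝ → ℝ} (ch : Continuous h) (chx : Continuous hx)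
    (dh : ∀ x ∈ Ioo (0:ℝ) 1, HasDerivAt h (hx x) x) {x y : ℝ} (hx0 : 0 ≤ x) (hxy : x ≤ y)
    (hy : y ≤ 1) : h y - h x = ∫ ξ in x..y, hx ξ := by
  rw [intervalIntegral.integral_eq_sub_of_hasDerivAt_of_le hxy ch.continuousOn
    (fun z hz => dh z ⟨hx0.trans_lt hz.1, hz.2.trans_le hy⟩) (chx.intervalIntegrable _ _)]

theorem abs_sub_le_integral {h hx : ℝ → ℝ} (ch : Continuous h) (chx : Continuous hx)
    (dh : ∀ x ∈ Ioo (0:ℝ) 1, HasDerivAt h (hx x) x) {x y : ℝ} (hX : x ∈ Icc (0:ℝ) 1)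
    (hY : y ∈ Icc (0:ℝ) 1) : |h x - h y| ≤ ∫ ξ in (0:ℝ)..1, |hx ξ| := by
  wlog hxy : x ≤ y generalizing x y
  · rw [abs_sub_comm]
    exact this hY hX (le_of_not_ge hxy)
  rw [abs_sub_comm, sub_eq_integral ch chx dh hX.1 hxy hY.2]
  refine (intervalIntegral.abs_integral_le_integral_abs hxy).trans ?_
  exact intervalIntegral.integral_mono_interval hX.1 hxy hY.2
    (Eventually.of_forall fun z => abs_nonneg _) (chx.abs.intervalIntegrable _ _)

/-- The oscillation of a function is controlled by a weighted `L²` norm of its derivative. -/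
theorem sub_sq_le {h hx w : ℝ → ℝ} (ch : Continuous h) (chx : Continuous hx) (hw : Continuous w)
    (wpos : ∀ x, 0 < w x)
    (dh : ∀ x ∈ Ioo (0:ℝ) 1, HasDerivAt h (hx x) x) {x y : ℝ} (hX : x ∈ Icc (0:ℝ) 1)
    (hY : y ∈ Icc (0:ℝ) 1) :
    (h x - h y) ^ 2 ≤ (∫ ξ in (0:ℝ)..1, hx ξ ^ 2 / w ξ) * ∫ ξ in (0:ℝ)..1, w ξ := by
  have h1 := abs_sub_le_integral ch chx dh hX hY
  have h2 := int_mul_sq_le (f := fun ξ => |hx ξ|) (g := fun _ => 1) chx.abs (by fun_prop) hw wpos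
  simp only [mul_one, sq_abs, one_pow, one_mul] at h2
  refine le_trans ?_ h2
  rw [← sq_abs]
  gcongr

theorem anti_of_deriv_nonpos {f f' : ℝ → ℝ} (cf : ContinuousOn f (Ici 0))
    (h : ∀ τ > 0, HasDerivAt f (f' τ) τ) (h0 : ∀ τ > 0, f' τ ≤ 0) {a b : ℝ} (ha : 0 ≤ a)
    (hab : a ≤ b) : f b ≤ f a := by
  have : AntitoneOn f (Ici 0) := by
    apply antitoneOn_of_deriv_nonpos (convex_Ici 0) cf
    · intro x hx
      rw [interior_Ici] at hx
      exact (h x hx).differentiableAt.differentiableWithinAt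
    · intro x hx
      rw [interior_Ici] at hx
      rw [(h x hx).deriv]
      exact h0 x hx
  exact this ha (ha.trans hab) hab

theorem const_of_deriv_zero {f : ℝ → ℝ} (cf : ContinuousOn f (Ici 0))
    (h : ∀ τ > 0, HasDerivAt f 0 τ) {b : ℝ} (hb : 0 ≤ b) : f b = f 0 := by
  apply le_antisymm
  · exact anti_of_deriv_nonpos (f' := fun _ => 0) cf h (fun _ _ => le_rfl) le_rfl hb
  · have := anti_of_deriv_nonpos (f := fun τ => - f τ) (f' := fun _ => -0) cf.neg
      (fun τ hτ => (h τ hτ).neg) (fun _ _ => by simp) le_rfl hb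
    linarith

/-- Carathéodory's criterion. -/
theorem hasDerivAt_of_slope {F G : ℝ → ℝ} {τ : ℝ} (hG : ContinuousAt G τ)
    (h : ∀ᶠ r in 𝓝 τ, F r - F τ = (r - τ) * G r) : HasDerivAt F (G τ) τ := by
  rw [hasDerivAt_iff_tendsto_slope]
  refine (hG.tendsto.mono_left nhdsWithin_le_nhds).congr' ?_
  filter_upwards [h.filter_mono nhdsWithin_le_nhds, self_mem_nhdsWithin] with r hr hne
  have : r - τ ≠ 0 := sub_ne_zero.mpr hne
  rw [slope_def_field, hr]
  field_simp

/-- The mean of `g x` over the segment from `τ` to `r`. -/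
noncomputable def segMean (g : ℝ → ℝ → ℝ) (x τ r : ℝ) : ℝ := ∫ ρ in (0:ℝ)..1, g x (τ + ρ * (r - τ))

theorem continuous_segMean {g : ℝ → ℝ → ℝ} (hg : Continuous fun p : ℝ × ℝ => g p.1 p.2) (τ : ℝ) :
    Continuous fun p : ℝ × ℝ => segMean g p.1 τ p.2 := by
  unfold segMean
  apply intervalIntegral.continuous_parametric_intervalIntegral_of_continuous'
  exact hg.comp (f := fun z : (ℝ × ℝ) × ℝ => (z.1.1, τ + z.2 * (z.1.2 - τ))) (by fun_prop)

theorem segMean_self (g : ℝ → ℝ → ℝ) (x τ : ℝ) : segMean g x τ τ = g x τ := by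
  simp [segMean]

theorem sub_eq_mul_segMean {f g : ℝ → ℝ → ℝ} (hg : Continuous fun p : ℝ × ℝ => g p.1 p.2)
    {s : Set ℝ} (hs : OrdConnected s) {x : ℝ} (d : ∀ r ∈ s, HasDerivAt (f x) (g x r) r)
    {τ r : ℝ} (hτ : τ ∈ s) (hr : r ∈ s) : f x r - f x τ = (r - τ) * segMean g x τ r := by
  have c1 : Continuous (g x) := hg.comp (f := fun y => (x, y)) (by fun_prop)
  have h1 : ∫ y in τ..r, g x y = f x r - f x τ :=
    intervalIntegral.integral_eq_sub_of_hasDerivAt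
      (fun y hy => d y (hs.uIcc_subset hτ hr hy)) (c1.intervalIntegrable _ _)
  rw [← h1, segMean]
  rcases eq_or_ne (r - τ) 0 with h | h
  · have : r = τ := by linarith
    simp [this]
  · have := intervalIntegral.mul_integral_comp_add_mul (f := g x) (a := 0) (b := 1) (r - τ) τ
    simp only [mul_zero, add_zero, mul_one, add_sub_cancel] at this
    rw [← this]
    simp only [mul_comm]

/-- Differentiation under the integral sign. -/
theorem hasDerivAt_integral {f g : ℝ → ℝ → ℝ} (cf : Continuous fun p : ℝ × ℝ => f p.1 p.2)
    (hg : Continuous fun p : ℝ × ℝ => g p.1 p.2) {a b : ℝ} {s : Set ℝ} (hs : OrdConnected s)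
    {τ : ℝ} (hτ : s ∈ 𝓝 τ)
    (d : ∀ x ∈ Ioo (min a b) (max a b), ∀ r ∈ s, HasDerivAt (f x) (g x r) r) :
    HasDerivAt (fun r => ∫ x in a..b, f x r) (∫ x in a..b, g x τ) τ := by
  have cG : Continuous fun r => ∫ x in a..b, segMean g x τ r := by
    apply intervalIntegral.continuous_parametric_intervalIntegral_of_continuous'
    exact (continuous_segMean hg τ).comp (f := fun z : ℝ × ℝ => (z.2, z.1)) (by fun_prop)
  have := hasDerivAt_of_slope (F := fun r => ∫ x in a..b, f x r) (τ := τ) cG.continuousAt ?_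
  · simpa only [segMean_self] using this
  · filter_upwards [hτ] with r hr
    have c1 : ∀ r, Continuous fun x => f x r := fun r =>
      cf.comp (f := fun y => (y, r)) (by fun_prop)
    rw [← intervalIntegral.integral_sub ((c1 _).intervalIntegrable _ _)
      ((c1 _).intervalIntegrable _ _), ← intervalIntegral.integral_const_mul]
    apply intervalIntegral.integral_congr_uIoo
    intro x hx
    exact sub_eq_mul_segMean hg hs (d x hx) (mem_of_mem_nhds hτ) hr

/-- Equality of mixed partial derivatives, without second-order differentiability assumptions. -/
theorem hasDerivAt_mixed {f fx g gx : ℝ → ℝ → ℝ} (cg : Continuous fun p : ℝ × ℝ => g p.1 p.2)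
    (cgx : Continuous fun p : ℝ × ℝ => gx p.1 p.2)
    (dx : ∀ x ∈ Ioo (0:ℝ) 1, ∀ τ, HasDerivAt (fun y => f y τ) (fx x τ) x)
    (dgx : ∀ x ∈ Ioo (0:ℝ) 1, ∀ τ, HasDerivAt (fun y => g y τ) (gx x τ) x)
    (dτ : ∀ x ∈ Ioo (0:ℝ) 1, ∀ τ > 0, HasDerivAt (f x) (g x τ) τ)
    {x τ : ℝ} (hx : x ∈ Ioo (0:ℝ) 1) (hτ : 0 < τ) : HasDerivAt (fx x) (gx x τ) τ := by
  have cgx1 : Continuous (gx x) := cgx.comp (f := fun y => (x, y)) (by fun_prop)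
  have key : ∀ r > 0, fx x r = fx x τ + ∫ s in τ..r, gx x s := by
    intro r hr
    have h1 : HasDerivAt (fun y => f y τ + ∫ s in τ..r, g y s)
        (fx x τ + ∫ s in τ..r, gx x s) x := by
      refine (dx x hx τ).add ?_
      exact hasDerivAt_integral (f := fun s y => g y s) (g := fun s y => gx y s)
        (cg.comp (f := fun z : ℝ × ℝ => (z.2, z.1)) (by fun_prop))
        (cgx.comp (f := fun z : ℝ × ℝ => (z.2, z.1)) (by fun_prop))
        ordConnected_Ioo (Ioo_mem_nhds hx.1 hx.2) (fun s _ y hy => dgx y hy s)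
    refine (dx x hx r).unique (h1.congr_of_eventuallyEq ?_)
    filter_upwards [Ioo_mem_nhds hx.1 hx.2] with y hy
    have cg1 : Continuous (g y) := cg.comp (f := fun s => (y, s)) (by fun_prop)
    rw [intervalIntegral.integral_eq_sub_of_hasDerivAt
      (fun s hs => dτ y hy s ?_) (cg1.intervalIntegrable _ _)]
    · ring
    · exact (lt_min hτ hr).trans_le hs.1
  have h2 : HasDerivAt (fun r => fx x τ + ∫ s in τ..r, gx x s) (gx x τ) τ :=
    (intervalIntegral.integral_hasDerivAt_right (cgx1.intervalIntegrable _ _)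
      cgx1.stronglyMeasurable.stronglyMeasurableAtFilter cgx1.continuousAt).const_add _
  refine h2.congr_of_eventuallyEq ?_
  filter_upwards [lt_mem_nhds hτ] with r hr using key r hr

/-- Time derivative of `∫ U s²` where `U s = f_x - k` and `s` vanishes at both end points. -/
theorem hasDerivAt_weighted {f fx ft k kt U Ut s sx : ℝ → ℝ → ℝ}
    (cf : Continuous fun p : ℝ × ℝ => f p.1 p.2) (cfx : Continuous fun p : ℝ × ℝ => fx p.1 p.2)
    (cft : Continuous fun p : ℝ × ℝ => ft p.1 p.2) (ck : Continuous fun p : ℝ × ℝ => k p.1 p.2)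
    (ckt : Continuous fun p : ℝ × ℝ => kt p.1 p.2) (cU : Continuous fun p : ℝ × ℝ => U p.1 p.2)
    (cUt : Continuous fun p : ℝ × ℝ => Ut p.1 p.2) (cs : Continuous fun p : ℝ × ℝ => s p.1 p.2)
    (csx : Continuous fun p : ℝ × ℝ => sx p.1 p.2)
    (hs : ∀ x τ, U x τ * s x τ = fx x τ - k x τ) (s0 : ∀ τ, s 0 τ = 0) (s1 : ∀ τ, s 1 τ = 0)
    (dfx : ∀ x ∈ Ioo (0:ℝ) 1, ∀ τ, HasDerivAt (fun y => f y τ) (fx x τ) x)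
    (dsx : ∀ x ∈ Ioo (0:ℝ) 1, ∀ τ, HasDerivAt (fun y => s y τ) (sx x τ) x)
    (df : ∀ x, ∀ τ > 0, HasDerivAt (f x) (ft x τ) τ)
    (dk : ∀ x, ∀ τ > 0, HasDerivAt (k x) (kt x τ) τ)
    (dU : ∀ x, ∀ τ > 0, HasDerivAt (U x) (Ut x τ) τ) {τ : ℝ} (hτ : 0 < τ) :
    HasDerivAt (fun r => ∫ x in (0:ℝ)..1, U x r * s x r ^ 2)
      (∫ x in (0:ℝ)..1, (-2 * sx x τ * ft x τ - 2 * s x τ * kt x τ - s x τ ^ 2 * Ut x τ)) τ := by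
  have c1 : ∀ {g : ℝ → ℝ → ℝ}, (Continuous fun p : ℝ × ℝ => g p.1 p.2) →
      ∀ r, Continuous fun x => g x r := fun hg r => hg.comp (f := fun y => (y, r)) (by fun_prop)
  have mf := continuous_segMean cft τ
  have mk := continuous_segMean ckt τ
  have mU := continuous_segMean cUt τ
  have cG : Continuous fun r => ∫ x in (0:ℝ)..1, (-((sx x r + sx x τ) * segMean ft x τ r)
      - segMean kt x τ r * (s x r + s x τ) - s x τ * s x r * segMean Ut x τ r) := by
    apply intervalIntegral.continuous_parametric_intervalIntegral_of_continuous'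
    have e : ∀ {g : ℝ → ℝ → ℝ}, (Continuous fun p : ℝ × ℝ => g p.1 p.2) →
      Continuous fun p : ℝ × ℝ => g p.2 p.1 := fun hg =>
        hg.comp (f := fun z : ℝ × ℝ => (z.2, z.1)) (by fun_prop)
    have e' : ∀ {g : ℝ → ℝ → ℝ}, (Continuous fun p : ℝ × ℝ => g p.1 p.2) →
      Continuous fun p : ℝ × ℝ => g p.2 τ := fun hg =>
        hg.comp (f := fun z : ℝ × ℝ => (z.2, τ)) (by fun_prop)
    exact (((((e csx).add (e' csx)).mul (e (g := fun x r => segMean ft x τ r) mf)).neg).sub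
      ((e (g := fun x r => segMean kt x τ r) mk).mul ((e cs).add (e' cs)))).sub
      (((e' cs).mul (e cs)).mul (e (g := fun x r => segMean Ut x τ r) mU))
  have key := hasDerivAt_of_slope (F := fun r => ∫ x in (0:ℝ)..1, U x r * s x r ^ 2) (τ := τ)
    cG.continuousAt ?_
  · simp only [segMean_self] at key
    convert key using 1
    apply int_congr
    intro x _
    ring
  · filter_upwards [lt_mem_nhds hτ] with r hr
    have sm : ∀ {f g : ℝ → ℝ → ℝ}, (Continuous fun p : ℝ × ℝ => g p.1 p.2) →
        (∀ x, ∀ τ > 0, HasDerivAt (f x) (g x τ) τ) → ∀ x,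
        f x r - f x τ = (r - τ) * segMean g x τ r := fun hg d x =>
      sub_eq_mul_segMean (s := Ioi 0) hg ordConnected_Ioi (fun y hy => d x y hy) hτ hr
    have ip := int_parts (f := fun x => s x r + s x τ) (g := fun x => f x r - f x τ)
      (f' := fun x => sx x r + sx x τ) (g' := fun x => fx x r - fx x τ)
      ((c1 cs r).add (c1 cs τ)) ((c1 cf r).sub (c1 cf τ)) ((c1 csx r).add (c1 csx τ))
      ((c1 cfx r).sub (c1 cfx τ)) (fun x hx => (dsx x hx r).add (dsx x hx τ))
      (fun x hx => (dfx x hx r).sub (dfx x hx τ))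
    simp only [s0, s1, add_zero, zero_mul, sub_self, zero_sub] at ip
    have cs1 := c1 cs
    have csx1 := c1 csx
    have cfx1 := c1 cfx
    have cf1 := c1 cf
    have cU1 := c1 cU
    have ck1 := c1 ck
    have c2 : ∀ {g : ℝ → ℝ → ℝ}, (Continuous fun p : ℝ × ℝ => segMean g p.1 τ p.2) →
      Continuous fun x => segMean g x τ r := fun hg => hg.comp (f := fun y => (y, r)) (by fun_prop)
    have mf1 := c2 mf
    have mk1 := c2 mk
    have mU1 := c2 mU
    rw [← int_sub (by fun_prop) (by fun_prop), ← intervalIntegral.integral_const_mul]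
    have e1 : ∫ x in (0:ℝ)..1, (U x r * s x r ^ 2 - U x τ * s x τ ^ 2)
        = (∫ x in (0:ℝ)..1, (s x r + s x τ) * (fx x r - fx x τ))
          + ∫ x in (0:ℝ)..1, (r - τ) * (- segMean kt x τ r * (s x r + s x τ)
            - s x τ * s x r * segMean Ut x τ r) := by
      rw [← int_add (by fun_prop) (by fun_prop)]
      apply int_congr
      intro x _
      have h1 := sm ckt dk x
      have h2 := sm cUt dU x
      have h3 := hs x r
      have h4 := hs x τ
      have h5 : fx x r = U x r * s x r + k x r := by linarith
      have h6 : fx x τ = U x τ * s x τ + k x τ := by linarith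
      rw [h5, h6]
      linear_combination -(s x r + s x τ) * h1 - s x τ * s x r * h2
    rw [e1, ip, ← intervalIntegral.integral_neg, ← int_add (by fun_prop) (by fun_prop)]
    apply int_congr
    intro x _
    have h1 := sm cft df x
    simp only [h1]
    ring

/-- The flow in the scaled variables `U = u/(1+t)`, `τ = log (1+t)`, extended continuously to
`ℝ × ℝ` by freezing it outside `[0,1] × [0,∞)`. Here `sx` and `qx` are the space derivatives of the
stress `(v_x - θ)/U` and of the heat flux `θ^β θ_x/U`; they are tied to the time derivatives. -/
structure ScaledFlow where
  β : ℝ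
  m : ℝ
  A : ℝ
  β_pos : 0 < β
  A_pos : 0 < A
  U : ℝ → ℝ → ℝ
  v : ℝ → ℝ → ℝ
  θ : ℝ → ℝ → ℝ
  Ux : ℝ → ℝ → ℝ
  vx : ℝ → ℝ → ℝ
  θx : ℝ → ℝ → ℝ
  sx : ℝ → ℝ → ℝ
  qx : ℝ → ℝ → ℝ
  cU : Continuous fun p : ℝ × ℝ => U p.1 p.2
  cv : Continuous fun p : ℝ × ℝ => v p.1 p.2
  cθ : Continuous fun p : ℝ × ℝ => θ p.1 p.2
  cUx : Continuous fun p : ℝ × ℝ => Ux p.1 p.2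
  cvx : Continuous fun p : ℝ × ℝ => vx p.1 p.2
  cθx : Continuous fun p : ℝ × ℝ => θx p.1 p.2
  csx : Continuous fun p : ℝ × ℝ => sx p.1 p.2
  cqx : Continuous fun p : ℝ × ℝ => qx p.1 p.2
  U_pos : ∀ x τ, 0 < U x τ
  θ_pos : ∀ x τ, 0 < θ x τ
  dUx : ∀ x ∈ Ioo (0:ℝ) 1, ∀ τ, HasDerivAt (fun y => U y τ) (Ux x τ) x
  dvx : ∀ x ∈ Ioo (0:ℝ) 1, ∀ τ, HasDerivAt (fun y => v y τ) (vx x τ) x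
  dθx : ∀ x ∈ Ioo (0:ℝ) 1, ∀ τ, HasDerivAt (fun y => θ y τ) (θx x τ) x
  dsx : ∀ x ∈ Ioo (0:ℝ) 1, ∀ τ,
    HasDerivAt (fun y => (vx y τ - θ y τ) / U y τ) (sx x τ) x
  dqx : ∀ x ∈ Ioo (0:ℝ) 1, ∀ τ,
    HasDerivAt (fun y => θ y τ ^ β * θx y τ / U y τ) (qx x τ) x
  bs0 : ∀ τ, vx 0 τ = θ 0 τ
  bs1 : ∀ τ, vx 1 τ = θ 1 τ
  bq0 : ∀ τ, θx 0 τ = 0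
  bq1 : ∀ τ, θx 1 τ = 0
  dUτ : ∀ x, ∀ τ > 0, HasDerivAt (U x) (vx x τ - U x τ) τ
  dvτ : ∀ x, ∀ τ > 0, HasDerivAt (v x) (sx x τ) τ
  dθτ : ∀ x, ∀ τ > 0,
    HasDerivAt (θ x) (qx x τ + (vx x τ - θ x τ) / U x τ * vx x τ) τ
  dUxτ : ∀ x ∈ Ioo (0:ℝ) 1, ∀ τ > 0, HasDerivAt (Ux x)
    (sx x τ * U x τ + (vx x τ - θ x τ) / U x τ * Ux x τ + θx x τ - Ux x τ) τ
  mean_v : ∫ x in (0:ℝ)..1, v x 0 = m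
  energy : ∫ x in (0:ℝ)..1, (v x 0 ^ 2 / 2 + θ x 0) = A ^ 2 / 24 + A + m ^ 2 / 2

namespace ScaledFlow

variable (F : ScaledFlow) {X : Type*} [TopologicalSpace X] {a b : X → ℝ}

@[fun_prop] theorem continuous_U (ha : Continuous a) (hb : Continuous b) :
    Continuous fun p => F.U (a p) (b p) := F.cU.comp (ha.prodMk hb)
@[fun_prop] theorem continuous_v (ha : Continuous a) (hb : Continuous b) :
    Continuous fun p => F.v (a p) (b p) := F.cv.comp (ha.prodMk hb)
@[fun_prop] theorem continuous_θ (ha : Continuous a) (hb : Continuous b) :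
    Continuous fun p => F.θ (a p) (b p) := F.cθ.comp (ha.prodMk hb)
@[fun_prop] theorem continuous_Ux (ha : Continuous a) (hb : Continuous b) :
    Continuous fun p => F.Ux (a p) (b p) := F.cUx.comp (ha.prodMk hb)
@[fun_prop] theorem continuous_vx (ha : Continuous a) (hb : Continuous b) :
    Continuous fun p => F.vx (a p) (b p) := F.cvx.comp (ha.prodMk hb)
@[fun_prop] theorem continuous_θx (ha : Continuous a) (hb : Continuous b) :
    Continuous fun p => F.θx (a p) (b p) := F.cθx.comp (ha.prodMk hb)
@[fun_prop] theorem continuous_sx (ha : Continuous a) (hb : Continuous b) :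
    Continuous fun p => F.sx (a p) (b p) := F.csx.comp (ha.prodMk hb)
@[fun_prop] theorem continuous_qx (ha : Continuous a) (hb : Continuous b) :
    Continuous fun p => F.qx (a p) (b p) := F.cqx.comp (ha.prodMk hb)

theorem U_ne (x τ : ℝ) : F.U x τ ≠ 0 := (F.U_pos x τ).ne'
theorem θ_ne (x τ : ℝ) : F.θ x τ ≠ 0 := (F.θ_pos x τ).ne'

@[fun_prop] theorem continuous_θ_rpow (p : ℝ) (ha : Continuous a) (hb : Continuous b) :
    Continuous fun z => F.θ (a z) (b z) ^ p :=
  (F.continuous_θ ha hb).rpow_const fun _ => Or.inl (F.θ_ne _ _)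

/-- The stress. -/
noncomputable def s (x τ : ℝ) : ℝ := (F.vx x τ - F.θ x τ) / F.U x τ
/-- The heat flux. -/
noncomputable def q (x τ : ℝ) : ℝ := F.θ x τ ^ F.β * F.θx x τ / F.U x τ

@[fun_prop] theorem continuous_s (ha : Continuous a) (hb : Continuous b) :
    Continuous fun p => F.s (a p) (b p) := by
  unfold s
  have := F.U_ne
  fun_prop (disch := simp [this])

@[fun_prop] theorem continuous_q (ha : Continuous a) (hb : Continuous b) :
    Continuous fun p => F.q (a p) (b p) := by
  unfold q
  have := F.U_ne
  fun_prop (disch := simp [this])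

@[fun_prop] theorem continuous_U_inv (ha : Continuous a) (hb : Continuous b) :
    Continuous fun p => (F.U (a p) (b p))⁻¹ := (F.continuous_U ha hb).inv₀ fun _ => F.U_ne _ _

@[fun_prop] theorem continuous_θ_inv (ha : Continuous a) (hb : Continuous b) :
    Continuous fun p => (F.θ (a p) (b p))⁻¹ := (F.continuous_θ ha hb).inv₀ fun _ => F.θ_ne _ _

@[fun_prop] theorem continuous_div_U {g : X → ℝ} (hg : Continuous g) (ha : Continuous a)
    (hb : Continuous b) : Continuous fun p => g p / F.U (a p) (b p) :=
  hg.div (F.continuous_U ha hb) fun _ => F.U_ne _ _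

@[fun_prop] theorem continuous_div_θ {g : X → ℝ} (hg : Continuous g) (ha : Continuous a)
    (hb : Continuous b) : Continuous fun p => g p / F.θ (a p) (b p) :=
  hg.div (F.continuous_θ ha hb) fun _ => F.θ_ne _ _

theorem vx_eq (x τ : ℝ) : F.vx x τ = F.U x τ * F.s x τ + F.θ x τ := by
  have := F.U_ne x τ
  unfold s
  field_simp
  ring

theorem U_mul_q (x τ : ℝ) : F.U x τ * F.q x τ = F.θ x τ ^ F.β * F.θx x τ := by
  have := F.U_ne x τ
  unfold q
  field_simp

theorem s_zero (τ : ℝ) : F.s 0 τ = 0 := by simp [s, F.bs0]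
theorem s_one (τ : ℝ) : F.s 1 τ = 0 := by simp [s, F.bs1]
theorem q_zero (τ : ℝ) : F.q 0 τ = 0 := by simp [q, F.bq0]
theorem q_one (τ : ℝ) : F.q 1 τ = 0 := by simp [q, F.bq1]

theorem ds (x : ℝ) (hx : x ∈ Ioo (0:ℝ) 1) (τ : ℝ) :
    HasDerivAt (fun y => F.s y τ) (F.sx x τ) x := F.dsx x hx τ
theorem dq (x : ℝ) (hx : x ∈ Ioo (0:ℝ) 1) (τ : ℝ) :
    HasDerivAt (fun y => F.q y τ) (F.qx x τ) x := F.dqx x hx τ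
theorem dθ (x τ : ℝ) (hτ : 0 < τ) :
    HasDerivAt (F.θ x) (F.qx x τ + F.s x τ * F.vx x τ) τ := F.dθτ x τ hτ

theorem θ_rpow_sub_two (x τ : ℝ) : F.θ x τ ^ (F.β - 2) = F.θ x τ ^ F.β / F.θ x τ ^ 2 := by
  rw [rpow_sub (F.θ_pos x τ)]
  norm_num

/-- Differentiation of a space integral in time. -/
theorem _root_.NSLargeTime.hasDerivAt_int {f g : ℝ → ℝ → ℝ}
    (cf : Continuous fun p : ℝ × ℝ => f p.1 p.2)
    (hg : Continuous fun p : ℝ × ℝ => g p.1 p.2)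
    (d : ∀ x ∈ Ioo (0:ℝ) 1, ∀ τ > 0, HasDerivAt (f x) (g x τ) τ) {τ : ℝ} (hτ : 0 < τ) :
    HasDerivAt (fun r => ∫ x in (0:ℝ)..1, f x r) (∫ x in (0:ℝ)..1, g x τ) τ :=
  hasDerivAt_integral cf hg (s := Ioi 0) ordConnected_Ioi (Ioi_mem_nhds hτ)
    (fun x hx r hr => d x (by simpa using hx) r hr)

theorem _root_.NSLargeTime.continuous_int {f : ℝ → ℝ → ℝ}
    (cf : Continuous fun p : ℝ × ℝ => f p.1 p.2) :
    Continuous fun r => ∫ x in (0:ℝ)..1, f x r := by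
  apply intervalIntegral.continuous_parametric_intervalIntegral_of_continuous'
  exact cf.comp (f := fun z : ℝ × ℝ => (z.2, z.1)) (by fun_prop)

theorem int_v {τ : ℝ} (hτ : 0 ≤ τ) : ∫ x in (0:ℝ)..1, F.v x τ = F.m := by
  rw [← F.mean_v]
  refine const_of_deriv_zero (f := fun τ => ∫ x in (0:ℝ)..1, F.v x τ)
    (continuous_int F.cv).continuousOn (fun r hr => ?_) hτ
  have h := hasDerivAt_int F.cv F.csx (fun x _ => F.dvτ x) hr
  have h1 := int_parts (f := fun _ => 1) (f' := fun _ => 0) (g := fun x => F.s x r)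
    (g' := fun x => F.sx x r) (by fun_prop) (by fun_prop) (by fun_prop) (by fun_prop)
    (fun x _ => hasDerivAt_const x _) (fun x hx => F.ds x hx r)
  simp only [one_mul, F.s_zero, F.s_one, zero_mul, sub_zero, intervalIntegral.integral_zero] at h1
  rwa [h1] at h

theorem int_energy {τ : ℝ} (hτ : 0 ≤ τ) : ∫ x in (0:ℝ)..1, (F.v x τ ^ 2 / 2 + F.θ x τ)
    = F.A ^ 2 / 24 + F.A + F.m ^ 2 / 2 := by
  rw [← F.energy]
  refine const_of_deriv_zero (f := fun τ => ∫ x in (0:ℝ)..1, (F.v x τ ^ 2 / 2 + F.θ x τ))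
    (continuous_int (by fun_prop)).continuousOn (fun r hr => ?_) hτ
  have h := hasDerivAt_int (f := fun x τ => F.v x τ ^ 2 / 2 + F.θ x τ)
    (g := fun x τ => F.v x τ * F.sx x τ + 1 * F.qx x τ + F.s x τ * F.vx x τ)
    (by fun_prop) (by fun_prop) (fun x _ τ hτ => by
      refine ((((F.dvτ x τ hτ).pow 2).div_const 2).add (F.dθ x τ hτ)).congr_deriv ?_
      simp
      ring) hr
  have h1 := int_parts (f := fun x => F.v x r) (f' := fun x => F.vx x r) (g := fun x => F.s x r)
    (g' := fun x => F.sx x r) (by fun_prop) (by fun_prop) (by fun_prop) (by fun_prop)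
    (fun x hx => F.dvx x hx r) (fun x hx => F.ds x hx r)
  have h2 := int_parts (f := fun _ => 1) (f' := fun _ => 0) (g := fun x => F.q x r)
    (g' := fun x => F.qx x r) (by fun_prop) (by fun_prop) (by fun_prop) (by fun_prop)
    (fun x _ => hasDerivAt_const x _) (fun x hx => F.dq x hx r)
  rw [int_add (by fun_prop) (by fun_prop), int_add (by fun_prop) (by fun_prop), h1, h2] at h
  simp only [F.s_zero, F.s_one, F.q_zero, F.q_one, mul_zero, zero_mul, sub_zero, zero_sub,
    intervalIntegral.integral_zero, mul_comm (F.s _ r), add_zero,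
    neg_add_cancel] at h
  exact h

/-- The velocity perturbation. -/
noncomputable def psi (x τ : ℝ) : ℝ := F.v x τ - F.m - F.A * (x - 1 / 2)

/-- The relative entropy density of the temperature. -/
noncomputable def phi (z : ℝ) : ℝ := z - F.A - F.A * log (z / F.A)

/-- The Lyapunov functional. -/
noncomputable def H (τ : ℝ) : ℝ := ∫ x in (0:ℝ)..1, (F.psi x τ ^ 2 / 2 + F.phi (F.θ x τ))

/-- The dissipation. -/
noncomputable def V (τ : ℝ) : ℝ :=
  ∫ x in (0:ℝ)..1, (F.θ x τ ^ (F.β - 2) * F.θx x τ ^ 2 / F.U x τ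
    + F.U x τ * F.s x τ ^ 2 / F.θ x τ)

@[fun_prop] theorem continuous_psi (ha : Continuous a) (hb : Continuous b) :
    Continuous fun p => F.psi (a p) (b p) := by
  unfold psi
  fun_prop

@[fun_prop] theorem continuous_phi_θ (ha : Continuous a) (hb : Continuous b) :
    Continuous fun p => F.phi (F.θ (a p) (b p)) := by
  unfold phi
  have : Continuous fun p => log (F.θ (a p) (b p) / F.A) :=
    ((F.continuous_θ ha hb).div_const _).log fun x => (div_pos (F.θ_pos _ _) F.A_pos).ne'
  fun_prop

@[fun_prop] theorem continuous_H : Continuous F.H := continuous_int (by fun_prop)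
@[fun_prop] theorem continuous_V : Continuous F.V := continuous_int (by fun_prop)

theorem phi_ge {z : ℝ} (hz : 0 < z) : (√z - √F.A) ^ 2 ≤ F.phi z := by
  have hA := F.A_pos
  have h1 : log (z / F.A) = 2 * log (√z / √F.A) := by
    rw [← Real.sqrt_div hz.le, Real.log_sqrt (div_pos hz hA).le]
    ring
  have h2 := log_le_sub_one_of_pos (x := √z / √F.A) (by positivity)
  have h3 := Real.sq_sqrt hz.le
  have h4 := Real.sq_sqrt hA.le
  have h5 : F.A * (√z / √F.A) = √z * √F.A := by
    have : √F.A ≠ 0 := by positivity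
    field_simp
    rw [h4]
  unfold phi
  rw [h1]
  nlinarith

theorem phi_nonneg {z : ℝ} (hz : 0 < z) : 0 ≤ F.phi z := (sq_nonneg _).trans (F.phi_ge hz)

theorem phi_le {z : ℝ} (hz : 0 < z) : F.phi z ≤ (z - F.A) ^ 2 / z := by
  have hA := F.A_pos
  have h1 : log (z / F.A) = - log (F.A / z) := by
    rw [← Real.log_inv, inv_div]
  have h2 := log_le_sub_one_of_pos (x := F.A / z) (by positivity)
  have h3 := mul_le_mul_of_nonneg_left h2 hA.le
  unfold phi
  rw [h1]
  have : (z - F.A) ^ 2 / z = z - 2 * F.A + F.A * (F.A / z) := by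
    field_simp
    ring
  rw [this]
  linarith

theorem V_nonneg (τ : ℝ) : 0 ≤ F.V τ := by
  apply int_nonneg
  intro x
  have := F.U_pos x τ
  have := F.θ_pos x τ
  positivity

theorem hasDerivAt_H {τ : ℝ} (hτ : 0 < τ) : HasDerivAt F.H (-F.A * F.V τ) τ := by
  have hA := F.A_pos
  have h := hasDerivAt_int (f := fun x τ => F.psi x τ ^ 2 / 2 + F.phi (F.θ x τ))
    (g := fun x τ => F.psi x τ * F.sx x τ + (1 - F.A / F.θ x τ) * F.qx x τ
      + (1 - F.A / F.θ x τ) * (F.s x τ * F.vx x τ))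
    (by fun_prop) (by fun_prop) (fun x _ τ hτ => by
      have h0 := F.θ_ne x τ
      have h1 : HasDerivAt (F.psi x) (F.sx x τ) τ :=
        ((F.dvτ x τ hτ).sub_const _).sub_const _
      have h2 := F.dθ x τ hτ
      have h3 : HasDerivAt (fun r => log (F.θ x r / F.A)) _ τ :=
        (h2.div_const F.A).log (div_ne_zero h0 hA.ne')
      refine (((h1.pow 2).div_const 2).add
        ((h2.sub_const F.A).sub (h3.const_mul F.A))).congr_deriv ?_
      have := hA.ne'
      simp
      field_simp
      ring) hτ
  have h1 := int_parts (f := fun x => F.psi x τ) (f' := fun x => F.vx x τ - F.A)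
    (g := fun x => F.s x τ)
    (g' := fun x => F.sx x τ) (by fun_prop) (by fun_prop) (by fun_prop) (by fun_prop)
    (fun x hx => by
      have := ((F.dvx x hx τ).sub_const F.m).sub
        (((hasDerivAt_id x).sub_const (1 / 2)).const_mul F.A)
      exact this.congr_deriv (by simp)) (fun x hx => F.ds x hx τ)
  have h2 := int_parts (f := fun x => 1 - F.A / F.θ x τ)
    (f' := fun x => F.A * F.θx x τ / F.θ x τ / F.θ x τ)
    (g := fun x => F.q x τ)
    (g' := fun x => F.qx x τ) (by fun_prop) (by fun_prop) (by fun_prop) (by fun_prop)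
    (fun x hx => by
      have := ((F.dθx x hx τ).fun_inv (F.θ_ne x τ)).const_mul F.A
      refine (this.const_sub 1).congr_deriv ?_
      have := F.θ_ne x τ
      field_simp) (fun x hx => F.dq x hx τ)
  rw [int_add (by fun_prop) (by fun_prop), int_add (by fun_prop) (by fun_prop), h1, h2] at h
  simp only [F.s_zero, F.s_one, F.q_zero, F.q_one, mul_zero, sub_zero, zero_sub] at h
  refine h.congr_deriv ?_
  symm
  unfold V
  rw [← intervalIntegral.integral_const_mul, ← intervalIntegral.integral_neg,
    ← intervalIntegral.integral_neg, ← int_add (by fun_prop) (by fun_prop),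
    ← int_add (by fun_prop) (by fun_prop)]
  apply int_congr
  intro x _
  have h0 := F.θ_ne x τ
  have h3 := F.U_ne x τ
  have h4 := F.U_mul_q x τ
  rw [θ_rpow_sub_two, vx_eq]
  have h5 : F.q x τ = F.θ x τ ^ F.β * F.θx x τ / F.U x τ := rfl
  rw [h5]
  field_simp
  ring

theorem H_nonneg (τ : ℝ) : 0 ≤ F.H τ := by
  apply int_nonneg
  intro x
  have := F.phi_nonneg (F.θ_pos x τ)
  positivity

theorem H_anti {r τ : ℝ} (hr : 0 ≤ r) (h : r ≤ τ) : F.H τ ≤ F.H r :=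
  anti_of_deriv_nonpos F.continuous_H.continuousOn (fun τ hτ => F.hasDerivAt_H hτ)
    (fun τ _ => by nlinarith [F.V_nonneg τ, F.A_pos]) hr h

theorem int_psi_sq_le (τ : ℝ) : ∫ x in (0:ℝ)..1, F.psi x τ ^ 2 ≤ 2 * F.H τ := by
  unfold H
  rw [← intervalIntegral.integral_const_mul]
  apply int_mono (by fun_prop) (by fun_prop)
  intro x _
  have := F.phi_nonneg (F.θ_pos x τ)
  linarith

theorem exists_phi_le (τ : ℝ) : ∃ y ∈ Icc (0:ℝ) 1, F.phi (F.θ y τ) ≤ F.H τ := by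
  by_contra! hc
  have h1 : 0 < ∫ x in (0:ℝ)..1, (F.phi (F.θ x τ) - F.H τ) := by
    apply intervalIntegral.intervalIntegral_pos_of_pos_on
      (Continuous.intervalIntegrable (by fun_prop) _ _) _ zero_lt_one
    intro x hx
    linarith [hc x (Ioo_subset_Icc_self hx)]
  rw [int_sub (by fun_prop) (by fun_prop)] at h1
  have h2 : ∫ x in (0:ℝ)..1, F.phi (F.θ x τ) ≤ F.H τ := by
    apply int_mono (by fun_prop) (by fun_prop)
    intro x _
    linarith [sq_nonneg (F.psi x τ)]
  simp at h1
  linarith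

theorem int_θ_le {τ : ℝ} (hτ : 0 ≤ τ) :
    ∫ x in (0:ℝ)..1, F.θ x τ ≤ F.A ^ 2 / 24 + F.A + F.m ^ 2 / 2 := by
  rw [← F.int_energy hτ]
  apply int_mono (by fun_prop) (by fun_prop)
  intro x _
  linarith [sq_nonneg (F.v x τ)]

end ScaledFlow

theorem exists_bound {f : ℝ → ℝ → ℝ} (cf : Continuous fun p : ℝ × ℝ => f p.1 p.2) (T : ℝ) :
    ∃ C > 0, ∀ x ∈ Icc (0:ℝ) 1, ∀ τ ∈ Icc (0:ℝ) T, |f x τ| ≤ C := by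
  obtain ⟨C, hC⟩ := ((isCompact_Icc (a := (0:ℝ)) (b := 1)).prod
    (isCompact_Icc (a := (0:ℝ)) (b := T))).exists_bound_of_continuousOn cf.continuousOn
  exact ⟨max C 1, by positivity, fun x hx τ hτ => (hC (x, τ) ⟨hx, hτ⟩).trans (le_max_left _ _)⟩

theorem exists_bound_one {f : ℝ → ℝ} (cf : Continuous f) (T : ℝ) :
    ∃ C > 0, ∀ τ ∈ Icc (0:ℝ) T, |f τ| ≤ C := by
  obtain ⟨C, hC, h⟩ := exists_bound (f := fun _ τ => f τ) (by fun_prop) T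
  exact ⟨C, hC, fun τ hτ => h 0 (by simp) τ hτ⟩

namespace ScaledFlow

variable (F : ScaledFlow) {X : Type*} [TopologicalSpace X]

theorem exists_good_point : ∃ c > 0, ∃ C > 0, ∀ τ ≥ 0, ∃ y ∈ Icc (0:ℝ) 1,
    c ≤ F.θ y τ ∧ F.θ y τ ≤ C := by
  have hA := F.A_pos
  refine ⟨F.A * exp (-(F.H 0 + F.A) / F.A), by positivity, (√F.A + √(F.H 0)) ^ 2, by positivity,
    fun τ hτ => ?_⟩
  obtain ⟨y, hy, h⟩ := F.exists_phi_le τ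
  have h0 := F.θ_pos y τ
  have h1 := h.trans (F.H_anti le_rfl hτ)
  refine ⟨y, hy, ?_, ?_⟩
  · have h2 : -(F.H 0 + F.A) / F.A ≤ log (F.θ y τ / F.A) := by
      rw [div_le_iff₀ hA]
      unfold phi at h1
      nlinarith
    have h3 := exp_le_exp.mpr h2
    rw [exp_log (div_pos h0 hA), le_div_iff₀ hA] at h3
    linarith
  · have h2 := Real.sqrt_le_sqrt ((F.phi_ge h0).trans h1)
    rw [Real.sqrt_sq_eq_abs] at h2
    have h3 := (le_abs_self _).trans h2
    calc F.θ y τ = √(F.θ y τ) ^ 2 := (Real.sq_sqrt h0.le).symm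
      _ ≤ _ := by
        gcongr
        linarith

/-- The weight `∫ θ U` in the oscillation estimates. -/
noncomputable def R (τ : ℝ) : ℝ := ∫ x in (0:ℝ)..1, F.θ x τ * F.U x τ

@[fun_prop] theorem continuous_R : Continuous F.R := continuous_int (by fun_prop)

theorem R_nonneg (τ : ℝ) : 0 ≤ F.R τ :=
  int_nonneg fun x => (mul_pos (F.θ_pos x τ) (F.U_pos x τ)).le

theorem osc_θ_rpow (τ : ℝ) {x y : ℝ} (hx : x ∈ Icc (0:ℝ) 1) (hy : y ∈ Icc (0:ℝ) 1) :
    (F.θ x τ ^ ((1 + F.β) / 2) - F.θ y τ ^ ((1 + F.β) / 2)) ^ 2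
      ≤ ((1 + F.β) / 2) ^ 2 * (F.V τ * F.R τ) := by
  set p := (1 + F.β) / 2 with hp
  have h := sub_sq_le (h := fun x => F.θ x τ ^ p)
    (hx := fun x => F.θx x τ * p * F.θ x τ ^ (p - 1)) (w := fun x => F.θ x τ * F.U x τ)
    (by fun_prop) (by fun_prop) (by fun_prop) (fun x => mul_pos (F.θ_pos x τ) (F.U_pos x τ))
    (fun x hx => (F.dθx x hx τ).rpow_const (Or.inl (F.θ_ne x τ))) hx hy
  refine h.trans ?_
  rw [← mul_assoc]
  have hR := F.R_nonneg τ
  unfold R at hR ⊢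
  refine mul_le_mul_of_nonneg_right ?_ hR
  unfold V
  rw [← intervalIntegral.integral_const_mul]
  have hpos : ∀ x, 0 < F.θ x τ * F.U x τ := fun x => mul_pos (F.θ_pos x τ) (F.U_pos x τ)
  apply int_mono _ (by fun_prop)
  · intro x _
    have h0 := F.θ_pos x τ
    have h1 := F.U_pos x τ
    have e : (F.θ x τ ^ (p - 1)) ^ 2 = F.θ x τ ^ (F.β - 2) * F.θ x τ := by
      rw [← rpow_natCast, ← rpow_mul h0.le]
      nth_rewrite 3 [← rpow_one (F.θ x τ)]
      rw [← rpow_add h0]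
      congr 1
      push_cast
      rw [hp]
      ring
    have e2 : (F.θx x τ * p * F.θ x τ ^ (p - 1)) ^ 2 / (F.θ x τ * F.U x τ)
        = p ^ 2 * (F.θ x τ ^ (F.β - 2) * F.θx x τ ^ 2 / F.U x τ) := by
      rw [mul_pow, mul_pow, e]
      field_simp
    rw [e2]
    have : 0 ≤ F.U x τ * F.s x τ ^ 2 / F.θ x τ := by positivity
    gcongr
    linarith
  · exact Continuous.div (by fun_prop) (by fun_prop) fun x => (hpos x).ne'

theorem rpow_half_sq {z : ℝ} (hz : 0 < z) : (z ^ ((1 + F.β) / 2)) ^ 2 = z ^ (1 + F.β) := by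
  rw [← rpow_natCast, ← rpow_mul hz.le]
  congr 1
  push_cast
  ring

theorem θ_rpow_le : ∃ C > 0, ∀ τ ≥ 0, ∀ x ∈ Icc (0:ℝ) 1,
    F.θ x τ ^ (1 + F.β) ≤ C * (1 + F.V τ * F.R τ) := by
  obtain ⟨c, hc, C, hC, h⟩ := F.exists_good_point
  have hβ := F.β_pos
  refine ⟨2 * C ^ (1 + F.β) + 2 * ((1 + F.β) / 2) ^ 2, by positivity, fun τ hτ x hx => ?_⟩
  obtain ⟨y, hy, h1, h2⟩ := h τ hτ
  have h3 := F.osc_θ_rpow τ hx hy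
  have hx0 := F.θ_pos x τ
  have hy0 := F.θ_pos y τ
  have h4 := F.rpow_half_sq hx0
  have h5 := F.rpow_half_sq hy0
  have h6 : F.θ y τ ^ (1 + F.β) ≤ C ^ (1 + F.β) := by gcongr
  have h7 : 0 ≤ F.V τ * F.R τ := mul_nonneg (F.V_nonneg τ) (F.R_nonneg τ)
  rw [← h4]
  have h8 : 0 < C ^ (1 + F.β) := by positivity
  nlinarith [sq_nonneg (F.θ x τ ^ ((1 + F.β) / 2) - 2 * F.θ y τ ^ ((1 + F.β) / 2)),
    mul_nonneg h8.le h7, sq_nonneg ((1 + F.β) / 2)]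

theorem le_one_add_rpow {z p : ℝ} (hz : 0 < z) (hp : 1 ≤ p) : z ≤ 1 + z ^ p := by
  rcases le_total z 1 with h | h
  · have := rpow_nonneg hz.le p
    linarith
  · have := rpow_le_rpow_of_exponent_le h hp
    rw [rpow_one] at this
    linarith

/-- The space primitive of the velocity perturbation. -/
noncomputable def b (x τ : ℝ) : ℝ := ∫ ξ in (0:ℝ)..x, F.psi ξ τ

theorem continuous_b_uncurried : Continuous fun p : ℝ × ℝ => F.b p.1 p.2 := by
  unfold b
  exact intervalIntegral.continuous_parametric_intervalIntegral_of_continuous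
    (f := fun (p : ℝ × ℝ) ξ => F.psi ξ p.2) (by fun_prop) continuous_fst

@[fun_prop] theorem continuous_b {c d : X → ℝ} (hc : Continuous c) (hd : Continuous d) :
    Continuous fun p => F.b (c p) (d p) := F.continuous_b_uncurried.comp (hc.prodMk hd)

theorem dbx (x τ : ℝ) : HasDerivAt (fun y => F.b y τ) (F.psi x τ) x := by
  have c : Continuous fun x => F.psi x τ := by fun_prop
  exact intervalIntegral.integral_hasDerivAt_right (c.intervalIntegrable _ _)
    c.stronglyMeasurable.stronglyMeasurableAtFilter c.continuousAt

theorem dbτ {x τ : ℝ} (hx : x ∈ Icc (0:ℝ) 1) (hτ : 0 < τ) :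
    HasDerivAt (F.b x) (F.s x τ) τ := by
  have h := hasDerivAt_integral (f := F.psi) (g := F.sx) (a := 0) (b := x) (s := Ioi 0) (τ := τ)
    (by fun_prop) (by fun_prop) ordConnected_Ioi (Ioi_mem_nhds hτ)
    (fun y _ r hr => ((F.dvτ y r hr).sub_const _).sub_const _)
  rw [← sub_eq_integral (h := fun x => F.s x τ) (hx := fun x => F.sx x τ) (by fun_prop)
    (by fun_prop) (fun y hy => F.ds y hy τ) le_rfl hx.1 hx.2, F.s_zero, sub_zero] at h
  exact h

theorem b_sq_le {x : ℝ} (hx : x ∈ Icc (0:ℝ) 1) (τ : ℝ) : F.b x τ ^ 2 ≤ 2 * F.H τ := by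
  have h := sub_sq_le (h := fun x => F.b x τ) (hx := fun x => F.psi x τ) (w := fun _ => 1)
    (by fun_prop) (by fun_prop) (by fun_prop) (fun _ => one_pos) (fun x _ => F.dbx x τ) hx
    (y := 0) (by simp)
  have h0 : F.b 0 τ = 0 := by simp [b]
  simp only [h0, sub_zero, div_one, intervalIntegral.integral_const, smul_eq_mul, mul_one] at h
  exact h.trans (F.int_psi_sq_le τ)

theorem exists_b_bound : ∃ B > 0, ∀ τ ≥ 0, ∀ x ∈ Icc (0:ℝ) 1, exp |F.b x τ| ≤ B := by
  refine ⟨exp √(2 * F.H 0), exp_pos _, fun τ hτ x hx => exp_le_exp.mpr ?_⟩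
  rw [← Real.sqrt_sq_eq_abs]
  exact Real.sqrt_le_sqrt ((F.b_sq_le hx τ).trans (by linarith [F.H_anti le_rfl hτ]))

/-- The specific volume with the stress integrated out. -/
noncomputable def W (x τ : ℝ) : ℝ := exp (-F.b x τ) * F.U x τ

@[fun_prop] theorem continuous_W {c d : X → ℝ} (hc : Continuous c) (hd : Continuous d) :
    Continuous fun p => F.W (c p) (d p) := by
  unfold W
  fun_prop

theorem W_pos (x τ : ℝ) : 0 < F.W x τ := mul_pos (exp_pos _) (F.U_pos x τ)

theorem U_eq (x τ : ℝ) : F.U x τ = exp (F.b x τ) * F.W x τ := by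
  unfold W
  rw [← mul_assoc, ← exp_add]
  simp

theorem dW {x τ : ℝ} (hx : x ∈ Icc (0:ℝ) 1) (hτ : 0 < τ) :
    HasDerivAt (F.W x) (-F.W x τ + exp (-F.b x τ) * F.θ x τ) τ := by
  refine ((F.dbτ hx hτ).neg.exp.mul (F.dUτ x τ hτ)).congr_deriv ?_
  rw [vx_eq]
  simp only [W, Pi.neg_apply]
  ring

theorem U_le : ∃ C > 0, ∀ τ ≥ 0, ∀ x ∈ Icc (0:ℝ) 1, F.U x τ ≤ C := by
  obtain ⟨B, hB, hb⟩ := F.exists_b_bound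
  obtain ⟨C, hC, hθ⟩ := F.θ_rpow_le
  obtain ⟨n0, hn0, hW0⟩ := exists_bound (f := F.W) (by fun_prop) 0
  have hA := F.A_pos
  have hb1 : ∀ τ ≥ 0, ∀ x ∈ Icc (0:ℝ) 1, exp (-F.b x τ) ≤ B := fun τ hτ x hx =>
    (exp_le_exp.mpr (neg_le_abs _)).trans (hb τ hτ x hx)
  have hb2 : ∀ τ ≥ 0, ∀ x ∈ Icc (0:ℝ) 1, exp (F.b x τ) ≤ B := fun τ hτ x hx =>
    (exp_le_exp.mpr (le_abs_self _)).trans (hb τ hτ x hx)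
  set E := F.A ^ 2 / 24 + F.A + F.m ^ 2 / 2 with hE
  have hE0 : 0 < E := by positivity
  have hθ' : ∀ τ ≥ 0, ∀ x ∈ Icc (0:ℝ) 1, F.θ x τ ≤ (1 + C) * (1 + F.V τ * F.R τ) := by
    intro τ hτ x hx
    have h1 := le_one_add_rpow (F.θ_pos x τ) (p := 1 + F.β) (by linarith [F.β_pos])
    have h2 := hθ τ hτ x hx
    have h3 : 0 ≤ F.V τ * F.R τ := mul_nonneg (F.V_nonneg τ) (F.R_nonneg τ)
    nlinarith
  set K := B * (1 + C) with hK
  have hK0 : 0 < K := by positivity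
  set n : ℝ → ℝ := fun τ => n0 + ∫ r in (0:ℝ)..τ, K * (exp r * (1 + F.V r * F.R r)) with hn
  have cn' : Continuous fun r => K * (exp r * (1 + F.V r * F.R r)) := by fun_prop
  have dn : ∀ τ, HasDerivAt n (K * (exp τ * (1 + F.V τ * F.R τ))) τ := fun τ =>
    (intervalIntegral.integral_hasDerivAt_right (cn'.intervalIntegrable _ _)
      cn'.stronglyMeasurable.stronglyMeasurableAtFilter cn'.continuousAt).const_add _
  have cn : Continuous n := continuous_iff_continuousAt.mpr fun τ => (dn τ).continuousAt
  have n_0 : n 0 = n0 := by simp [hn]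
  have hWn : ∀ τ ≥ 0, ∀ x ∈ Icc (0:ℝ) 1, exp τ * F.W x τ ≤ n τ := by
    intro τ hτ x hx
    have := anti_of_deriv_nonpos (f := fun τ => exp τ * F.W x τ - n τ)
      (f' := fun τ => exp τ * F.W x τ + exp τ * (-F.W x τ + exp (-F.b x τ) * F.θ x τ)
        - K * (exp τ * (1 + F.V τ * F.R τ))) (a := 0) (b := τ)
      (by apply Continuous.continuousOn; fun_prop)
      (fun r hr => ((Real.hasDerivAt_exp r).mul (F.dW hx hr)).sub (dn r))
      (fun r hr => by
        have h1 := hb1 r hr.le x hx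
        have h2 := hθ' r hr.le x hx
        have h3 : exp (-F.b x r) * F.θ x r ≤ B * ((1 + C) * (1 + F.V r * F.R r)) :=
          mul_le_mul h1 h2 (F.θ_pos x r).le hB.le
        have h4 := exp_pos r
        have := mul_le_mul_of_nonneg_left h3 h4.le
        rw [hK]
        nlinarith) le_rfl hτ
    have h0 := (le_abs_self _).trans (hW0 x hx 0 (by simp))
    simp only [exp_zero, one_mul, n_0] at this
    linarith
  have hUn : ∀ τ ≥ 0, ∀ x ∈ Icc (0:ℝ) 1, exp τ * F.U x τ ≤ B * n τ := by
    intro τ hτ x hx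
    rw [U_eq]
    have h1 := hWn τ hτ x hx
    have h2 : 0 < exp τ * F.W x τ := mul_pos (exp_pos _) (F.W_pos x τ)
    have := mul_le_mul (hb2 τ hτ x hx) h1 h2.le hB.le
    linarith
  have n_pos : ∀ τ ≥ 0, 0 ≤ n τ := fun τ hτ =>
    (mul_pos (exp_pos _) (F.W_pos 0 τ)).le.trans (hWn τ hτ 0 (by simp))
  have hR : ∀ τ ≥ 0, exp τ * F.R τ ≤ E * B * n τ := by
    intro τ hτ
    unfold R
    rw [← intervalIntegral.integral_const_mul]
    calc _ ≤ ∫ x in (0:ℝ)..1, F.θ x τ * (B * n τ) := by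
          apply int_mono (by fun_prop) (by fun_prop)
          intro x hx
          have := mul_le_mul_of_nonneg_left (hUn τ hτ x (Ioo_subset_Icc_self hx))
            (F.θ_pos x τ).le
          linarith
      _ = (∫ x in (0:ℝ)..1, F.θ x τ) * (B * n τ) := by
          rw [intervalIntegral.integral_mul_const]
      _ ≤ E * (B * n τ) := by
          have := n_pos τ hτ
          have := F.int_θ_le hτ
          gcongr
      _ = _ := by ring
  set k := K * E * B / F.A with hk
  have hk0 : 0 < k := by positivity
  have hkA : k * F.A = K * E * B := by rw [hk]; field_simp
  have hn_le : ∀ τ ≥ 0, n τ ≤ (n0 + K) * exp (k * F.H 0) * exp τ := by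
    intro τ hτ
    have := anti_of_deriv_nonpos
      (f := fun τ => n τ * exp (k * F.H τ) - K * exp (k * F.H 0) * exp τ)
      (f' := fun τ => K * (exp τ * (1 + F.V τ * F.R τ)) * exp (k * F.H τ)
        + n τ * (exp (k * F.H τ) * (k * (-F.A * F.V τ))) - K * exp (k * F.H 0) * exp τ)
      (a := 0) (b := τ)
      (by apply Continuous.continuousOn; fun_prop)
      (fun r hr => ((dn r).mul ((F.hasDerivAt_H hr).const_mul k).exp).sub
        ((Real.hasDerivAt_exp r).const_mul _))
      (fun r hr => by
        have h1 := hR r hr.le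
        have h2 := mul_le_mul_of_nonneg_left h1 (mul_nonneg hK0.le (F.V_nonneg r))
        have h3 : exp (k * F.H r) ≤ exp (k * F.H 0) := by
          have := F.H_anti le_rfl hr.le
          gcongr
        have h4 := mul_le_mul_of_nonneg_left h3 (mul_pos hK0 (exp_pos r)).le
        have h5 := mul_le_mul_of_nonneg_left h2 (exp_pos (k * F.H r)).le
        have h6 : n r * (exp (k * F.H r) * (k * (-F.A * F.V r)))
            = -(exp (k * F.H r) * (K * F.V r * (E * B * n r))) := by
          linear_combination (-(n r * exp (k * F.H r) * F.V r)) * hkA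
        rw [h6]
        nlinarith) le_rfl hτ
    simp only [n_0, exp_zero, mul_one] at this
    have h1 : 1 ≤ exp (k * F.H τ) := one_le_exp (mul_nonneg hk0.le (F.H_nonneg τ))
    have h2 := mul_le_mul_of_nonneg_left h1 (n_pos τ hτ)
    have h3 : 1 ≤ exp τ := one_le_exp hτ
    have h4 := mul_le_mul_of_nonneg_left h3 (mul_pos hn0 (exp_pos (k * F.H 0))).le
    have h5 : 0 < K * exp (k * F.H 0) := by positivity
    nlinarith
  refine ⟨B * ((n0 + K) * exp (k * F.H 0)), by positivity, fun τ hτ x hx => ?_⟩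
  have h1 := hUn τ hτ x hx
  have h2 := mul_le_mul_of_nonneg_left (hn_le τ hτ) hB.le
  have h3 : exp τ * F.U x τ ≤ exp τ * (B * ((n0 + K) * exp (k * F.H 0))) := by linarith
  exact le_of_mul_le_mul_left h3 (exp_pos τ)

theorem R_le : ∃ C > 0, ∀ τ ≥ 0, F.R τ ≤ C := by
  obtain ⟨C, hC, hU⟩ := F.U_le
  have hA := F.A_pos
  refine ⟨(F.A ^ 2 / 24 + F.A + F.m ^ 2 / 2) * C, by positivity, fun τ hτ => ?_⟩
  calc F.R τ ≤ ∫ x in (0:ℝ)..1, F.θ x τ * C := by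
        apply int_mono (by fun_prop) (by fun_prop)
        intro x hx
        exact mul_le_mul_of_nonneg_left (hU τ hτ x (Ioo_subset_Icc_self hx)) (F.θ_pos x τ).le
    _ = (∫ x in (0:ℝ)..1, F.θ x τ) * C := by rw [intervalIntegral.integral_mul_const]
    _ ≤ _ := mul_le_mul_of_nonneg_right (F.int_θ_le hτ) hC.le

theorem θ_rpow_le_V : ∃ C > 0, ∀ τ ≥ 0, ∀ x ∈ Icc (0:ℝ) 1,
    F.θ x τ ^ (1 + F.β) ≤ C * (1 + F.V τ) := by
  obtain ⟨C, hC, h⟩ := F.θ_rpow_le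
  obtain ⟨R, hR, hr⟩ := F.R_le
  refine ⟨C * (1 + R), by positivity, fun τ hτ x hx => (h τ hτ x hx).trans ?_⟩
  have h1 := mul_le_mul_of_nonneg_left (hr τ hτ) (F.V_nonneg τ)
  have h2 := F.V_nonneg τ
  rw [mul_assoc]
  gcongr
  nlinarith

end ScaledFlow

theorem rpow_le_add_of_mem {c C z : ℝ} (hc : 0 < c) (h1 : c ≤ z) (h2 : z ≤ C) (p : ℝ) :
    z ^ p ≤ c ^ p + C ^ p := by
  have hz : 0 < z := hc.trans_le h1
  have hC : 0 < C := hz.trans_le h2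
  rcases le_total 0 p with hp | hp
  · have := rpow_le_rpow hz.le h2 hp
    have := rpow_pos_of_pos hc p
    linarith
  · have := rpow_le_rpow_of_nonpos hc h1 hp
    have := rpow_pos_of_pos hC p
    linarith

namespace ScaledFlow

variable (F : ScaledFlow)

theorem exists_small_V : ∃ ε > 0, ∃ c > 0, ∃ C > 0, ∀ τ ≥ 0, F.V τ ≤ ε →
    ∀ x ∈ Icc (0:ℝ) 1, c ≤ F.θ x τ ∧ F.θ x τ ≤ C := by
  obtain ⟨c, hc, C, hC, h⟩ := F.exists_good_point
  obtain ⟨R, hR, hr⟩ := F.R_le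
  have hβ := F.β_pos
  set p := (1 + F.β) / 2 with hp
  have hp0 : 0 < p := by positivity
  have e : ∀ k > (0:ℝ), ∀ c > 0, (c * k ^ (1 / p)) ^ p = c ^ p * k := by
    intro k hk c hc
    rw [mul_rpow hc.le (by positivity), ← rpow_mul hk.le, one_div_mul_cancel hp0.ne', rpow_one]
  have hcp : 0 < c ^ p := by positivity
  refine ⟨(c ^ p / 2) ^ 2 / (p ^ 2 * R), by positivity, c * (1 / 2) ^ (1 / p), by positivity,
    C * 2 ^ (1 / p), by positivity, fun τ hτ hV x hx => ?_⟩
  obtain ⟨y, hy, h1, h2⟩ := h τ hτ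
  have h3 := F.osc_θ_rpow τ hx hy
  rw [← hp] at h3
  have h4 : p ^ 2 * (F.V τ * F.R τ) ≤ (c ^ p / 2) ^ 2 := by
    rw [le_div_iff₀ (by positivity)] at hV
    have := mul_le_mul_of_nonneg_left (hr τ hτ) (F.V_nonneg τ)
    have := mul_le_mul_of_nonneg_left this (sq_nonneg p)
    linarith
  have h5 := abs_le_of_sq_le_sq' (h3.trans h4) (by positivity)
  have h6 : c ^ p ≤ F.θ y τ ^ p := by gcongr
  have h7 : F.θ y τ ^ p ≤ C ^ p := by
    have := F.θ_pos y τ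
    gcongr
  have hx0 := F.θ_pos x τ
  constructor
  · rw [← rpow_le_rpow_iff (by positivity) hx0.le hp0, e _ (by norm_num) _ hc]
    linarith
  · rw [← rpow_le_rpow_iff hx0.le (by positivity) hp0, e _ (by norm_num) _ hC]
    linarith

theorem θ_ge : ∃ c > 0, ∃ C > 0, ∀ τ ≥ 0, ∀ x ∈ Icc (0:ℝ) 1, c - C * F.V τ ≤ F.θ x τ := by
  obtain ⟨ε, hε, c, hc, C, hC, h⟩ := F.exists_small_V
  refine ⟨c, hc, c / ε, by positivity, fun τ hτ x hx => ?_⟩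
  rcases le_total (F.V τ) ε with hV | hV
  · have := (h τ hτ hV x hx).1
    have : 0 ≤ c / ε * F.V τ := mul_nonneg (by positivity) (F.V_nonneg τ)
    linarith
  · have h1 : c / ε * ε ≤ c / ε * F.V τ := by gcongr
    rw [div_mul_cancel₀ _ hε.ne'] at h1
    linarith [F.θ_pos x τ]

theorem int_abs_stress_sq_le (τ : ℝ) :
    (∫ x in (0:ℝ)..1, |F.U x τ * F.s x τ|) ^ 2 ≤ F.V τ * F.R τ := by
  have h := int_mul_sq_le (f := fun x => |F.U x τ * F.s x τ|) (g := fun _ => 1)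
    (w := fun x => F.θ x τ * F.U x τ) (by fun_prop) (by fun_prop) (by fun_prop)
    (fun x => mul_pos (F.θ_pos x τ) (F.U_pos x τ))
  simp only [mul_one, one_pow, one_mul] at h
  refine h.trans (mul_le_mul_of_nonneg_right ?_ (F.R_nonneg τ))
  apply int_mono _ (by fun_prop)
  · intro x _
    have h0 := F.θ_pos x τ
    have h1 := F.U_pos x τ
    have e2 : |F.U x τ * F.s x τ| ^ 2 / (F.θ x τ * F.U x τ) = F.U x τ * F.s x τ ^ 2 / F.θ x τ := by
      rw [sq_abs]
      field_simp
    rw [e2]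
    have : 0 ≤ F.θ x τ ^ (F.β - 2) * F.θx x τ ^ 2 / F.U x τ := by positivity
    linarith
  · exact Continuous.div (by fun_prop) (by fun_prop)
      fun x => (mul_pos (F.θ_pos x τ) (F.U_pos x τ)).ne'

theorem osc_θ_sq_le (τ : ℝ) {x y : ℝ} (hx : x ∈ Icc (0:ℝ) 1) (hy : y ∈ Icc (0:ℝ) 1) :
    (F.θ x τ - F.θ y τ) ^ 2 ≤ F.V τ * ∫ ξ in (0:ℝ)..1, F.θ ξ τ ^ (2 - F.β) * F.U ξ τ := by
  have hpos : ∀ x, 0 < F.θ x τ ^ (2 - F.β) * F.U x τ := fun x =>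
    mul_pos (rpow_pos_of_pos (F.θ_pos x τ) _) (F.U_pos x τ)
  have h := sub_sq_le (h := fun x => F.θ x τ)
    (hx := fun x => F.θx x τ) (w := fun x => F.θ x τ ^ (2 - F.β) * F.U x τ)
    (by fun_prop) (by fun_prop) (by fun_prop) hpos (fun x hx => F.dθx x hx τ) hx hy
  refine h.trans (mul_le_mul_of_nonneg_right ?_ (int_nonneg fun x => (hpos x).le))
  apply int_mono _ (by fun_prop)
  · intro x _
    have h0 := F.θ_pos x τ
    have h1 := F.U_pos x τ
    have e : F.θx x τ ^ 2 / (F.θ x τ ^ (2 - F.β) * F.U x τ)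
        = F.θ x τ ^ (F.β - 2) * F.θx x τ ^ 2 / F.U x τ := by
      rw [show F.β - 2 = -(2 - F.β) by ring, rpow_neg h0.le]
      field_simp
    rw [e]
    have : 0 ≤ F.U x τ * F.s x τ ^ 2 / F.θ x τ := by positivity
    linarith
  · exact Continuous.div (by fun_prop) (by fun_prop) fun x => (hpos x).ne'

theorem integral_affine_energy (m c : ℝ) :
    ∫ x in (0:ℝ)..1, ((m + c * (x - 1 / 2)) ^ 2 / 2 + c) = m ^ 2 / 2 + c ^ 2 / 24 + c := by
  have h := intervalIntegral.integral_eq_sub_of_hasDerivAt (a := 0) (b := 1)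
    (f := fun x => (m - c / 2) ^ 2 / 2 * x + (m - c / 2) * c / 2 * x ^ 2 + c ^ 2 / 6 * x ^ 3 + c * x)
    (f' := fun x => (m + c * (x - 1 / 2)) ^ 2 / 2 + c) (fun x _ => by
      refine (((((hasDerivAt_id x).const_mul _).add ((hasDerivAt_pow 2 x).const_mul _)).add
        ((hasDerivAt_pow 3 x).const_mul _)).add ((hasDerivAt_id x).const_mul _)).congr_deriv ?_
      simp
      ring) (Continuous.intervalIntegrable (by fun_prop) _ _)
  rw [h]
  ring

/-- Closeness to an affine velocity and a constant temperature determines the constants. -/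
theorem exists_H_le (D c : ℝ) (hc : 0 < c) : ∃ K > 0, ∀ τ ≥ 0, ∀ δ ≥ 0, δ ≤ D →
    c ≤ F.θ 0 τ → F.θ 0 τ ≤ D → (∀ x ∈ Icc (0:ℝ) 1, c ≤ F.θ x τ ∧ |F.θ x τ - F.θ 0 τ| ≤ δ) →
    (∫ x in (0:ℝ)..1, |F.U x τ * F.s x τ|) ≤ δ → F.H τ ≤ K * δ ^ 2 := by
  have hA := F.A_pos
  rcases le_or_gt 0 D with hD | hD
  swap
  · exact ⟨1, one_pos, fun τ _ δ h0 h1 => absurd (h0.trans h1) (not_le.mpr hD)⟩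
  set M := 2 * (|F.m| + D) + 2 * D + 1 with hM
  have hM0 : 0 < M := by positivity
  refine ⟨(2 + M) ^ 2 / 2 + (1 + M) ^ 2 / c, by positivity,
    fun τ hτ δ hδ hδD hc1 hc2 h1 h2 => ?_⟩
  set k := F.θ 0 τ with hk
  set e : ℝ → ℝ := fun x => F.v x τ - F.m - k * (x - 1 / 2) with he
  have ce : Continuous e := by fun_prop
  have hosc : ∀ x ∈ Icc (0:ℝ) 1, ∀ y ∈ Icc (0:ℝ) 1, |e x - e y| ≤ 2 * δ := by
    intro x hx y hy
    refine (abs_sub_le_integral (hx := fun x => F.vx x τ - k) ce (by fun_prop) (fun x hx => ?_)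
      hx hy).trans ?_
    · have := ((F.dvx x hx τ).sub_const F.m).sub
        (((hasDerivAt_id x).sub_const (1 / 2)).const_mul k)
      exact this.congr_deriv (by simp)
    · have : ∫ x in (0:ℝ)..1, |F.vx x τ - k| ≤ ∫ x in (0:ℝ)..1, (|F.U x τ * F.s x τ| + δ) := by
        apply int_mono (by fun_prop) (by fun_prop)
        intro x hx
        have := (h1 x (Ioo_subset_Icc_self hx)).2
        rw [vx_eq, add_sub_assoc]
        exact (abs_add_le _ _).trans (by linarith)
      rw [int_add (by fun_prop) (by fun_prop)] at this
      simp only [intervalIntegral.integral_const, sub_zero, one_smul] at this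
      linarith
  have hmean : ∫ x in (0:ℝ)..1, e x = 0 := by
    have h3 : ∫ x in (0:ℝ)..1, k * (x - 1 / 2) = 0 := by
      rw [intervalIntegral.integral_const_mul, int_sub (by fun_prop) (by fun_prop)]
      simp
    rw [he, int_sub (by fun_prop) (by fun_prop), int_sub (by fun_prop) (by fun_prop), h3,
      F.int_v hτ]
    simp
  have heb : ∀ x ∈ Icc (0:ℝ) 1, |e x| ≤ 2 * δ := by
    intro x hx
    have h3 : ∫ y in (0:ℝ)..1, (e x - e y) = e x := by
      rw [int_sub (by fun_prop) (by fun_prop), hmean]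
      simp
    have h4 : ∫ y in (0:ℝ)..1, (e x - e y) ≤ ∫ y in (0:ℝ)..1, 2 * δ :=
      int_mono (by fun_prop) (by fun_prop) fun y hy =>
        (abs_le.mp (hosc x hx y (Ioo_subset_Icc_self hy))).2
    have h5 : ∫ y in (0:ℝ)..1, -(2 * δ) ≤ ∫ y in (0:ℝ)..1, (e x - e y) :=
      int_mono (by fun_prop) (by fun_prop) fun y hy =>
        (abs_le.mp (hosc x hx y (Ioo_subset_Icc_self hy))).1
    rw [h3] at h4 h5
    simp only [intervalIntegral.integral_const, sub_zero, one_smul] at h4 h5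
    exact abs_le.mpr ⟨by linarith, h4⟩
  have hv : ∀ x, F.v x τ = F.m + k * (x - 1 / 2) + e x := by
    intro x
    simp only [he]
    ring
  have hpt : ∀ x ∈ Icc (0:ℝ) 1, |F.v x τ ^ 2 / 2 + F.θ x τ
      - ((F.m + k * (x - 1 / 2)) ^ 2 / 2 + k)| ≤ M * δ := by
    intro x hx
    have h3 : F.v x τ ^ 2 / 2 + F.θ x τ - ((F.m + k * (x - 1 / 2)) ^ 2 / 2 + k)
        = (F.m + k * (x - 1 / 2)) * e x + e x ^ 2 / 2 + (F.θ x τ - k) := by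
      rw [hv]
      ring
    rw [h3]
    have h4 : |F.m + k * (x - 1 / 2)| ≤ |F.m| + D := by
      have h5 : |k * (x - 1 / 2)| ≤ D * 1 := by
        rw [abs_mul]
        have : |x - 1 / 2| ≤ 1 := abs_le.mpr ⟨by linarith [hx.1], by linarith [hx.2]⟩
        have : |k| ≤ D := abs_le.mpr ⟨by linarith, hc2⟩
        gcongr
      exact (abs_add_le _ _).trans (by linarith)
    have h6 : |(F.m + k * (x - 1 / 2)) * e x| ≤ (|F.m| + D) * (2 * δ) := by
      rw [abs_mul]
      exact mul_le_mul h4 (heb x hx) (abs_nonneg _) (by positivity)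
    have h7 : |e x ^ 2 / 2| ≤ 2 * D * δ := by
      have := pow_le_pow_left₀ (abs_nonneg _) (heb x hx) 2
      rw [sq_abs] at this
      rw [abs_of_nonneg (by positivity)]
      nlinarith
    have h8 := (h1 x hx).2
    calc _ ≤ |(F.m + k * (x - 1 / 2)) * e x| + |e x ^ 2 / 2| + |F.θ x τ - k| := abs_add_three _ _ _
      _ ≤ _ := by rw [hM]; linarith
  have hkA : |k - F.A| ≤ M * δ := by
    have h3 := F.int_energy hτ
    have h4 := integral_affine_energy F.m k
    have h5 : ∫ x in (0:ℝ)..1, (F.v x τ ^ 2 / 2 + F.θ x τ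
      - ((F.m + k * (x - 1 / 2)) ^ 2 / 2 + k)) ≤ ∫ x in (0:ℝ)..1, M * δ :=
      int_mono (by fun_prop) (by fun_prop) fun y hy =>
        (abs_le.mp (hpt y (Ioo_subset_Icc_self hy))).2
    have h6 : ∫ x in (0:ℝ)..1, -(M * δ) ≤ ∫ x in (0:ℝ)..1, (F.v x τ ^ 2 / 2 + F.θ x τ
      - ((F.m + k * (x - 1 / 2)) ^ 2 / 2 + k)) :=
      int_mono (by fun_prop) (by fun_prop) fun y hy =>
        (abs_le.mp (hpt y (Ioo_subset_Icc_self hy))).1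
    rw [int_sub (by fun_prop) (by fun_prop), h3, h4] at h5 h6
    simp only [intervalIntegral.integral_const, sub_zero, one_smul] at h5 h6
    have hMδ : 0 ≤ M * δ := by positivity
    rw [abs_le]
    constructor
    · by_contra! hlt
      nlinarith
    · by_contra! hlt
      nlinarith
  have hψ : ∀ x ∈ Icc (0:ℝ) 1, F.psi x τ ^ 2 ≤ ((2 + M) * δ) ^ 2 := by
    intro x hx
    have h3 : F.psi x τ = e x + (k - F.A) * (x - 1 / 2) := by
      simp only [he, psi]
      ring
    have h4 : |F.psi x τ| ≤ (2 + M) * δ := by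
      rw [h3]
      refine (abs_add_le _ _).trans ?_
      have h5 := heb x hx
      have h6 : |x - 1 / 2| ≤ 1 := abs_le.mpr ⟨by linarith [hx.1], by linarith [hx.2]⟩
      have h7 : |(k - F.A) * (x - 1 / 2)| ≤ M * δ * 1 := by
        rw [abs_mul]
        exact mul_le_mul hkA h6 (abs_nonneg _) (by positivity)
      linarith
    rw [← sq_abs (F.psi x τ)]
    exact pow_le_pow_left₀ (abs_nonneg _) h4 2
  have hφ : ∀ x ∈ Icc (0:ℝ) 1, F.phi (F.θ x τ) ≤ ((1 + M) * δ) ^ 2 / c := by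
    intro x hx
    obtain ⟨h3, h4⟩ := h1 x hx
    refine (F.phi_le (F.θ_pos x τ)).trans ?_
    have h5 : |F.θ x τ - F.A| ≤ (1 + M) * δ := by
      have := abs_sub_le (F.θ x τ) k F.A
      linarith
    rw [← sq_abs]
    gcongr
  calc F.H τ ≤ ∫ x in (0:ℝ)..1, (((2 + M) * δ) ^ 2 / 2 + ((1 + M) * δ) ^ 2 / c) := by
        apply int_mono (by fun_prop) (by fun_prop)
        intro x hx
        have := hψ x (Ioo_subset_Icc_self hx)
        have := hφ x (Ioo_subset_Icc_self hx)
        linarith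
    _ = _ := by
        simp
        ring

theorem H_le_V : ∃ K > 0, ∀ τ ≥ 0, F.H τ ≤ K * F.V τ := by
  obtain ⟨ε, hε, c, hc, C, hC, h⟩ := F.exists_small_V
  obtain ⟨R, hR, hr⟩ := F.R_le
  obtain ⟨B, hB, hb⟩ := F.U_le
  set N := (c ^ (2 - F.β) + C ^ (2 - F.β)) * B + R with hN
  have hN0 : 0 < N := by positivity
  obtain ⟨K, hK, hk⟩ := F.exists_H_le (C + √(N * ε)) c hc
  have hH0 := F.H_nonneg 0
  refine ⟨K * N + F.H 0 / ε, by positivity, fun τ hτ => ?_⟩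
  have hV0 := F.V_nonneg τ
  rcases le_total (F.V τ) ε with hV | hV
  · have h1 := hk τ hτ √(N * F.V τ) (sqrt_nonneg _)
      ((Real.sqrt_le_sqrt (mul_le_mul_of_nonneg_left hV hN0.le)).trans (by linarith)) (h τ hτ hV 0 (by simp)).1
      ((h τ hτ hV 0 (by simp)).2.trans (by linarith [sqrt_nonneg (N * ε)]))
      (fun x hx => ⟨(h τ hτ hV x hx).1, by
        apply Real.abs_le_sqrt
        refine (F.osc_θ_sq_le τ hx (by simp)).trans ?_
        rw [mul_comm]
        gcongr
        calc _ ≤ ∫ x in (0:ℝ)..1, (c ^ (2 - F.β) + C ^ (2 - F.β)) * B := by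
              apply int_mono (by fun_prop) (by fun_prop)
              intro x hx
              have hx := Ioo_subset_Icc_self hx
              have h1 := h τ hτ hV x hx
              exact mul_le_mul (rpow_le_add_of_mem hc h1.1 h1.2 _) (hb τ hτ x hx)
                (F.U_pos x τ).le (by positivity)
          _ ≤ N := by
              simp
              linarith⟩)
      (by
        apply (le_abs_self _).trans
        apply Real.abs_le_sqrt
        refine (F.int_abs_stress_sq_le τ).trans ?_
        rw [mul_comm]
        gcongr
        refine (hr τ hτ).trans ?_
        rw [hN]
        have : 0 < (c ^ (2 - F.β) + C ^ (2 - F.β)) * B := by positivity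
        linarith)
    rw [Real.sq_sqrt (by positivity)] at h1
    have : 0 ≤ F.H 0 / ε * F.V τ := by positivity
    linarith
  · have h1 := F.H_anti le_rfl hτ
    have h2 : F.H 0 / ε * ε ≤ F.H 0 / ε * F.V τ := by gcongr
    rw [div_mul_cancel₀ _ hε.ne'] at h2
    have : 0 ≤ K * N * F.V τ := by positivity
    linarith

/-- Exponential decay of the Lyapunov functional. -/
theorem H_decay : ∃ μ > 0, μ < 1 ∧ ∃ C > 0, ∀ τ ≥ 0, F.H τ ≤ C * exp (-μ * τ) := by
  obtain ⟨K, hK, h⟩ := F.H_le_V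
  have hA := F.A_pos
  set μ := min (F.A / K) (1 / 2) with hμ
  have hμ0 : 0 < μ := by positivity
  have hμK : μ * K ≤ F.A := by
    rw [← le_div_iff₀ hK]
    exact min_le_left _ _
  refine ⟨μ, hμ0, (min_le_right _ _).trans_lt (by norm_num), F.H 0 + 1,
    by linarith [F.H_nonneg 0], fun τ hτ => ?_⟩
  have := anti_of_deriv_nonpos (f := fun τ => exp (μ * τ) * F.H τ)
    (f' := fun τ => exp (μ * τ) * (μ * 1) * F.H τ + exp (μ * τ) * (-F.A * F.V τ))
    (a := 0) (b := τ) (by apply Continuous.continuousOn; fun_prop)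
    (fun r hr => ((hasDerivAt_id r).const_mul μ).exp.mul (F.hasDerivAt_H hr))
    (fun r hr => by
      have h1 := mul_le_mul_of_nonneg_left (h r hr.le) hμ0.le
      have h2 := mul_le_mul_of_nonneg_right hμK (F.V_nonneg r)
      have h3 : μ * F.H r - F.A * F.V r ≤ 0 := by linarith
      have := mul_nonpos_of_nonneg_of_nonpos (exp_pos (μ * r)).le h3
      linarith) le_rfl hτ
  simp only [mul_zero, exp_zero, one_mul] at this
  rw [neg_mul, exp_neg, ← div_eq_mul_inv, le_div_iff₀ (exp_pos _)]
  linarith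

/-- In every unit time interval there is a time of small dissipation. -/
theorem exists_good_time : ∃ μ > 0, μ < 1 ∧ ∃ C > 0, (∀ τ ≥ 0, F.H τ ≤ C * exp (-μ * τ)) ∧
    ∀ τ ≥ 1, ∃ r > 0, τ - 1 ≤ r ∧ r ≤ τ ∧ F.V r ≤ C * exp (-μ * τ) := by
  obtain ⟨μ, hμ, hμ1, C, hC, h⟩ := F.H_decay
  have hA := F.A_pos
  refine ⟨μ, hμ, hμ1, C + C * exp μ / F.A, by positivity, fun τ hτ => (h τ hτ).trans ?_,
    fun τ hτ => ?_⟩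
  · gcongr
    have : 0 < C * exp μ / F.A := by positivity
    linarith
  · obtain ⟨r, hr, he⟩ := exists_hasDerivAt_eq_slope F.H (fun r => -F.A * F.V r)
      (a := τ - 1) (b := τ) (by linarith) F.continuous_H.continuousOn
      (fun x hx => F.hasDerivAt_H (by linarith [hx.1]))
    refine ⟨r, by linarith [hr.1], hr.1.le, hr.2.le, ?_⟩
    have h1 := h (τ - 1) (by linarith)
    have h2 := F.H_nonneg τ
    rw [show -μ * (τ - 1) = μ + -μ * τ by ring, exp_add] at h1
    simp only [sub_sub_cancel, div_one] at he
    have h3 : F.A * F.V r ≤ C * exp μ * exp (-μ * τ) := by linarith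
    rw [mul_comm, ← le_div_iff₀ hA] at h3
    have h4 : C * exp μ * exp (-μ * τ) / F.A = C * exp μ / F.A * exp (-μ * τ) := by ring
    have h5 : 0 < C * exp (-μ * τ) := by positivity
    linarith

end ScaledFlow

/-- A positive continuous function bounded below up to an exponentially decaying error is bounded
below. -/
theorem exists_pos_le {f : ℝ → ℝ → ℝ} (cf : Continuous fun p : ℝ × ℝ => f p.1 p.2)
    (hf : ∀ x τ, 0 < f x τ) {c C μ : ℝ} (hc : 0 < c) (hC : 0 < C) (hμ : 0 < μ)
    (h : ∀ τ ≥ 0, ∀ x ∈ Icc (0:ℝ) 1, c - C * exp (-μ * τ) ≤ f x τ) :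
    ∃ k > 0, ∀ τ ≥ 0, ∀ x ∈ Icc (0:ℝ) 1, k ≤ f x τ := by
  set T := 2 * C / (c * μ) with hT
  obtain ⟨B, hB, hb⟩ := exists_bound (f := fun x τ => (f x τ)⁻¹)
    (cf.inv₀ fun p => (hf _ _).ne') T
  refine ⟨min (c / 2) B⁻¹, by positivity, fun τ hτ x hx => ?_⟩
  rcases le_total τ T with h1 | h1
  · have h2 := (le_abs_self _).trans (hb x hx τ ⟨hτ, h1⟩)
    exact (min_le_right _ _).trans ((inv_le_comm₀ (hf x τ) hB).mp h2)
  · refine (min_le_left _ _).trans (le_trans ?_ (h τ hτ x hx))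
    have h2 : C * exp (-μ * τ) ≤ c / 2 := by
      rw [neg_mul, exp_neg, ← div_eq_mul_inv, div_le_iff₀ (exp_pos _)]
      have h3 := add_one_le_exp (μ * τ)
      have h4 : T * μ * (c / 2) = C := by
        rw [hT]
        field_simp
      have h5 : T * μ * (c / 2) ≤ τ * μ * (c / 2) := by gcongr
      nlinarith
    linarith

theorem exists_uniform_bound {f Φ : ℝ → ℝ} (cf : Continuous f) (cΦ : Continuous Φ)
    (hf : ∀ τ > 0, DifferentiableAt ℝ f τ) (hΦ : ∀ τ > 0, DifferentiableAt ℝ Φ τ)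
    (f0 : ∀ τ, 0 ≤ f τ) {B C K : ℝ} (hC : 0 ≤ C) (bΦ : ∀ τ ≥ 0, |Φ τ| ≤ B)
    (hd : ∀ τ > 0, deriv f τ ≤ (C - deriv Φ τ) * (1 + f τ))
    (hg : ∀ τ ≥ 1, ∃ r > 0, τ - 1 ≤ r ∧ r ≤ τ ∧ f r ≤ K) : ∃ M > 0, ∀ τ ≥ 0, f τ ≤ M := by
  obtain ⟨N, hN, hn⟩ := exists_bound_one cf 1
  have hK : 0 ≤ K := by
    obtain ⟨r, _, _, _, h⟩ := hg 1 le_rfl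
    exact (f0 r).trans h
  refine ⟨N + (1 + K) * exp (C + 2 * B), by positivity, fun τ hτ => ?_⟩
  rcases le_total τ 1 with h1 | h1
  · have := (le_abs_self _).trans (hn τ ⟨hτ, h1⟩)
    have : 0 ≤ (1 + K) * exp (C + 2 * B) := by positivity
    linarith
  · obtain ⟨r, hr, h2, h3, h4⟩ := hg τ h1
    have h5 := anti_of_deriv_nonpos (f := fun τ => (1 + f τ) * exp (-(C * τ) + Φ τ))
      (f' := fun τ => deriv f τ * exp (-(C * τ) + Φ τ)
        + (1 + f τ) * (exp (-(C * τ) + Φ τ) * (-(C * 1) + deriv Φ τ))) (a := r) (b := τ)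
      (by apply Continuous.continuousOn; fun_prop)
      (fun t ht => ((hf t ht).hasDerivAt.const_add 1).mul
        (((hasDerivAt_id t).const_mul C).neg.add (hΦ t ht).hasDerivAt).exp)
      (fun t ht => by
        have h := mul_le_mul_of_nonneg_right (hd t ht) (exp_pos (-(C * t) + Φ t)).le
        linarith) hr.le h3
    have h6 : (1 + f τ) * exp (-(C * τ) + Φ τ) * exp (C * τ - Φ τ) = 1 + f τ := by
      rw [mul_assoc, ← exp_add]
      simp
    have h7 := mul_le_mul_of_nonneg_right h5 (exp_pos (C * τ - Φ τ)).le
    rw [h6, mul_assoc, ← exp_add] at h7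
    have h8 : -(C * r) + Φ r + (C * τ - Φ τ) ≤ C + 2 * B := by
      have := (abs_le.mp (bΦ r hr.le)).2
      have := (abs_le.mp (bΦ τ hτ)).1
      nlinarith
    have h9 := exp_le_exp.mpr h8
    have h10 := mul_le_mul (add_le_add_right h4 1) h9 (exp_pos _).le (by positivity)
    linarith

namespace ScaledFlow

variable (F : ScaledFlow)

theorem U_ge : ∃ c > 0, ∀ τ ≥ 0, ∀ x ∈ Icc (0:ℝ) 1, c ≤ F.U x τ := by
  obtain ⟨B, hB, hb⟩ := F.exists_b_bound
  obtain ⟨c, hc, C, hC, hθ⟩ := F.θ_ge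
  obtain ⟨μ, hμ, hμ1, N, hN, hH⟩ := F.H_decay
  have hA := F.A_pos
  have hb1 : ∀ τ ≥ 0, ∀ x ∈ Icc (0:ℝ) 1, B⁻¹ ≤ exp (-F.b x τ) := fun τ hτ x hx => by
    rw [exp_neg]
    exact inv_anti₀ (exp_pos _) ((exp_le_exp.mpr (le_abs_self _)).trans (hb τ hτ x hx))
  set k := C / (B * F.A) with hk
  have hk0 : 0 < k := by positivity
  have hkA : k * F.A = B⁻¹ * C := by
    rw [hk]
    field_simp
  have h1μ : 0 < 1 - μ := by linarith
  have hW : ∀ τ ≥ 0, ∀ x ∈ Icc (0:ℝ) 1,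
      B⁻¹ * c - (k * N / (1 - μ) + B⁻¹ * c + k * F.H 0) * exp (-μ * τ) ≤ F.W x τ := by
    intro τ hτ x hx
    have h := anti_of_deriv_nonpos
      (f := fun τ => B⁻¹ * c * exp τ - k * N / (1 - μ) * exp ((1 - μ) * τ)
        - exp τ * (F.W x τ - k * F.H τ))
      (f' := fun τ => B⁻¹ * c * exp τ - k * N / (1 - μ) * (exp ((1 - μ) * τ) * ((1 - μ) * 1))
        - (exp τ * (F.W x τ - k * F.H τ)
          + exp τ * ((-F.W x τ + exp (-F.b x τ) * F.θ x τ) - k * (-F.A * F.V τ))))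
      (a := 0) (b := τ)
      (by apply Continuous.continuousOn; fun_prop)
      (fun r hr => (((Real.hasDerivAt_exp r).const_mul _).sub
        (((hasDerivAt_id r).const_mul (1 - μ)).exp.const_mul _)).sub
        ((Real.hasDerivAt_exp r).mul ((F.dW hx hr).sub ((F.hasDerivAt_H hr).const_mul k))))
      (fun r hr => by
        have h1 := hb1 r hr.le x hx
        have h2 := hθ r hr.le x hx
        have h3 := mul_le_mul_of_nonneg_right h1 (F.θ_pos x r).le
        have h4 := mul_le_mul_of_nonneg_left h2 (inv_pos.mpr hB).le
        have h5 := mul_le_mul_of_nonneg_left (hH r hr.le) hk0.le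
        have h6 : k * N / (1 - μ) * (exp ((1 - μ) * r) * ((1 - μ) * 1))
            = exp r * (k * (N * exp (-μ * r))) := by
          rw [show (1 - μ) * r = r + -μ * r by ring, exp_add]
          field_simp
        have h7 : B⁻¹ * c - k * (N * exp (-μ * r)) + k * F.H r - exp (-F.b x r) * F.θ x r
            - k * F.A * F.V r ≤ 0 := by
          rw [hkA]
          linarith
        have := mul_nonpos_of_nonneg_of_nonpos (exp_pos r).le h7
        rw [h6]
        linarith) le_rfl hτ
    simp only [mul_zero, exp_zero, mul_one, one_mul] at h
    have h0 := F.W_pos x 0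
    have e1 : exp ((1 - μ) * τ) = exp τ * exp (-μ * τ) := by
      rw [← exp_add]
      ring_nf
    have e2 : 1 ≤ exp τ * exp (-μ * τ) := by
      rw [← e1]
      exact one_le_exp (by positivity)
    rw [e1] at h
    have h8 : 0 ≤ exp τ * (k * F.H τ) := mul_nonneg (exp_pos τ).le
      (mul_nonneg hk0.le (F.H_nonneg τ))
    have h10 : 0 ≤ B⁻¹ * c + k * F.H 0 := by
      have := F.H_nonneg 0
      positivity
    have h11 := mul_le_mul_of_nonneg_left e2 h10
    have h12 : 0 < k * N / (1 - μ) := by positivity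
    have h9 : exp τ * (B⁻¹ * c - (k * N / (1 - μ) + B⁻¹ * c + k * F.H 0) * exp (-μ * τ))
        ≤ exp τ * F.W x τ := by
      linarith
    exact le_of_mul_le_mul_left h9 (exp_pos τ)
  have hH0 := F.H_nonneg 0
  obtain ⟨w, hw, h⟩ := exists_pos_le (by fun_prop) F.W_pos (by positivity) (by positivity) hμ hW
  refine ⟨B⁻¹ * w, by positivity, fun τ hτ x hx => ?_⟩
  rw [U_eq]
  have h1 : B⁻¹ ≤ exp (F.b x τ) := by
    rw [← neg_neg (F.b x τ), exp_neg]
    exact inv_anti₀ (exp_pos _) ((exp_le_exp.mpr (neg_le_abs _)).trans (hb τ hτ x hx))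
  exact mul_le_mul h1 (h τ hτ x hx) hw.le (exp_pos _).le

/-- The weighted `L²` norm of the stress. -/
noncomputable def y (τ : ℝ) : ℝ := ∫ x in (0:ℝ)..1, F.U x τ * F.s x τ ^ 2
/-- The weighted `L²` norm of the heat flux. -/
noncomputable def z (τ : ℝ) : ℝ := ∫ x in (0:ℝ)..1, F.U x τ * F.q x τ ^ 2
/-- The `(2+β)`-th moment of the temperature. -/
noncomputable def Th (τ : ℝ) : ℝ := ∫ x in (0:ℝ)..1, F.θ x τ ^ (2 + F.β)
/-- The `L²` norm of the acceleration. -/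
noncomputable def D (τ : ℝ) : ℝ := ∫ x in (0:ℝ)..1, F.sx x τ ^ 2

@[fun_prop] theorem continuous_y : Continuous F.y := continuous_int (by fun_prop)
@[fun_prop] theorem continuous_z : Continuous F.z := continuous_int (by fun_prop)
@[fun_prop] theorem continuous_Th : Continuous F.Th := continuous_int (by fun_prop)

theorem y_nonneg (τ : ℝ) : 0 ≤ F.y τ :=
  int_nonneg fun x => mul_nonneg (F.U_pos x τ).le (sq_nonneg _)
theorem z_nonneg (τ : ℝ) : 0 ≤ F.z τ :=
  int_nonneg fun x => mul_nonneg (F.U_pos x τ).le (sq_nonneg _)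
theorem Th_nonneg (τ : ℝ) : 0 ≤ F.Th τ := int_nonneg fun x => rpow_nonneg (F.θ_pos x τ).le _
theorem D_nonneg (τ : ℝ) : 0 ≤ F.D τ := int_nonneg fun _ => sq_nonneg _

theorem hasDerivAt_y {τ : ℝ} (hτ : 0 < τ) : HasDerivAt F.y
    (-2 * F.D τ + 2 * (∫ x in (0:ℝ)..1, F.sx x τ * F.q x τ)
      - 3 * (∫ x in (0:ℝ)..1, F.s x τ ^ 2 * F.vx x τ) + F.y τ) τ := by
  have h := hasDerivAt_weighted (f := F.v) (fx := F.vx) (ft := F.sx) (k := F.θ)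
    (kt := fun x τ => F.qx x τ + F.s x τ * F.vx x τ) (U := F.U)
    (Ut := fun x τ => F.vx x τ - F.U x τ) (s := F.s) (sx := F.sx) F.cv F.cvx F.csx F.cθ
    (by fun_prop) F.cU (by fun_prop) (by fun_prop) F.csx
    (fun x τ => by rw [vx_eq]; ring) F.s_zero F.s_one F.dvx F.ds F.dvτ F.dθ F.dUτ hτ
  refine h.congr_deriv ?_
  have h1 := int_parts (f := fun x => F.s x τ) (f' := fun x => F.sx x τ) (g := fun x => F.q x τ)
    (g' := fun x => F.qx x τ) (by fun_prop) (by fun_prop) (by fun_prop) (by fun_prop)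
    (fun x hx => F.ds x hx τ) (fun x hx => F.dq x hx τ)
  simp only [F.s_zero, F.s_one, zero_mul, sub_zero, zero_sub] at h1
  have h2 : ∫ x in (0:ℝ)..1, F.sx x τ * F.q x τ = - ∫ x in (0:ℝ)..1, F.s x τ * F.qx x τ := by
    rw [h1, neg_neg]
  rw [h2]
  unfold D y
  simp only [← intervalIntegral.integral_const_mul, ← intervalIntegral.integral_neg]
  rw [← int_add (by fun_prop) (by fun_prop), ← int_sub (by fun_prop) (by fun_prop),
    ← int_add (by fun_prop) (by fun_prop)]
  exact int_congr fun x _ => by ring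

theorem hasDerivAt_z {τ : ℝ} (hτ : 0 < τ) : HasDerivAt F.z
    (∫ x in (0:ℝ)..1, (-2 * F.qx x τ * (F.θ x τ ^ F.β * (F.qx x τ + F.s x τ * F.vx x τ))
      - F.q x τ ^ 2 * (F.vx x τ - F.U x τ))) τ := by
  have hβ := F.β_pos
  have hb : (1 + F.β) ≠ 0 := by positivity
  have h := hasDerivAt_weighted (f := fun x τ => F.θ x τ ^ (1 + F.β) / (1 + F.β))
    (fx := fun x τ => F.θ x τ ^ F.β * F.θx x τ)
    (ft := fun x τ => F.θ x τ ^ F.β * (F.qx x τ + F.s x τ * F.vx x τ)) (k := fun _ _ => 0)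
    (kt := fun x τ => 0) (U := F.U)
    (Ut := fun x τ => F.vx x τ - F.U x τ) (s := F.q) (sx := F.qx) (by fun_prop) (by fun_prop)
    (by fun_prop) (by fun_prop) (by fun_prop) F.cU (by fun_prop) (by fun_prop) F.cqx
    (fun x τ => by rw [U_mul_q, sub_zero]) F.q_zero F.q_one
    (fun x hx τ => by
      refine (((F.dθx x hx τ).rpow_const (p := 1 + F.β)
        (Or.inl (F.θ_ne x τ))).div_const (1 + F.β)).congr_deriv ?_
      rw [add_sub_cancel_left]
      field_simp) F.dq
    (fun x τ hτ => by
      refine (((F.dθ x τ hτ).rpow_const (p := 1 + F.β)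
        (Or.inl (F.θ_ne x τ))).div_const (1 + F.β)).congr_deriv ?_
      rw [add_sub_cancel_left]
      field_simp) (fun x τ _ => hasDerivAt_const τ _) F.dUτ hτ
  refine h.congr_deriv (int_congr fun x _ => by ring)

theorem hasDerivAt_Th {τ : ℝ} (hτ : 0 < τ) : HasDerivAt F.Th
    (-(2 + F.β) * (1 + F.β) * F.z τ + (2 + F.β) *
      ∫ x in (0:ℝ)..1, F.θ x τ ^ (1 + F.β) * (F.s x τ * F.vx x τ)) τ := by
  have h := hasDerivAt_int (f := fun x τ => F.θ x τ ^ (2 + F.β))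
    (g := fun x τ => (2 + F.β) * (F.θ x τ ^ (1 + F.β) * F.qx x τ)
      + (2 + F.β) * (F.θ x τ ^ (1 + F.β) * (F.s x τ * F.vx x τ)))
    (by fun_prop) (by fun_prop) (fun x _ τ hτ => by
      refine ((F.dθ x τ hτ).rpow_const (p := 2 + F.β) (Or.inl (F.θ_ne x τ))).congr_deriv ?_
      rw [show 2 + F.β - 1 = 1 + F.β by ring]
      ring) hτ
  refine h.congr_deriv ?_
  have h1 := int_parts (f := fun x => F.θ x τ ^ (1 + F.β))
    (f' := fun x => (1 + F.β) * (F.θ x τ ^ F.β * F.θx x τ)) (g := fun x => F.q x τ)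
    (g' := fun x => F.qx x τ) (by fun_prop) (by fun_prop) (by fun_prop) (by fun_prop)
    (fun x hx => by
      refine ((F.dθx x hx τ).rpow_const (p := 1 + F.β)
        (Or.inl (F.θ_ne x τ))).congr_deriv ?_
      rw [add_sub_cancel_left]
      ring) (fun x hx => F.dq x hx τ)
  simp only [F.q_zero, F.q_one, mul_zero, sub_zero, zero_sub] at h1
  rw [int_add (by fun_prop) (by fun_prop), intervalIntegral.integral_const_mul,
    intervalIntegral.integral_const_mul, h1, add_left_inj]
  rw [neg_mul, neg_mul, mul_neg, mul_assoc]
  congr 2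
  unfold z
  rw [← intervalIntegral.integral_const_mul]
  refine int_congr fun x _ => ?_
  rw [← U_mul_q]
  ring

theorem s_sq_le (τ : ℝ) {x : ℝ} (hx : x ∈ Icc (0:ℝ) 1) : F.s x τ ^ 2 ≤ F.D τ := by
  have h := sub_sq_le (h := fun x => F.s x τ) (hx := fun x => F.sx x τ) (w := fun _ => 1)
    (by fun_prop) (by fun_prop) (by fun_prop) (fun _ => one_pos) (fun x hx => F.ds x hx τ) hx
    (y := 0) (by simp)
  simp only [F.s_zero, sub_zero, div_one, intervalIntegral.integral_const, smul_eq_mul,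
    mul_one] at h
  exact h

theorem mul_s_sq_le (τ k : ℝ) {x : ℝ} (hx : x ∈ Icc (0:ℝ) 1) :
    k * F.s x τ ^ 2 ≤ F.D τ / 2 + 2 * k ^ 2 * ∫ x in (0:ℝ)..1, F.s x τ ^ 2 := by
  have h := abs_sub_le_integral (h := fun x => k * F.s x τ ^ 2)
    (hx := fun x => k * (2 * F.s x τ * F.sx x τ))
    (by fun_prop) (by fun_prop) (fun x hx => by
      refine (((F.ds x hx τ).pow 2).const_mul k).congr_deriv ?_
      simp) hx (y := 0) (by simp)
  simp only [F.s_zero, ne_eq, OfNat.ofNat_ne_zero, not_false_eq_true, zero_pow, mul_zero,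
    sub_zero] at h
  refine (le_abs_self _).trans (h.trans ?_)
  unfold D
  rw [div_eq_mul_inv, ← intervalIntegral.integral_mul_const,
    ← intervalIntegral.integral_const_mul, ← int_add (by fun_prop) (by fun_prop)]
  refine int_mono (by fun_prop) (by fun_prop) fun x _ => ?_
  rw [abs_le]
  constructor
  · nlinarith [sq_nonneg (F.sx x τ + 2 * k * F.s x τ)]
  · nlinarith [sq_nonneg (F.sx x τ - 2 * k * F.s x τ)]

theorem int_cube_le : ∃ C > 0, ∀ τ ≥ 0,
    3 * ∫ x in (0:ℝ)..1, F.U x τ * |F.s x τ| ^ 3 ≤ F.D τ / 2 + C * F.V τ * F.y τ := by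
  obtain ⟨R, hR, hr⟩ := F.R_le
  obtain ⟨c, hc, hU⟩ := F.U_ge
  refine ⟨18 * R / c, by positivity, fun τ hτ => ?_⟩
  obtain ⟨m, hm, hmax⟩ := isCompact_Icc.exists_isMaxOn (nonempty_Icc.mpr zero_le_one)
    (f := fun x => F.s x τ ^ 2) (by fun_prop : Continuous _).continuousOn
  set k := 3 * ∫ x in (0:ℝ)..1, |F.U x τ * F.s x τ| with hk
  have h1 : 3 * ∫ x in (0:ℝ)..1, F.U x τ * |F.s x τ| ^ 3 ≤ k * F.s m τ ^ 2 := by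
    rw [hk, mul_assoc, ← intervalIntegral.integral_mul_const]
    refine mul_le_mul_of_nonneg_left (int_mono (by fun_prop) (by fun_prop) fun x hx => ?_)
      (by norm_num)
    have h2 : F.s x τ ^ 2 ≤ F.s m τ ^ 2 := hmax (Ioo_subset_Icc_self hx)
    have h3 : F.U x τ * |F.s x τ| ^ 3 = |F.U x τ * F.s x τ| * F.s x τ ^ 2 := by
      rw [abs_mul, abs_of_pos (F.U_pos x τ), ← sq_abs (F.s x τ)]
      ring
    rw [h3]
    gcongr
  have h2 := F.mul_s_sq_le τ k hm
  have h3 : k ^ 2 ≤ 9 * (F.V τ * R) := by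
    rw [hk, mul_pow]
    have := F.int_abs_stress_sq_le τ
    have := mul_le_mul_of_nonneg_left (hr τ hτ) (F.V_nonneg τ)
    linarith
  have h4 : c * ∫ x in (0:ℝ)..1, F.s x τ ^ 2 ≤ F.y τ := by
    rw [← intervalIntegral.integral_const_mul]
    refine int_mono (by fun_prop) (by fun_prop) fun x hx => ?_
    have := hU τ hτ x (Ioo_subset_Icc_self hx)
    gcongr
  have h5 : ∫ x in (0:ℝ)..1, F.s x τ ^ 2 ≤ F.y τ / c := by
    rw [le_div_iff₀ hc]
    linarith
  have h6 := mul_le_mul h3 h5 (int_nonneg fun x => sq_nonneg _)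
    (by have := F.V_nonneg τ; positivity)
  have h7 : 18 * R / c * F.V τ * F.y τ = 2 * (9 * (F.V τ * R) * (F.y τ / c)) := by ring
  rw [h7]
  linarith

/-- The basic inequality for the stress energy. -/
theorem deriv_y_le : ∃ C > 0, ∀ τ > 0, deriv F.y τ
    ≤ -(F.D τ / 2) + (∫ x in (0:ℝ)..1, F.q x τ ^ 2) + F.y τ + C * F.V τ * F.y τ := by
  obtain ⟨C, hC, h⟩ := F.int_cube_le
  refine ⟨C, hC, fun τ hτ => ?_⟩
  rw [(F.hasDerivAt_y hτ).deriv]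
  have h1 := h τ hτ.le
  have h2 : 2 * ∫ x in (0:ℝ)..1, F.sx x τ * F.q x τ
      ≤ F.D τ + ∫ x in (0:ℝ)..1, F.q x τ ^ 2 := by
    unfold D
    rw [← int_add (by fun_prop) (by fun_prop), ← intervalIntegral.integral_const_mul]
    refine int_mono (by fun_prop) (by fun_prop) fun x _ => ?_
    nlinarith [sq_nonneg (F.sx x τ - F.q x τ)]
  have h3 : -(∫ x in (0:ℝ)..1, F.s x τ ^ 2 * F.vx x τ)
      ≤ ∫ x in (0:ℝ)..1, F.U x τ * |F.s x τ| ^ 3 := by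
    rw [← intervalIntegral.integral_neg]
    refine int_mono (by fun_prop) (by fun_prop) fun x _ => ?_
    have h4 : F.U x τ * |F.s x τ| ^ 3 = F.U x τ * F.s x τ ^ 2 * |F.s x τ| := by
      rw [← sq_abs (F.s x τ)]
      ring
    rw [vx_eq, h4]
    have h5 := F.U_pos x τ
    have h6 := F.θ_pos x τ
    have h7 : 0 ≤ F.U x τ * F.s x τ ^ 2 := by positivity
    have h8 : 0 ≤ F.s x τ ^ 2 * F.θ x τ := by positivity
    have := mul_le_mul_of_nonneg_left (neg_le_abs (F.s x τ)) h7
    linarith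
  linarith

end ScaledFlow

theorem rpow_le_one_add_rpow {z p q : ℝ} (hz : 0 < z) (hp : 0 ≤ p) (hpq : p ≤ q) :
    z ^ p ≤ 1 + z ^ q := by
  rcases le_total z 1 with h | h
  · have := rpow_nonneg hz.le q
    have := rpow_le_one hz.le h hp
    linarith
  · have := rpow_le_rpow_of_exponent_le h hpq
    linarith

namespace ScaledFlow

variable (F : ScaledFlow)

theorem y_le_V {τ M : ℝ} (h : ∀ x ∈ Icc (0:ℝ) 1, F.θ x τ ≤ M) : F.y τ ≤ M * F.V τ := by
  unfold y V
  rw [← intervalIntegral.integral_const_mul]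
  refine int_mono (by fun_prop) (by fun_prop) fun x hx => ?_
  have h0 := F.θ_pos x τ
  have h1 := F.U_pos x τ
  have h2 := h x (Ioo_subset_Icc_self hx)
  have h3 : 0 ≤ F.U x τ * F.s x τ ^ 2 / F.θ x τ := by positivity
  have h4 : 0 ≤ F.θ x τ ^ (F.β - 2) * F.θx x τ ^ 2 / F.U x τ := by positivity
  have h5 : F.U x τ * F.s x τ ^ 2 = F.θ x τ * (F.U x τ * F.s x τ ^ 2 / F.θ x τ) := by
    field_simp
  refine h5.trans_le ?_
  exact mul_le_mul h2 (by linarith) h3 (h0.le.trans h2)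

theorem z_le_V {τ M : ℝ} (h : ∀ x ∈ Icc (0:ℝ) 1, F.θ x τ ≤ M) :
    F.z τ ≤ M ^ (2 + F.β) * F.V τ := by
  unfold z V
  rw [← intervalIntegral.integral_const_mul]
  refine int_mono (by fun_prop) (by fun_prop) fun x hx => ?_
  have h0 := F.θ_pos x τ
  have h1 := F.U_pos x τ
  have h2 := h x (Ioo_subset_Icc_self hx)
  have hβ := F.β_pos
  have h3 : 0 ≤ F.U x τ * F.s x τ ^ 2 / F.θ x τ := by positivity
  have h4 : 0 ≤ F.θ x τ ^ (F.β - 2) * F.θx x τ ^ 2 / F.U x τ := by positivity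
  have h5 : F.U x τ * F.q x τ ^ 2
      = F.θ x τ ^ (2 + F.β) * (F.θ x τ ^ (F.β - 2) * F.θx x τ ^ 2 / F.U x τ) := by
    have e : F.θ x τ ^ (2 + F.β) * F.θ x τ ^ (F.β - 2) = F.θ x τ ^ F.β * F.θ x τ ^ F.β := by
      rw [← rpow_add h0, ← rpow_add h0]
      ring_nf
    rw [mul_div_assoc, ← mul_assoc, e]
    unfold q
    field_simp
  rw [h5]
  exact mul_le_mul (by gcongr) (by linarith) h4 (rpow_nonneg (h0.le.trans h2) _)

theorem Th_le {τ M : ℝ} (h : ∀ x ∈ Icc (0:ℝ) 1, F.θ x τ ≤ M) : F.Th τ ≤ M ^ (2 + F.β) := by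
  have hβ := F.β_pos
  calc F.Th τ ≤ ∫ x in (0:ℝ)..1, M ^ (2 + F.β) := by
        refine int_mono (by fun_prop) (by fun_prop) fun x hx => ?_
        have h0 := F.θ_pos x τ
        have h2 := h x (Ioo_subset_Icc_self hx)
        gcongr
    _ = _ := by simp

theorem exists_bounded_time : ∃ M > 0, ∀ τ ≥ 1, ∃ r > 0, τ - 1 ≤ r ∧ r ≤ τ ∧ F.V r ≤ M ∧
    ∀ x ∈ Icc (0:ℝ) 1, F.θ x r ≤ M := by
  obtain ⟨μ, hμ, -, C, hC, -, h⟩ := F.exists_good_time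
  obtain ⟨K, hK, hθ⟩ := F.θ_rpow_le_V
  refine ⟨C + 1 + K * (1 + C), by positivity, fun τ hτ => ?_⟩
  obtain ⟨r, hr, h1, h2, h3⟩ := h τ hτ
  have h4 : F.V r ≤ C := h3.trans (by
    have : exp (-μ * τ) ≤ 1 := exp_le_one_iff.mpr (by nlinarith)
    nlinarith)
  refine ⟨r, hr, h1, h2, h4.trans ?_, fun x hx => ?_⟩
  · have : 0 < K * (1 + C) := by positivity
    linarith
  · have h5 := le_one_add_rpow (F.θ_pos x r) (p := 1 + F.β) (by linarith [F.β_pos])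
    have h6 := hθ r hr.le x hx
    have h7 : K * (1 + F.V r) ≤ K * (1 + C) := by gcongr
    linarith

theorem deriv_Th_le : ∃ C > 0, ∀ τ > 0, deriv F.Th τ
    ≤ -(2 * F.z τ) + C * (1 + F.V τ) * (1 + F.y τ + F.Th τ) := by
  obtain ⟨K, hK, hθ⟩ := F.θ_rpow_le_V
  obtain ⟨c, hc, hU⟩ := F.U_ge
  have hβ := F.β_pos
  refine ⟨(2 + F.β) * K * (2 + 1 / c), by positivity, fun τ hτ => ?_⟩
  have hV := F.V_nonneg τ
  have hy := F.y_nonneg τ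
  have hT := F.Th_nonneg τ
  have hz := F.z_nonneg τ
  rw [(F.hasDerivAt_Th hτ).deriv]
  have h1 : ∫ x in (0:ℝ)..1, F.θ x τ ^ (1 + F.β) * (F.s x τ * F.vx x τ)
      ≤ K * (1 + F.V τ) * (2 * F.y τ + 1 / c * (1 + F.Th τ)) := by
    have e : 2 * F.y τ + 1 / c * (1 + F.Th τ) = ∫ x in (0:ℝ)..1,
        (2 * (F.U x τ * F.s x τ ^ 2) + 1 / c * (1 + F.θ x τ ^ (2 + F.β))) := by
      rw [int_add (by fun_prop) (by fun_prop), intervalIntegral.integral_const_mul,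
        intervalIntegral.integral_const_mul, int_add (by fun_prop) (by fun_prop)]
      simp [y, Th]
    rw [e, ← intervalIntegral.integral_const_mul]
    refine int_mono (by fun_prop) (by fun_prop) fun x hx => ?_
    have hx := Ioo_subset_Icc_self hx
    have h0 := F.θ_pos x τ
    have hU0 := F.U_pos x τ
    have h2 := hU τ hτ.le x hx
    have h3 : F.θ x τ ^ 2 ≤ 1 + F.θ x τ ^ (2 + F.β) := by
      have := rpow_le_one_add_rpow h0 (p := 2) (q := 2 + F.β) (by norm_num) (by linarith)
      rwa [rpow_two] at this
    have h4 : F.s x τ * F.θ x τ ≤ F.U x τ * F.s x τ ^ 2 + F.θ x τ ^ 2 / F.U x τ := by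
      rw [← sub_nonneg]
      have : F.U x τ * F.s x τ ^ 2 + F.θ x τ ^ 2 / F.U x τ - F.s x τ * F.θ x τ
          = ((F.U x τ * F.s x τ - F.θ x τ / 2) ^ 2 + 3 / 4 * F.θ x τ ^ 2) / F.U x τ := by
        field_simp
        ring
      rw [this]
      positivity
    have h5 : F.θ x τ ^ 2 / F.U x τ ≤ 1 / c * (1 + F.θ x τ ^ (2 + F.β)) := by
      rw [one_div, inv_mul_eq_div]
      gcongr
    refine mul_le_mul_of_nonneg (hθ τ hτ.le x hx) ?_ (by positivity) (by positivity)
    rw [vx_eq]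
    linarith
  have h2 : 2 * F.y τ + 1 / c * (1 + F.Th τ) ≤ (2 + 1 / c) * (1 + F.y τ + F.Th τ) := by
    have : 0 < 1 / c := by positivity
    nlinarith
  have h3 := mul_le_mul_of_nonneg_left h2 (by positivity : 0 ≤ K * (1 + F.V τ))
  have h4 := mul_le_mul_of_nonneg_left (h1.trans h3) (by positivity : 0 ≤ 2 + F.β)
  nlinarith [mul_nonneg hβ.le hz, mul_nonneg (mul_nonneg hβ.le hβ.le) hz]

theorem int_q_sq_le : ∃ c > 0, ∀ τ ≥ 0, ∫ x in (0:ℝ)..1, F.q x τ ^ 2 ≤ c * F.z τ := by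
  obtain ⟨c, hc, hU⟩ := F.U_ge
  refine ⟨c⁻¹, by positivity, fun τ hτ => ?_⟩
  unfold z
  rw [← intervalIntegral.integral_const_mul]
  refine int_mono (by fun_prop) (by fun_prop) fun x hx => ?_
  have := hU τ hτ x (Ioo_subset_Icc_self hx)
  rw [inv_mul_eq_div, le_div_iff₀ hc, mul_comm]
  gcongr

theorem exists_deriv_y_add_Th_le : ∃ N > 0, ∃ C > 0, ∀ τ > 0,
    deriv F.y τ + N * deriv F.Th τ
      ≤ -(F.D τ / 2) + C * (1 + F.V τ) * (1 + (F.y τ + N * F.Th τ)) := by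
  obtain ⟨C₁, hC₁, h1⟩ := F.deriv_y_le
  obtain ⟨C₂, hC₂, h2⟩ := F.deriv_Th_le
  obtain ⟨N, hN, h3⟩ := F.int_q_sq_le
  refine ⟨N, hN, 1 + C₁ + N * C₂ * (1 + N⁻¹), by positivity, fun τ hτ => ?_⟩
  have hV := F.V_nonneg τ
  have hy := F.y_nonneg τ
  have hT := F.Th_nonneg τ
  have hz := F.z_nonneg τ
  have h4 := h1 τ hτ
  have h5 := mul_le_mul_of_nonneg_left (h2 τ hτ) hN.le
  have h6 := h3 τ hτ.le
  have h7 : 1 + F.y τ + F.Th τ ≤ (1 + N⁻¹) * (1 + (F.y τ + N * F.Th τ)) := by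
    have h8 : N⁻¹ * (N * F.Th τ) = F.Th τ := by field_simp
    have h9 : 0 ≤ N⁻¹ * (1 + F.y τ) := by positivity
    have h10 : 0 ≤ N * F.Th τ := by positivity
    linarith
  have h8 := mul_le_mul_of_nonneg_left h7 (by positivity : 0 ≤ N * C₂ * (1 + F.V τ))
  have h9 : F.y τ + C₁ * F.V τ * F.y τ
      ≤ (1 + C₁) * (1 + F.V τ) * (1 + (F.y τ + N * F.Th τ)) := by
    have : 0 ≤ N * F.Th τ := by positivity
    have h10 : F.y τ + C₁ * F.V τ * F.y τ ≤ (1 + C₁) * (1 + F.V τ) * F.y τ := by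
      have : 0 ≤ F.V τ * F.y τ := by positivity
      have : 0 ≤ C₁ * F.y τ := by positivity
      linarith
    refine h10.trans ?_
    gcongr
    linarith
  have h10 : 0 ≤ N * F.z τ := by positivity
  linarith

theorem abs_H_le {k τ : ℝ} (hk : 0 ≤ k) (hτ : 0 ≤ τ) : |k * F.H τ| ≤ k * F.H 0 := by
  rw [abs_of_nonneg (mul_nonneg hk (F.H_nonneg τ))]
  have := F.H_anti le_rfl hτ
  gcongr

theorem y_add_Th_le : ∃ N > 0, ∃ C > 0, (∀ τ ≥ 0, F.y τ + N * F.Th τ ≤ C) ∧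
    ∀ τ > 0, deriv F.y τ + N * deriv F.Th τ ≤ -(F.D τ / 2) + C * (1 + F.V τ) := by
  obtain ⟨N, hN, C, hC, h⟩ := F.exists_deriv_y_add_Th_le
  obtain ⟨K, hK, hr⟩ := F.exists_bounded_time
  have hA := F.A_pos
  obtain ⟨M, hM, hb⟩ := exists_uniform_bound (f := fun τ => F.y τ + N * F.Th τ)
    (Φ := fun τ => C / F.A * F.H τ) (by fun_prop) (by fun_prop)
    (fun τ hτ => (F.hasDerivAt_y hτ).differentiableAt.add
      ((F.hasDerivAt_Th hτ).differentiableAt.const_mul N))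
    (fun τ hτ => (F.hasDerivAt_H hτ).differentiableAt.const_mul _)
    (fun τ => add_nonneg (F.y_nonneg τ) (mul_nonneg hN.le (F.Th_nonneg τ)))
    (B := C / F.A * F.H 0) (C := C) (K := K * K + N * K ^ (2 + F.β)) hC.le
    (fun τ hτ => F.abs_H_le (by positivity) hτ)
    (fun τ hτ => by
      have e1 : deriv (fun τ => F.y τ + N * F.Th τ) τ = deriv F.y τ + N * deriv F.Th τ := by
        rw [deriv_fun_add (F.hasDerivAt_y hτ).differentiableAt
          ((F.hasDerivAt_Th hτ).differentiableAt.const_mul N),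
          deriv_const_mul _ (F.hasDerivAt_Th hτ).differentiableAt]
      have e2 : deriv (fun τ => C / F.A * F.H τ) τ = -(C * F.V τ) := by
        rw [deriv_const_mul _ (F.hasDerivAt_H hτ).differentiableAt, (F.hasDerivAt_H hτ).deriv]
        field_simp
      rw [e1, e2]
      have := h τ hτ
      have := F.D_nonneg τ
      linarith)
    (fun τ hτ => by
      obtain ⟨r, hr0, h1, h2, h3, h4⟩ := hr τ hτ
      refine ⟨r, hr0, h1, h2, ?_⟩
      have h5 := F.y_le_V h4
      have h6 := F.Th_le h4
      gcongr
      exact h5.trans (by gcongr))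
  refine ⟨N, hN, M + C * (1 + M), by positivity, fun τ hτ => (hb τ hτ).trans ?_, fun τ hτ => ?_⟩
  · have : 0 < C * (1 + M) := by positivity
    linarith
  · refine (h τ hτ).trans ?_
    have h1 := hb τ hτ.le
    have hV := F.V_nonneg τ
    have h2 : C * (1 + F.V τ) * (1 + (F.y τ + N * F.Th τ)) ≤ C * (1 + F.V τ) * (1 + M) := by
      gcongr
    have : 0 ≤ M * (1 + F.V τ) := by positivity
    linarith

theorem deriv_z_le : ∃ B > 0, ∀ τ > 0, ∀ P, (∀ x ∈ Icc (0:ℝ) 1, F.θ x τ ^ F.β ≤ P) →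
    deriv F.z τ ≤ P * B * F.y τ * F.D τ + F.D τ * F.Th τ + (2 + F.D τ) * F.z τ := by
  obtain ⟨B, hB, hU⟩ := F.U_le
  refine ⟨B, hB, fun τ hτ P hP => ?_⟩
  rw [(F.hasDerivAt_z hτ).deriv]
  unfold y Th z
  simp only [← intervalIntegral.integral_const_mul]
  rw [← intervalIntegral.integral_mul_const,
    ← int_add (by fun_prop) (by fun_prop), ← int_add (by fun_prop) (by fun_prop)]
  refine int_mono (by fun_prop) (by fun_prop) fun x hx => ?_
  have hx := Ioo_subset_Icc_self hx
  have h0 := F.θ_pos x τ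
  have hU0 := F.U_pos x τ
  have h1 := hP x hx
  have h2 := hU τ hτ.le x hx
  have h3 := F.s_sq_le τ hx
  have hD := F.D_nonneg τ
  have hb : 0 < F.θ x τ ^ F.β := rpow_pos_of_pos h0 _
  have e : F.θ x τ ^ (2 + F.β) = F.θ x τ ^ F.β * F.θ x τ ^ 2 := by
    rw [add_comm, rpow_add h0, rpow_two]
  rw [e, vx_eq]
  have h4 : -2 * F.qx x τ * (F.θ x τ ^ F.β * (F.qx x τ
      + F.s x τ * (F.U x τ * F.s x τ + F.θ x τ)))
      ≤ F.θ x τ ^ F.β * (F.s x τ ^ 2 * (F.U x τ ^ 2 * F.s x τ ^ 2 + F.θ x τ ^ 2)) := by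
    have : -2 * F.qx x τ * (F.qx x τ + F.s x τ * (F.U x τ * F.s x τ + F.θ x τ))
        ≤ F.s x τ ^ 2 * (F.U x τ ^ 2 * F.s x τ ^ 2 + F.θ x τ ^ 2) := by
      nlinarith [sq_nonneg (2 * F.qx x τ + F.s x τ * (F.U x τ * F.s x τ + F.θ x τ)),
        sq_nonneg (F.s x τ * (F.U x τ * F.s x τ - F.θ x τ))]
    have := mul_le_mul_of_nonneg_left this hb.le
    linarith
  have h5 : F.θ x τ ^ F.β * (F.s x τ ^ 2 * (F.U x τ ^ 2 * F.s x τ ^ 2))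
      ≤ P * B * F.D τ * (F.U x τ * F.s x τ ^ 2) := by
    have : F.θ x τ ^ F.β * F.U x τ * F.s x τ ^ 2 ≤ P * B * F.D τ := by
      have := hb.le.trans h1
      gcongr
    have := mul_le_mul_of_nonneg_right this (by positivity : 0 ≤ F.U x τ * F.s x τ ^ 2)
    linarith
  have h6 : F.θ x τ ^ F.β * (F.s x τ ^ 2 * F.θ x τ ^ 2)
      ≤ F.D τ * (F.θ x τ ^ F.β * F.θ x τ ^ 2) := by
    have := mul_le_mul_of_nonneg_right h3 (by positivity : 0 ≤ F.θ x τ ^ F.β * F.θ x τ ^ 2)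
    linarith
  have h7 : -F.s x τ ≤ 1 + F.D τ := by nlinarith [sq_nonneg (F.s x τ + 1)]
  have h8 := mul_le_mul_of_nonneg_left h7 (by positivity : 0 ≤ F.U x τ * F.q x τ ^ 2)
  have h9 : 0 ≤ F.q x τ ^ 2 * F.θ x τ := by positivity
  linarith

theorem osc_θ_rpow_z : ∃ K > 0, ∀ τ ≥ 0, ∀ x ∈ Icc (0:ℝ) 1, ∀ w ∈ Icc (0:ℝ) 1,
    (F.θ x τ ^ (1 + F.β) - F.θ w τ ^ (1 + F.β)) ^ 2 ≤ K * F.z τ := by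
  obtain ⟨B, hB, hU⟩ := F.U_le
  have hβ := F.β_pos
  refine ⟨(1 + F.β) ^ 2 * B, by positivity, fun τ hτ x hx w hw => ?_⟩
  have h := sub_sq_le (h := fun x => F.θ x τ ^ (1 + F.β))
    (hx := fun x => (1 + F.β) * (F.U x τ * F.q x τ)) (w := fun x => F.U x τ)
    (by fun_prop) (by fun_prop) (by fun_prop) (fun x => F.U_pos x τ) (fun x hx => by
      refine ((F.dθx x hx τ).rpow_const (p := 1 + F.β)
        (Or.inl (F.θ_ne x τ))).congr_deriv ?_
      rw [add_sub_cancel_left, U_mul_q]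
      ring) hx hw
  refine h.trans ?_
  have e : ∫ ξ in (0:ℝ)..1, ((1 + F.β) * (F.U ξ τ * F.q ξ τ)) ^ 2 / F.U ξ τ
      = (1 + F.β) ^ 2 * F.z τ := by
    unfold z
    rw [← intervalIntegral.integral_const_mul]
    refine int_congr fun x _ => ?_
    have := F.U_ne x τ
    field_simp
  rw [e, mul_right_comm]
  have hz := F.z_nonneg τ
  gcongr
  calc _ ≤ ∫ x in (0:ℝ)..1, B := int_mono (by fun_prop) (by fun_prop)
        fun x hx => hU τ hτ x (Ioo_subset_Icc_self hx)
    _ = B := by simp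

theorem θ_rpow_le_z : ∃ C > 0, ∀ τ ≥ 0, ∀ x ∈ Icc (0:ℝ) 1,
    F.θ x τ ^ (1 + F.β) ≤ C * (1 + F.z τ) := by
  obtain ⟨c, hc, C, hC, h⟩ := F.exists_good_point
  obtain ⟨K, hK, hz⟩ := F.osc_θ_rpow_z
  have hβ := F.β_pos
  refine ⟨C ^ (1 + F.β) + 1 + K, by positivity, fun τ hτ x hx => ?_⟩
  obtain ⟨w, hw, h1, h2⟩ := h τ hτ
  have h3 := hz τ hτ x hx w hw
  have hw0 := F.θ_pos w τ
  have h6 : F.θ w τ ^ (1 + F.β) ≤ C ^ (1 + F.β) := by gcongr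
  have h7 := F.z_nonneg τ
  have h8 : 0 < C ^ (1 + F.β) := by positivity
  nlinarith [sq_nonneg (F.θ x τ ^ (1 + F.β) - F.θ w τ ^ (1 + F.β) - 1), mul_nonneg h8.le h7]

theorem z_le : ∃ C > 0, ∀ τ ≥ 0, F.z τ ≤ C := by
  obtain ⟨N, hN, M, hM, hY, hY'⟩ := F.y_add_Th_le
  obtain ⟨K, hK, hr⟩ := F.exists_bounded_time
  obtain ⟨B, hB, hz⟩ := F.deriv_z_le
  obtain ⟨Q, hQ, hq⟩ := F.θ_rpow_le_z
  have hA := F.A_pos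
  have hβ := F.β_pos
  have hzD : ∃ C > 0, ∀ τ > 0, deriv F.z τ ≤ C * (1 + F.D τ) * (1 + F.z τ) := by
    refine ⟨(1 + Q) * B * M + M / N + 2, by positivity, fun τ hτ => ?_⟩
    have hz0 := F.z_nonneg τ
    have hD := F.D_nonneg τ
    have hy := F.y_nonneg τ
    have hT := F.Th_nonneg τ
    have h1 := hz τ hτ ((1 + Q) * (1 + F.z τ)) fun x hx => by
      have h2 := rpow_le_one_add_rpow (F.θ_pos x τ) (p := F.β) (q := 1 + F.β) hβ.le (by linarith)
      have h3 := hq τ hτ.le x hx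
      linarith
    have h2 := hY τ hτ.le
    have h3 : F.y τ ≤ M := by nlinarith
    have h4 : F.Th τ ≤ M / N := by
      rw [le_div_iff₀ hN]
      linarith
    have h5 : (1 + Q) * (1 + F.z τ) * B * F.y τ * F.D τ
        ≤ (1 + Q) * (1 + F.z τ) * B * M * (1 + F.D τ) := by
      gcongr
      linarith
    have h6 : F.D τ * F.Th τ ≤ (1 + F.D τ) * (M / N * (1 + F.z τ)) := by
      have : M / N ≤ M / N * (1 + F.z τ) := by
        have : 0 ≤ M / N * F.z τ := by positivity
        linarith
      exact mul_le_mul (by linarith) (h4.trans this) hT (by positivity)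
    have h7 : (2 + F.D τ) * F.z τ ≤ 2 * (1 + F.D τ) * (1 + F.z τ) := by nlinarith
    linarith
  obtain ⟨C, hC, hC'⟩ := hzD
  set k := 2 * C * M / F.A with hk
  have hk0 : 0 < k := by positivity
  have hkA : k * F.A = 2 * C * M := by
    rw [hk]
    field_simp
  refine exists_uniform_bound (f := F.z)
    (Φ := fun τ => 2 * C * (F.y τ + N * F.Th τ) + k * F.H τ) (by fun_prop) (by fun_prop)
    (fun τ hτ => (F.hasDerivAt_z hτ).differentiableAt)
    (fun τ hτ => (((F.hasDerivAt_y hτ).differentiableAt.add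
      ((F.hasDerivAt_Th hτ).differentiableAt.const_mul N)).const_mul _).add
      ((F.hasDerivAt_H hτ).differentiableAt.const_mul _)) F.z_nonneg
    (B := 2 * C * M + k * F.H 0) (C := C + 2 * C * M)
    (K := K ^ (2 + F.β) * K) (by positivity) (fun τ hτ => ?_) (fun τ hτ => ?_) (fun τ hτ => ?_)
  · refine (abs_add_le _ _).trans (add_le_add ?_ (F.abs_H_le hk0.le hτ))
    have hy := F.y_nonneg τ
    have hT := F.Th_nonneg τ
    rw [abs_of_nonneg (by positivity)]
    have := hY τ hτ
    gcongr
  · have e : HasDerivAt (fun τ => 2 * C * (F.y τ + N * F.Th τ) + k * F.H τ)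
        (2 * C * (deriv F.y τ + N * deriv F.Th τ) + k * (-F.A * F.V τ)) τ :=
      (((F.hasDerivAt_y hτ).differentiableAt.hasDerivAt.add
      ((F.hasDerivAt_Th hτ).differentiableAt.hasDerivAt.const_mul N)).const_mul _).add
      ((F.hasDerivAt_H hτ).const_mul _)
    rw [e.deriv]
    refine (hC' τ hτ).trans ?_
    have hz0 := F.z_nonneg τ
    gcongr
    have h1 := mul_le_mul_of_nonneg_left (hY' τ hτ) (by positivity : 0 ≤ 2 * C)
    have h2 : k * (-F.A * F.V τ) = -(2 * C * M * F.V τ) := by rw [← hkA]; ring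
    rw [h2]
    linarith
  · obtain ⟨r, hr0, h1, h2, h3, h4⟩ := hr τ hτ
    refine ⟨r, hr0, h1, h2, (F.z_le_V h4).trans ?_⟩
    gcongr

theorem θ_le : ∃ M > 0, ∀ τ ≥ 0, ∀ x ∈ Icc (0:ℝ) 1, F.θ x τ ≤ M := by
  obtain ⟨C, hC, h⟩ := F.z_le
  obtain ⟨Q, hQ, hq⟩ := F.θ_rpow_le_z
  refine ⟨1 + Q * (1 + C), by positivity, fun τ hτ x hx => ?_⟩
  have h1 := le_one_add_rpow (F.θ_pos x τ) (p := 1 + F.β) (by linarith [F.β_pos])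
  have h2 := hq τ hτ x hx
  have h3 : Q * (1 + F.z τ) ≤ Q * (1 + C) := by
    have := h τ hτ
    gcongr
  linarith

/-- Exponential decay of the Lyapunov functional, the stress and the heat flux. -/
theorem energy_decay : ∃ μ > 0, μ < 1 ∧ ∃ C > 0, ∀ τ ≥ 0, F.H τ ≤ C * exp (-μ * τ) ∧
    F.y τ ≤ C * exp (-μ * τ) ∧ F.z τ ≤ C * exp (-μ * τ) := by
  obtain ⟨μ, hμ, hμ1, C, hC, hH, hg⟩ := F.exists_good_time
  obtain ⟨M, hM, hθ⟩ := F.θ_le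
  obtain ⟨N, hN, Y, hY, hYle, -⟩ := F.y_add_Th_le
  obtain ⟨Z, hZ, hzle⟩ := F.z_le
  obtain ⟨B, hB, hz⟩ := F.deriv_z_le
  obtain ⟨E, hE, hy⟩ := F.deriv_y_le
  obtain ⟨G, hG, hq⟩ := F.int_q_sq_le
  have hA := F.A_pos
  have hβ := F.β_pos
  set M' := M ^ (2 + F.β) with hM'
  have hM'0 : 0 < M' := by positivity
  have hyY : ∀ τ ≥ 0, F.y τ ≤ Y := fun τ hτ => by
    have := hYle τ hτ
    have := mul_nonneg hN.le (F.Th_nonneg τ)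
    linarith
  have hyV : ∀ τ ≥ 0, F.y τ ≤ M * F.V τ := fun τ hτ => F.y_le_V (hθ τ hτ)
  have hzV : ∀ τ ≥ 0, F.z τ ≤ M' * F.V τ := fun τ hτ => F.z_le_V (hθ τ hτ)
  set a := G * M' + M + E * Y with ha
  have ha0 : 0 < a := by positivity
  have hy' : ∀ τ > 0, deriv F.y τ ≤ -(F.D τ / 2) + a * F.V τ := fun τ hτ => by
    have h1 := hy τ hτ
    have h2 := (hq τ hτ.le).trans (mul_le_mul_of_nonneg_left (hzV τ hτ.le) hG.le)
    have h3 := hyV τ hτ.le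
    have h4 : E * F.V τ * F.y τ ≤ E * F.V τ * Y := by
      have := hyY τ hτ.le
      have := F.V_nonneg τ
      gcongr
    linarith
  set d := M ^ F.β * B * Y + M' + Z with hd
  have hd0 : 0 < d := by positivity
  have hz' : ∀ τ > 0, deriv F.z τ ≤ d * F.D τ + 2 * M' * F.V τ := fun τ hτ => by
    have h1 := hz τ hτ (M ^ F.β) fun x hx => by
      have := F.θ_pos x τ
      have := hθ τ hτ.le x hx
      gcongr
    have hD := F.D_nonneg τ
    have h2 : M ^ F.β * B * F.y τ * F.D τ ≤ M ^ F.β * B * Y * F.D τ := by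
      have := hyY τ hτ.le
      gcongr
    have h3 := mul_le_mul_of_nonneg_left (F.Th_le (hθ τ hτ.le)) hD
    have h4 := mul_le_mul_of_nonneg_left (hzle τ hτ.le) hD
    have h5 := hzV τ hτ.le
    linarith
  set k := (2 * M' + 2 * d * a) / F.A with hk
  have hk0 : 0 < k := by positivity
  have hkA : k * F.A = 2 * M' + 2 * d * a := by
    rw [hk]
    field_simp
  set P : ℝ → ℝ := fun τ => F.z τ + 2 * d * F.y τ + k * F.H τ with hP
  have cP : Continuous P := by fun_prop
  have hanti : ∀ r τ, 0 ≤ r → r ≤ τ → P τ ≤ P r := fun r τ hr hrτ =>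
    anti_of_deriv_nonpos (f := P)
      (f' := fun τ => deriv F.z τ + 2 * d * deriv F.y τ + k * (-F.A * F.V τ)) cP.continuousOn
      (fun τ hτ => ((F.hasDerivAt_z hτ).differentiableAt.hasDerivAt.add
        ((F.hasDerivAt_y hτ).differentiableAt.hasDerivAt.const_mul _)).add
        ((F.hasDerivAt_H hτ).const_mul _))
      (fun τ hτ => by
        have h1 := hz' τ hτ
        have h2 := mul_le_mul_of_nonneg_left (hy' τ hτ) (by positivity : 0 ≤ 2 * d)
        have h3 : k * (-F.A * F.V τ) = -((2 * M' + 2 * d * a) * F.V τ) := by rw [← hkA]; ring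
        rw [h3]
        linarith) hr hrτ
  obtain ⟨n, hn, hPn⟩ := exists_bound_one cP 1
  set Q := n * exp μ + (M' + 2 * d * M) * C + k * (C * exp μ) with hQ
  have hQ0 : 0 < Q := by positivity
  have hPd : ∀ τ ≥ 0, P τ ≤ Q * exp (-μ * τ) := fun τ hτ => by
    have hpos : 0 < exp (-μ * τ) := exp_pos _
    rcases le_total τ 1 with h1 | h1
    · have h2 := (le_abs_self _).trans (hPn τ ⟨hτ, h1⟩)
      have h3 : 1 ≤ exp μ * exp (-μ * τ) := by
        rw [← exp_add]
        exact one_le_exp (by nlinarith)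
      have h4 := mul_le_mul_of_nonneg_left h3 hn.le
      have h5 : 0 ≤ ((M' + 2 * d * M) * C + k * (C * exp μ)) * exp (-μ * τ) := by positivity
      rw [hQ]
      linarith
    · obtain ⟨r, hr0, h2, h3, h4⟩ := hg τ h1
      refine (hanti r τ hr0.le h3).trans ?_
      have h5 : F.H r ≤ C * exp μ * exp (-μ * τ) := by
        refine (hH r hr0.le).trans ?_
        rw [mul_assoc, ← exp_add]
        gcongr
        nlinarith
      have h6 := hzV r hr0.le
      have h7 := mul_le_mul_of_nonneg_left (hyV r hr0.le) (by positivity : 0 ≤ 2 * d)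
      have h8 := mul_le_mul_of_nonneg_left h5 hk0.le
      have h9 := mul_le_mul_of_nonneg_left h4 (by positivity : 0 ≤ M' + 2 * d * M)
      have h10 : 0 ≤ n * exp μ * exp (-μ * τ) := by positivity
      simp only [hP, hQ]
      linarith
  refine ⟨μ, hμ, hμ1, C + Q + Q / (2 * d), by positivity, fun τ hτ => ?_⟩
  have h1 := hPd τ hτ
  simp only [hP] at h1
  have hy0 := F.y_nonneg τ
  have hz0 := F.z_nonneg τ
  have hH0 := F.H_nonneg τ
  have h2 : 0 ≤ k * F.H τ := by positivity
  have h3 : 0 ≤ 2 * d * F.y τ := by positivity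
  have h4 : F.y τ ≤ Q / (2 * d) * exp (-μ * τ) := by
    rw [div_mul_eq_mul_div, le_div_iff₀ (by positivity)]
    linarith
  have hpos : 0 < exp (-μ * τ) := exp_pos _
  have h5 : 0 < Q * exp (-μ * τ) := by positivity
  have h6 : 0 < C * exp (-μ * τ) := by positivity
  have h7 : 0 < Q / (2 * d) * exp (-μ * τ) := by positivity
  have h8 := hH τ hτ
  refine ⟨?_, ?_, ?_⟩ <;> linarith

end ScaledFlow

/-- Decay from a linear differential inequality with exponentially small forcing. -/
theorem decay_of_deriv_le {f f' : ℝ → ℝ} (cf : ContinuousOn f (Ici 0))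
    (h : ∀ τ > 0, HasDerivAt f (f' τ) τ) {N ν : ℝ} (hν : ν < 1) (hN : 0 ≤ N)
    (h0 : ∀ τ > 0, f' τ ≤ -f τ + N * exp (-ν * τ)) {τ : ℝ} (hτ : 0 ≤ τ) :
    f τ ≤ (|f 0| + N / (1 - ν)) * exp (-ν * τ) := by
  have hν' : 0 < 1 - ν := by linarith
  have e1 : ∀ r, exp r * exp (-ν * r) = exp ((1 - ν) * r) := fun r => by
    rw [← exp_add]
    ring_nf
  have key := anti_of_deriv_nonpos (f := fun r => exp r * f r - N / (1 - ν) * exp ((1 - ν) * r))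
    (f' := fun r => exp r * f r + exp r * f' r - N / (1 - ν) * (exp ((1 - ν) * r) * (1 - ν)))
    (by fun_prop)
    (fun r hr => by
      have h1 := ((hasDerivAt_id r).const_mul (1 - ν)).exp
      refine (((Real.hasDerivAt_exp r).mul (h r hr)).sub
        (h1.const_mul (N / (1 - ν)))).congr_deriv ?_
      simp)
    (fun r hr => by
      have h1 := mul_le_mul_of_nonneg_left (h0 r hr) (exp_pos r).le
      have h2 : N / (1 - ν) * (exp ((1 - ν) * r) * (1 - ν)) = N * exp ((1 - ν) * r) := by
        field_simp
      rw [h2, ← e1]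
      linarith) le_rfl hτ
  simp only [exp_zero, one_mul, mul_zero, mul_one] at key
  have h3 : 0 ≤ N / (1 - ν) := by positivity
  have h4 : 1 ≤ exp ((1 - ν) * τ) := one_le_exp (by positivity)
  have h5 : |f 0| ≤ |f 0| * exp ((1 - ν) * τ) := le_mul_of_one_le_right (abs_nonneg _) h4
  have h6 : exp τ * f τ ≤ exp τ * ((|f 0| + N / (1 - ν)) * exp (-ν * τ)) := by
    calc exp τ * f τ ≤ (|f 0| + N / (1 - ν)) * exp ((1 - ν) * τ) := by
          linarith [le_abs_self (f 0)]
      _ = _ := by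
          rw [← e1]
          ring
  exact le_of_mul_le_mul_left h6 (exp_pos τ)

theorem abs_exp_sub_one_le_mul_exp (y : ℝ) : |exp y - 1| ≤ |y| * exp |y| := by
  have h1 := add_one_le_exp y
  have h2 := add_one_le_exp (-y)
  have h3 : exp y * exp (-y) = 1 := by
    rw [← exp_add]
    simp
  have h4 := exp_pos y
  have h5 : 1 ≤ exp |y| := one_le_exp (abs_nonneg y)
  rw [abs_le]
  constructor
  · have : |y| ≤ |y| * exp |y| := le_mul_of_one_le_right (abs_nonneg y) h5
    linarith [neg_abs_le y]
  · have h6 : exp y - 1 ≤ y * exp y := by nlinarith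
    refine h6.trans ?_
    have : exp y ≤ exp |y| := exp_le_exp.mpr (le_abs_self y)
    exact (mul_le_mul_of_nonneg_right (le_abs_self y) h4.le).trans
      (mul_le_mul_of_nonneg_left this (abs_nonneg y))

theorem abs_sub_mul_rpow_le {a b p : ℝ} (ha : 0 < a) (hb : 0 < b) (hp : 0 ≤ p) :
    |a - b| * b ^ p ≤ |a ^ (1 + p) - b ^ (1 + p)| := by
  rw [rpow_add ha, rpow_add hb, rpow_one, rpow_one]
  rcases le_total a b with h | h
  · have h1 := rpow_le_rpow ha.le h hp
    have h2 : a * a ^ p ≤ a * b ^ p := by gcongr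
    rw [abs_of_nonpos (by linarith)]
    exact le_trans (by linarith) (neg_le_abs _)
  · have h1 := rpow_le_rpow hb.le h hp
    have h2 : a * b ^ p ≤ a * a ^ p := by gcongr
    rw [abs_of_nonneg (by linarith)]
    exact le_trans (by linarith) (le_abs_self _)

theorem sqrt_mul_exp {C μ τ : ℝ} : √(C * exp (-μ * τ)) = √C * exp (-(μ / 2) * τ) := by
  have : exp (-μ * τ) = exp (-(μ / 2) * τ) ^ 2 := by
    rw [← exp_nat_mul]
    push_cast
    ring_nf
  rw [this, Real.sqrt_mul' _ (sq_nonneg _), Real.sqrt_sq (exp_pos _).le]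

namespace ScaledFlow

variable (F : ScaledFlow) {X : Type*} [TopologicalSpace X]

theorem θ_sub_sq_le : ∃ μ > 0, μ < 1 ∧ ∃ C > 0, ∀ τ ≥ 0,
    (F.H τ ≤ C * exp (-μ * τ) ∧ F.y τ ≤ C * exp (-μ * τ) ∧ F.z τ ≤ C * exp (-μ * τ)) ∧
    ∀ x ∈ Icc (0:ℝ) 1, (F.θ x τ - F.A) ^ 2 ≤ C * exp (-μ * τ) := by
  obtain ⟨μ, hμ, hμ1, C, hC, h⟩ := F.energy_decay
  obtain ⟨K, hK, hosc⟩ := F.osc_θ_rpow_z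
  obtain ⟨c, hc, c', -, hg⟩ := F.exists_good_point
  obtain ⟨M, hM, hθ⟩ := F.θ_le
  have hA := F.A_pos
  have hβ := F.β_pos
  have hcb : 0 < c ^ F.β := rpow_pos_of_pos hc _
  refine ⟨μ, hμ, hμ1, C + (6 * (K * C / (c ^ F.β) ^ 2) + 6 * C * (M + F.A)), by positivity,
    fun τ hτ => ?_⟩
  obtain ⟨hH, hy, hz⟩ := h τ hτ
  set e := exp (-μ * τ) with he
  have he0 : 0 < e := exp_pos _
  have hadd : C * e ≤ (C + (6 * (K * C / (c ^ F.β) ^ 2) + 6 * C * (M + F.A))) * e := by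
    gcongr
    have : 0 ≤ (6 * (K * C / (c ^ F.β) ^ 2) + 6 * C * (M + F.A)) := by positivity
    linarith
  refine ⟨⟨hH.trans hadd, hy.trans hadd, hz.trans hadd⟩, fun x hx => ?_⟩
  obtain ⟨w, hw, hcw, -⟩ := hg τ hτ
  obtain ⟨p, hp, hφ⟩ := F.exists_phi_le τ
  have near : ∀ x ∈ Icc (0:ℝ) 1, (F.θ x τ - F.θ w τ) ^ 2 ≤ K * C / (c ^ F.β) ^ 2 * e := by
    intro x hx
    have h1 := abs_sub_mul_rpow_le (F.θ_pos x τ) (F.θ_pos w τ) hβ.le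
    have h2 : c ^ F.β ≤ F.θ w τ ^ F.β := rpow_le_rpow hc.le hcw hβ.le
    have h3 : |F.θ x τ - F.θ w τ| * c ^ F.β
        ≤ |F.θ x τ ^ (1 + F.β) - F.θ w τ ^ (1 + F.β)| :=
      (mul_le_mul_of_nonneg_left h2 (abs_nonneg _)).trans h1
    have h4 := pow_le_pow_left₀ (by positivity) h3 2
    rw [mul_pow, sq_abs, sq_abs] at h4
    have h5 := h4.trans (hosc τ hτ x hx w hw)
    have h6 : K * F.z τ ≤ K * (C * e) := by gcongr
    calc (F.θ x τ - F.θ w τ) ^ 2 ≤ K * (C * e) / (c ^ F.β) ^ 2 := by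
          rw [le_div_iff₀ (by positivity)]
          exact h5.trans h6
      _ = _ := by ring
  have h1 : (F.θ p τ - F.A) ^ 2 ≤ 2 * C * (M + F.A) * e := by
    have h2 := F.phi_ge (F.θ_pos p τ)
    have h3 := Real.sq_sqrt (F.θ_pos p τ).le
    have h4 := Real.sq_sqrt hA.le
    have h5 : F.θ p τ - F.A = (√(F.θ p τ) - √F.A) * (√(F.θ p τ) + √F.A) := by linarith
    have h6 : (√(F.θ p τ) + √F.A) ^ 2 ≤ 2 * (M + F.A) := by
      have := hθ τ hτ p hp
      nlinarith [sq_nonneg (√(F.θ p τ) - √F.A)]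
    rw [h5, mul_pow]
    calc _ ≤ C * e * (2 * (M + F.A)) := by
          apply mul_le_mul (h2.trans (hφ.trans hH)) h6 (sq_nonneg _) (by positivity)
      _ = _ := by ring
  have h2 := near x hx
  have h3 := near p hp
  have h4 : (F.θ x τ - F.A) ^ 2 ≤ 3 * (F.θ x τ - F.θ w τ) ^ 2 + 3 * (F.θ p τ - F.θ w τ) ^ 2
      + 3 * (F.θ p τ - F.A) ^ 2 := by
    nlinarith [sq_nonneg ((F.θ x τ - F.θ w τ) + (F.θ p τ - F.θ w τ)),
      sq_nonneg ((F.θ x τ - F.θ w τ) - (F.θ p τ - F.A)),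
      sq_nonneg ((F.θ p τ - F.θ w τ) + (F.θ p τ - F.A))]
  have h5 : 0 < C * e := by positivity
  linarith

theorem θ_lower : ∃ k > 0, ∀ τ ≥ 0, ∀ x ∈ Icc (0:ℝ) 1, k ≤ F.θ x τ := by
  obtain ⟨μ, hμ, -, C, hC, h⟩ := F.θ_sub_sq_le
  refine exists_pos_le F.cθ F.θ_pos F.A_pos (C := √C) (by positivity) (half_pos hμ)
    fun τ hτ x hx => ?_
  have := Real.abs_le_sqrt ((h τ hτ).2 x hx)
  rw [sqrt_mul_exp] at this
  linarith [neg_le_of_abs_le this]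

theorem int_θx_sq_le : ∃ C > 0, ∀ τ ≥ 0, ∫ x in (0:ℝ)..1, F.θx x τ ^ 2 ≤ C * F.z τ := by
  obtain ⟨k, hk, hθ⟩ := F.θ_lower
  obtain ⟨B, hB, hU⟩ := F.U_le
  have hkb : 0 < k ^ F.β := rpow_pos_of_pos hk _
  refine ⟨B / (k ^ F.β) ^ 2, by positivity, fun τ hτ => ?_⟩
  unfold z
  rw [← intervalIntegral.integral_const_mul]
  refine int_mono (by fun_prop) (by fun_prop) fun x hx => ?_
  have hx := Ioo_subset_Icc_self hx
  have h1 : k ^ F.β ≤ F.θ x τ ^ F.β := rpow_le_rpow hk.le (hθ τ hτ x hx) F.β_pos.le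
  have h2 := hU τ hτ x hx
  have h3 := F.U_pos x τ
  rw [div_mul_eq_mul_div, le_div_iff₀ (by positivity)]
  calc F.θx x τ ^ 2 * (k ^ F.β) ^ 2 ≤ F.θx x τ ^ 2 * (F.θ x τ ^ F.β) ^ 2 := by gcongr
    _ = (F.U x τ * F.q x τ) ^ 2 := by
      rw [U_mul_q]
      ring
    _ = F.U x τ * (F.U x τ * F.q x τ ^ 2) := by ring
    _ ≤ _ := by gcongr

theorem exp_b_sub_one_le : ∃ μ > 0, μ < 1 ∧ ∃ C > 0, ∀ τ ≥ 0, ∀ x ∈ Icc (0:ℝ) 1,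
    |exp (F.b x τ) - 1| ≤ C * exp (-μ * τ) ∧ |exp (-F.b x τ) - 1| ≤ C * exp (-μ * τ) ∧
    |F.θ x τ - F.A| ≤ C * exp (-μ * τ) := by
  obtain ⟨μ, hμ, hμ1, C, hC, h⟩ := F.θ_sub_sq_le
  obtain ⟨B, hB, hb⟩ := F.exists_b_bound
  refine ⟨μ / 2, by positivity, by linarith, √(2 * C) * (B + 1), by positivity,
    fun τ hτ x hx => ?_⟩
  have h1 := Real.abs_le_sqrt (F.b_sq_le hx τ)
  have h2 := Real.abs_le_sqrt ((h τ hτ).2 x hx)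
  have h3 : √(2 * F.H τ) ≤ √(2 * C) * exp (-(μ / 2) * τ) := by
    rw [← sqrt_mul_exp]
    apply Real.sqrt_le_sqrt
    linarith [(h τ hτ).1.1]
  have h4 : √(C * exp (-μ * τ)) ≤ √(2 * C) * exp (-(μ / 2) * τ) := by
    rw [← sqrt_mul_exp]
    apply Real.sqrt_le_sqrt
    gcongr
    linarith
  have h5 : |F.b x τ| * exp |F.b x τ| ≤ √(2 * C) * (B + 1) * exp (-(μ / 2) * τ) := by
    calc _ ≤ √(2 * C) * exp (-(μ / 2) * τ) * (B + 1) :=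
          mul_le_mul (h1.trans h3) ((hb τ hτ x hx).trans (by linarith)) (exp_pos _).le
            (by positivity)
      _ = _ := by ring
  refine ⟨(abs_exp_sub_one_le_mul_exp _).trans h5, ?_, (h2.trans h4).trans ?_⟩
  · have := abs_exp_sub_one_le_mul_exp (-F.b x τ)
    rw [abs_neg] at this
    exact this.trans h5
  · gcongr
    exact le_mul_of_one_le_right (by positivity) (by linarith)

theorem U_sub_le : ∃ μ > 0, ∃ C > 0, ∀ τ ≥ 0, ∀ x ∈ Icc (0:ℝ) 1,
    |F.U x τ - F.A| ≤ C * exp (-μ * τ) := by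
  obtain ⟨μ, hμ, hμ1, C, hC, h⟩ := F.exp_b_sub_one_le
  obtain ⟨B, hB, hb⟩ := F.exists_b_bound
  obtain ⟨M, hM, hθ⟩ := F.θ_le
  obtain ⟨K, hK, hW0⟩ := exists_bound (f := fun x τ => F.W x τ - F.A) (by fun_prop) 0
  have hA := F.A_pos
  set N := M * C + C with hN
  have hN0 : 0 < N := by positivity
  have hμ' : 0 < 1 - μ := by linarith
  refine ⟨μ, hμ, B * (K + N / (1 - μ)) + F.A * C, by positivity, fun τ hτ x hx => ?_⟩
  have g : ∀ τ > 0, |exp (-F.b x τ) * F.θ x τ - F.A| ≤ N * exp (-μ * τ) := by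
    intro τ hτ
    obtain ⟨-, h1, h2⟩ := h τ hτ.le x hx
    have h3 := hθ τ hτ.le x hx
    have h4 := F.θ_pos x τ
    have e : exp (-F.b x τ) * F.θ x τ - F.A
        = F.θ x τ * (exp (-F.b x τ) - 1) + (F.θ x τ - F.A) := by ring
    rw [e]
    refine (abs_add_le _ _).trans ?_
    rw [abs_mul, abs_of_pos h4, hN, add_mul, mul_assoc]
    gcongr
  have d : ∀ τ > 0, HasDerivAt (fun r => F.W x r - F.A) _ τ := fun τ hτ =>
    (F.dW hx hτ).sub_const F.A
  have c : Continuous fun r => F.W x r - F.A := by fun_prop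
  have up := decay_of_deriv_le c.continuousOn d hμ1 hN0.le (fun τ hτ => by
    linarith [le_of_abs_le (g τ hτ)]) hτ
  have lo := decay_of_deriv_le c.neg.continuousOn (fun τ hτ => (d τ hτ).neg) hμ1 hN0.le
    (fun τ hτ => by
      simp only [Pi.neg_apply]
      linarith [neg_le_of_abs_le (g τ hτ)]) hτ
  simp only [Pi.neg_apply, abs_neg] at up lo
  have h1 : |F.W x τ - F.A| ≤ (K + N / (1 - μ)) * exp (-μ * τ) := by
    have := hW0 x hx 0 (by simp)
    have h2 : (|F.W x 0 - F.A| + N / (1 - μ)) * exp (-μ * τ)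
        ≤ (K + N / (1 - μ)) * exp (-μ * τ) := by gcongr
    rw [abs_le]
    constructor <;> linarith
  have e : F.U x τ - F.A = exp (F.b x τ) * (F.W x τ - F.A) + F.A * (exp (F.b x τ) - 1) := by
    rw [F.U_eq]
    ring
  have h2 : exp (F.b x τ) ≤ B := (exp_le_exp.mpr (le_abs_self _)).trans (hb τ hτ x hx)
  rw [e]
  refine (abs_add_le _ _).trans ?_
  rw [abs_mul, abs_mul, abs_of_pos (exp_pos _), abs_of_pos hA, add_mul, mul_assoc B, mul_assoc F.A]
  gcongr
  exact (h τ hτ x hx).1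

/-- The space derivative of `W`. -/
noncomputable def Wx (x τ : ℝ) : ℝ := exp (-F.b x τ) * (F.Ux x τ - F.psi x τ * F.U x τ)

@[fun_prop] theorem continuous_Wx {c d : X → ℝ} (hc : Continuous c) (hd : Continuous d) :
    Continuous fun p => F.Wx (c p) (d p) := by
  unfold Wx
  fun_prop

theorem dWx {x τ : ℝ} (hx : x ∈ Ioo (0:ℝ) 1) (hτ : 0 < τ) : HasDerivAt (F.Wx x)
    (-F.Wx x τ + exp (-F.b x τ) * (F.θx x τ - F.psi x τ * F.θ x τ)) τ := by
  have h1 : HasDerivAt (F.psi x) (F.sx x τ) τ := ((F.dvτ x τ hτ).sub_const _).sub_const _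
  have h2 := (F.dbτ (Ioo_subset_Icc_self hx) hτ).neg.exp
  have h3 := (F.dUxτ x hx τ hτ).sub (h1.mul (F.dUτ x τ hτ))
  refine (h2.mul h3).congr_deriv ?_
  have e : (F.vx x τ - F.θ x τ) / F.U x τ = F.s x τ := rfl
  simp only [Pi.neg_apply, Pi.mul_apply, Pi.sub_apply]
  rw [e, vx_eq]
  unfold Wx
  ring

theorem int_Ux_sq_le : ∃ μ > 0, ∃ C > 0, ∀ τ ≥ 0,
    ∫ x in (0:ℝ)..1, F.Ux x τ ^ 2 ≤ C * exp (-μ * τ) := by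
  obtain ⟨μ, hμ, hμ1, C, hC, h⟩ := F.θ_sub_sq_le
  obtain ⟨B, hB, hb⟩ := F.exists_b_bound
  obtain ⟨M, hM, hθ⟩ := F.θ_le
  obtain ⟨K, hK, hU⟩ := F.U_le
  obtain ⟨L, hL, hθx⟩ := F.int_θx_sq_le
  set N := 2 * B ^ 2 * (L * C) + 2 * B ^ 2 * M ^ 2 * (2 * C) with hN
  have hN0 : 0 < N := by positivity
  have hμ' : 0 < 1 - μ := by linarith
  have hpsi : ∀ τ ≥ 0, ∫ x in (0:ℝ)..1, F.psi x τ ^ 2 ≤ 2 * C * exp (-μ * τ) := fun τ hτ =>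
    (F.int_psi_sq_le τ).trans (by linarith [(h τ hτ).1.1])
  have d : ∀ τ > 0, HasDerivAt (fun r => ∫ x in (0:ℝ)..1, F.Wx x r ^ 2) _ τ := fun τ hτ =>
    hasDerivAt_int (f := fun x r => F.Wx x r ^ 2)
      (g := fun x r => 2 * F.Wx x r
        * (-F.Wx x r + exp (-F.b x r) * (F.θx x r - F.psi x r * F.θ x r)))
      (by fun_prop) (by fun_prop) (fun x hx r hr =>
        ((F.dWx hx hr).pow 2).congr_deriv (by simp)) hτ
  have c : Continuous fun r => ∫ x in (0:ℝ)..1, F.Wx x r ^ 2 := continuous_int (by fun_prop)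
  have key := fun (τ : ℝ) (hτ : 0 ≤ τ) => decay_of_deriv_le c.continuousOn d hμ1 hN0.le
    (fun τ hτ => by
      have h1 := hθx τ hτ.le
      have h2 := hpsi τ hτ.le
      have h3 : L * F.z τ ≤ L * (C * exp (-μ * τ)) := by
        gcongr
        exact (h τ hτ.le).1.2.2
      calc _ ≤ ∫ x in (0:ℝ)..1, (-F.Wx x τ ^ 2 + 2 * B ^ 2 * F.θx x τ ^ 2
            + 2 * B ^ 2 * M ^ 2 * F.psi x τ ^ 2) := by
            refine int_mono (by fun_prop) (by fun_prop) fun x hx => ?_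
            have hx := Ioo_subset_Icc_self hx
            have k1 : exp (-F.b x τ) ≤ B :=
              (exp_le_exp.mpr (neg_le_abs _)).trans (hb τ hτ.le x hx)
            have k2 := hθ τ hτ.le x hx
            have k3 := F.θ_pos x τ
            set g := exp (-F.b x τ) * (F.θx x τ - F.psi x τ * F.θ x τ) with hg
            have k4 : g ^ 2 ≤ 2 * B ^ 2 * F.θx x τ ^ 2 + 2 * B ^ 2 * M ^ 2 * F.psi x τ ^ 2 := by
              calc g ^ 2 = exp (-F.b x τ) ^ 2 * (F.θx x τ - F.psi x τ * F.θ x τ) ^ 2 := by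
                    rw [hg, mul_pow]
                _ ≤ B ^ 2 * (2 * F.θx x τ ^ 2 + 2 * (F.psi x τ ^ 2 * F.θ x τ ^ 2)) := by
                    gcongr
                    nlinarith [sq_nonneg (F.θx x τ + F.psi x τ * F.θ x τ)]
                _ ≤ B ^ 2 * (2 * F.θx x τ ^ 2 + 2 * (F.psi x τ ^ 2 * M ^ 2)) := by
                    gcongr
                _ = _ := by ring
            nlinarith [sq_nonneg (F.Wx x τ - g)]
        _ = -(∫ x in (0:ℝ)..1, F.Wx x τ ^ 2) + 2 * B ^ 2 * (∫ x in (0:ℝ)..1, F.θx x τ ^ 2)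
            + 2 * B ^ 2 * M ^ 2 * ∫ x in (0:ℝ)..1, F.psi x τ ^ 2 := by
            rw [int_add (by fun_prop) (by fun_prop), int_add (by fun_prop) (by fun_prop),
              intervalIntegral.integral_neg, intervalIntegral.integral_const_mul,
              intervalIntegral.integral_const_mul]
        _ ≤ -(∫ x in (0:ℝ)..1, F.Wx x τ ^ 2) + 2 * B ^ 2 * (L * (C * exp (-μ * τ)))
            + 2 * B ^ 2 * M ^ 2 * (2 * C * exp (-μ * τ)) := by
            gcongr
            exact h1.trans h3
        _ = _ := by
            rw [hN]
            ring) hτ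
  set J := |∫ x in (0:ℝ)..1, F.Wx x 0 ^ 2| + N / (1 - μ) with hJ
  have hJ0 : 0 < J := by positivity
  refine ⟨μ, hμ, 2 * B ^ 2 * J + 2 * K ^ 2 * (2 * C), by positivity, fun τ hτ => ?_⟩
  have h2 := hpsi τ hτ
  have h3 := key τ hτ
  calc _ ≤ ∫ x in (0:ℝ)..1, (2 * B ^ 2 * F.Wx x τ ^ 2 + 2 * K ^ 2 * F.psi x τ ^ 2) := by
        refine int_mono (by fun_prop) (by fun_prop) fun x hx => ?_
        have hx := Ioo_subset_Icc_self hx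
        have k1 : exp (F.b x τ) ≤ B := (exp_le_exp.mpr (le_abs_self _)).trans (hb τ hτ x hx)
        have k2 := hU τ hτ x hx
        have k3 := F.U_pos x τ
        have e : F.Ux x τ = exp (F.b x τ) * F.Wx x τ + F.U x τ * F.psi x τ := by
          unfold Wx
          rw [← mul_assoc, ← exp_add]
          simp
          ring
        rw [e]
        calc _ ≤ 2 * exp (F.b x τ) ^ 2 * F.Wx x τ ^ 2 + 2 * F.U x τ ^ 2 * F.psi x τ ^ 2 := by
              nlinarith [sq_nonneg (exp (F.b x τ) * F.Wx x τ - F.U x τ * F.psi x τ)]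
          _ ≤ _ := by gcongr
    _ = 2 * B ^ 2 * (∫ x in (0:ℝ)..1, F.Wx x τ ^ 2)
        + 2 * K ^ 2 * ∫ x in (0:ℝ)..1, F.psi x τ ^ 2 := by
        rw [int_add (by fun_prop) (by fun_prop), intervalIntegral.integral_const_mul,
          intervalIntegral.integral_const_mul]
    _ ≤ 2 * B ^ 2 * (J * exp (-μ * τ)) + 2 * K ^ 2 * (2 * C * exp (-μ * τ)) := by gcongr
    _ = _ := by ring

/-- Uniform bounds for the scaled flow. -/
theorem uniform_bounds : ∃ C > 0, ∀ τ ≥ 0, ∀ x ∈ Icc (0:ℝ) 1,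
    C⁻¹ ≤ F.U x τ ∧ F.U x τ ≤ C ∧ C⁻¹ ≤ F.θ x τ ∧ F.θ x τ ≤ C := by
  obtain ⟨k, hk, hθ⟩ := F.θ_lower
  obtain ⟨c, hc, hU⟩ := F.U_ge
  obtain ⟨M, hM, hθM⟩ := F.θ_le
  obtain ⟨B, hB, hUB⟩ := F.U_le
  refine ⟨k⁻¹ + c⁻¹ + M + B, by positivity, fun τ hτ x hx => ?_⟩
  have h1 : 0 < k⁻¹ := by positivity
  have h2 : 0 < c⁻¹ := by positivity
  refine ⟨(inv_le_of_inv_le₀ hc (by linarith)).trans (hU τ hτ x hx),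
    (hUB τ hτ x hx).trans (by linarith),
    (inv_le_of_inv_le₀ hk (by linarith)).trans (hθ τ hτ x hx),
    (hθM τ hτ x hx).trans (by linarith)⟩

/-- Exponential decay in `H¹` for the scaled flow. -/
theorem H1_decay : ∃ C > 0, ∃ lam > 0, ∀ τ ≥ 0,
    √(∫ x in (0:ℝ)..1, ((F.U x τ - F.A) ^ 2 + F.Ux x τ ^ 2))
      + √(∫ x in (0:ℝ)..1, (F.psi x τ ^ 2 + (F.vx x τ - F.A) ^ 2))
      + √(∫ x in (0:ℝ)..1, ((F.θ x τ - F.A) ^ 2 + F.θx x τ ^ 2)) ≤ C * exp (-lam * τ) := by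
  obtain ⟨μ₁, hμ₁, -, C₁, hC₁, h₁⟩ := F.θ_sub_sq_le
  obtain ⟨μ₂, hμ₂, C₂, hC₂, h₂⟩ := F.U_sub_le
  obtain ⟨μ₃, hμ₃, C₃, hC₃, h₃⟩ := F.int_Ux_sq_le
  obtain ⟨K, hK, hU⟩ := F.U_le
  obtain ⟨L, hL, hθx⟩ := F.int_θx_sq_le
  set μ := min μ₁ (min μ₂ μ₃) with hμ
  have hμ0 : 0 < μ := by positivity
  have m₁ : μ ≤ μ₁ := min_le_left _ _
  have m₂ : μ ≤ μ₂ := (min_le_right _ _).trans (min_le_left _ _)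
  have m₃ : μ ≤ μ₃ := (min_le_right _ _).trans (min_le_right _ _)
  refine ⟨√(C₂ ^ 2 + C₃) + √(2 * C₁ + (2 * K * C₁ + 2 * C₁)) + √(C₁ + L * C₁), by positivity,
    μ / 2, by positivity, fun τ hτ => ?_⟩
  set e := exp (-μ * τ) with he
  have he0 : 0 < e := exp_pos _
  have he1 : e ≤ 1 := exp_le_one_iff.mpr (by nlinarith)
  have exp_le : ∀ {ν : ℝ}, μ ≤ ν → exp (-ν * τ) ≤ e := fun hν => exp_le_exp.mpr (by nlinarith)
  obtain ⟨⟨hH, hy, hz⟩, hθ⟩ := h₁ τ hτ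
  have b₁ : C₁ * exp (-μ₁ * τ) ≤ C₁ * e := by
    have := exp_le m₁
    gcongr
  have b₃ : C₃ * exp (-μ₃ * τ) ≤ C₃ * e := by
    have := exp_le m₃
    gcongr
  have iU : ∫ x in (0:ℝ)..1, (F.U x τ - F.A) ^ 2 ≤ C₂ ^ 2 * e := by
    calc _ ≤ ∫ x in (0:ℝ)..1, C₂ ^ 2 * e := by
          refine int_mono (by fun_prop) (by fun_prop) fun x hx => ?_
          have h := (h₂ τ hτ x (Ioo_subset_Icc_self hx)).trans
            (mul_le_mul_of_nonneg_left (exp_le m₂) hC₂.le)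
          rw [← sq_abs]
          calc |F.U x τ - F.A| ^ 2 ≤ (C₂ * e) ^ 2 := by gcongr
            _ = C₂ ^ 2 * (e * e) := by ring
            _ ≤ C₂ ^ 2 * (e * 1) := by gcongr
            _ = _ := by ring
      _ = _ := by simp
  have iθ : ∫ x in (0:ℝ)..1, (F.θ x τ - F.A) ^ 2 ≤ C₁ * e := by
    calc _ ≤ ∫ x in (0:ℝ)..1, C₁ * e :=
          int_mono (by fun_prop) (by fun_prop) fun x hx =>
            (hθ x (Ioo_subset_Icc_self hx)).trans b₁
      _ = _ := by simp
  have iv : ∫ x in (0:ℝ)..1, (F.vx x τ - F.A) ^ 2 ≤ (2 * K * C₁ + 2 * C₁) * e := by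
    calc _ ≤ ∫ x in (0:ℝ)..1, (2 * K * (F.U x τ * F.s x τ ^ 2) + 2 * (F.θ x τ - F.A) ^ 2) := by
          refine int_mono (by fun_prop) (by fun_prop) fun x hx => ?_
          have h1 := hU τ hτ x (Ioo_subset_Icc_self hx)
          have h2 := F.U_pos x τ
          have h3 : F.U x τ * (F.U x τ * F.s x τ ^ 2) ≤ K * (F.U x τ * F.s x τ ^ 2) := by gcongr
          rw [vx_eq]
          nlinarith [sq_nonneg (F.U x τ * F.s x τ - (F.θ x τ - F.A))]
      _ = 2 * K * F.y τ + 2 * ∫ x in (0:ℝ)..1, (F.θ x τ - F.A) ^ 2 := by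
          rw [int_add (by fun_prop) (by fun_prop), intervalIntegral.integral_const_mul,
            intervalIntegral.integral_const_mul]
          rfl
      _ ≤ 2 * K * (C₁ * e) + 2 * (C₁ * e) := by
          have := hy.trans b₁
          gcongr
      _ = _ := by ring
  have ip := F.int_psi_sq_le τ
  have iUx := (h₃ τ hτ).trans b₃
  have iθx : ∫ x in (0:ℝ)..1, F.θx x τ ^ 2 ≤ L * (C₁ * e) :=
    (hθx τ hτ).trans (mul_le_mul_of_nonneg_left (hz.trans b₁) hL.le)
  rw [int_add (by fun_prop) (by fun_prop), int_add (by fun_prop) (by fun_prop),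
    int_add (by fun_prop) (by fun_prop), add_mul, add_mul, ← sqrt_mul_exp, ← sqrt_mul_exp,
    ← sqrt_mul_exp]
  gcongr <;> linarith

end ScaledFlow

/-- The projection of the line onto `[0,1]`. -/
noncomputable def clamp (x : ℝ) : ℝ := max 0 (min x 1)

/-- The growth factor `1 + t` as a function of the logarithmic time. -/
noncomputable def growth (τ : ℝ) : ℝ := exp (max τ 0)

theorem clamp_mem (x : ℝ) : clamp x ∈ Icc (0:ℝ) 1 :=
  ⟨le_max_left _ _, max_le zero_le_one (min_le_right _ _)⟩

theorem clamp_of_mem {x : ℝ} (hx : x ∈ Icc (0:ℝ) 1) : clamp x = x := by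
  rw [clamp, min_eq_left hx.2, max_eq_right hx.1]

@[fun_prop] theorem continuous_clamp : Continuous clamp := by
  unfold clamp
  fun_prop

@[fun_prop] theorem continuous_growth : Continuous growth := by
  unfold growth
  fun_prop

theorem growth_pos (τ : ℝ) : 0 < growth τ := exp_pos _

theorem growth_ne (τ : ℝ) : growth τ ≠ 0 := (growth_pos τ).ne'

theorem growth_sub_mem (τ : ℝ) : growth τ - 1 ∈ Ici (0:ℝ) :=
  sub_nonneg.mpr (one_le_exp (le_max_right _ _))

theorem growth_zero : growth 0 = 1 := by simp [growth]

theorem growth_log {t : ℝ} (ht : 0 ≤ t) : growth (log (1 + t)) = 1 + t := by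
  rw [growth, max_eq_left (log_nonneg (by linarith)), exp_log (by linarith)]

theorem hasDerivAt_growth {τ : ℝ} (hτ : 0 < τ) : HasDerivAt growth (growth τ) τ := by
  have : growth =ᶠ[𝓝 τ] exp := by
    filter_upwards [lt_mem_nhds hτ] with r hr
    rw [growth, max_eq_left hr.le]
  rw [this.eq_of_nhds]
  exact (Real.hasDerivAt_exp τ).congr_of_eventuallyEq this

theorem hasDerivAt_comp_clamp {f : ℝ → ℝ} {d x : ℝ} (hx : x ∈ Ioo (0:ℝ) 1)
    (h : HasDerivWithinAt f d (Icc 0 1) (clamp x)) : HasDerivAt (fun y => f (clamp y)) d x := by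
  rw [clamp_of_mem (Ioo_subset_Icc_self hx)] at h
  refine (h.hasDerivAt (Icc_mem_nhds hx.1 hx.2)).congr_of_eventuallyEq ?_
  filter_upwards [Ioo_mem_nhds hx.1 hx.2] with y hy
  rw [clamp_of_mem (Ioo_subset_Icc_self hy)]

theorem hasDerivAt_comp_growth {f : ℝ → ℝ} {d τ : ℝ} (hτ : 0 < τ)
    (h : HasDerivWithinAt f d (Ici 0) (growth τ - 1)) :
    HasDerivAt (fun r => f (growth r - 1)) (d * growth τ) τ := by
  have h1 : 0 < growth τ - 1 := by
    rw [growth, max_eq_left hτ.le]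
    linarith [add_one_le_exp τ]
  exact (h.hasDerivAt (Ici_mem_nhds h1)).comp τ ((hasDerivAt_growth hτ).sub_const 1)

theorem continuous_comp_clamp_growth {g : ℝ → ℝ → ℝ}
    (hg : ContinuousOn (Function.uncurry g) (Icc 0 1 ×ˢ Ici 0)) :
    Continuous fun p : ℝ × ℝ => g (clamp p.1) (growth p.2 - 1) :=
  hg.comp_continuous (f := fun p : ℝ × ℝ => (clamp p.1, growth p.2 - 1)) (by fun_prop)
    fun p => ⟨clamp_mem _, growth_sub_mem _⟩

variable (S : NSOrigSol)

theorem int_clamp_growth_zero (g : ℝ → ℝ → ℝ) :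
    ∫ x in (0:ℝ)..1, g (S.v (clamp x) (growth 0 - 1)) (S.θ (clamp x) (growth 0 - 1))
      = ∫ x in (0:ℝ)..1, g (S.v x 0) (S.θ x 0) := by
  apply int_congr
  intro x hx
  rw [clamp_of_mem (Ioo_subset_Icc_self hx), growth_zero, sub_self]

theorem mean_sq_lt_energy : (∫ x in (0:ℝ)..1, S.v x 0) ^ 2 < 2 * S.E₀ := by
  have cv : Continuous fun x => S.v (clamp x) 0 :=
    S.hv_cont.comp_continuous (f := fun x : ℝ => (clamp x, (0:ℝ))) (by fun_prop)
      fun p => ⟨clamp_mem _, by simp⟩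
  have cθ : Continuous fun x => S.θ (clamp x) 0 :=
    S.hθ_cont.comp_continuous (f := fun x : ℝ => (clamp x, (0:ℝ))) (by fun_prop)
      fun p => ⟨clamp_mem _, by simp⟩
  have e1 : ∫ x in (0:ℝ)..1, S.v x 0 = ∫ x in (0:ℝ)..1, S.v (clamp x) 0 * 1 :=
    int_congr fun x hx => by rw [clamp_of_mem (Ioo_subset_Icc_self hx), mul_one]
  have e2 : S.E₀ = ∫ x in (0:ℝ)..1, (S.v (clamp x) 0 ^ 2 / 1 / 2 + S.θ (clamp x) 0) :=
    int_congr fun x hx => by rw [clamp_of_mem (Ioo_subset_Icc_self hx), div_one]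
  have h1 := int_mul_sq_le (f := fun x => S.v (clamp x) 0) (g := fun _ => 1) (w := fun _ => 1)
    cv (by fun_prop) (by fun_prop) (fun _ => one_pos)
  have h2 : 0 < ∫ x in (0:ℝ)..1, S.θ (clamp x) 0 :=
    intervalIntegral.intervalIntegral_pos_of_pos (cθ.intervalIntegrable _ _)
      (fun x => S.hθ_pos _ (clamp_mem x) 0 (by simp)) zero_lt_one
  rw [e1, e2, int_add (by fun_prop) (by fun_prop), intervalIntegral.integral_div]
  simp only [one_pow, mul_one, intervalIntegral.integral_const, sub_zero, one_smul] at h1 ⊢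
  linarith

theorem hasDerivAt_scaled_volume (x : ℝ) {τ : ℝ} (hτ : 0 < τ) :
    HasDerivAt (fun r => S.u (clamp x) (growth r - 1) / growth r)
      (S.vx (clamp x) (growth τ - 1) - S.u (clamp x) (growth τ - 1) / growth τ) τ := by
  have h := (hasDerivAt_comp_growth hτ (S.hut _ (clamp_mem x) _ (growth_sub_mem _))).fun_div
    (hasDerivAt_growth hτ) (growth_ne τ)
  refine h.congr_deriv ?_
  have := growth_ne τ
  rw [S.mass _ (clamp_mem x) _ (growth_sub_mem _)]
  field_simp

theorem hasDerivAt_scaled_volume_x {x τ : ℝ} (hx : x ∈ Ioo (0:ℝ) 1) (hτ : 0 < τ) :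
    HasDerivAt (fun r => S.ux (clamp x) (growth r - 1) / growth r)
      (growth τ * S.vt (clamp x) (growth τ - 1) * (S.u (clamp x) (growth τ - 1) / growth τ)
        + (S.vx (clamp x) (growth τ - 1) - S.θ (clamp x) (growth τ - 1))
          / (S.u (clamp x) (growth τ - 1) / growth τ) * (S.ux (clamp x) (growth τ - 1) / growth τ)
        + S.θx (clamp x) (growth τ - 1) - S.ux (clamp x) (growth τ - 1) / growth τ) τ := by
  have cu := (continuous_comp_clamp_growth S.hu_cont).div (g := fun p => growth p.2)
    (by fun_prop) fun _ => growth_ne _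
  have cux := (continuous_comp_clamp_growth S.hux_cont).div (g := fun p => growth p.2)
    (by fun_prop) fun _ => growth_ne _
  have du : ∀ x ∈ Ioo (0:ℝ) 1, ∀ τ,
      HasDerivAt (fun y => S.u (clamp y) (growth τ - 1) / growth τ)
        (S.ux (clamp x) (growth τ - 1) / growth τ) x := fun x hx τ =>
    hasDerivAt_comp_clamp (f := fun y => S.u y (growth τ - 1) / growth τ) hx
      ((S.hux _ (clamp_mem _) _ (growth_sub_mem _)).div_const _)
  have dv : ∀ x ∈ Ioo (0:ℝ) 1, ∀ τ, HasDerivAt (fun y => S.vx (clamp y) (growth τ - 1))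
      (S.vxx (clamp x) (growth τ - 1)) x := fun x hx τ =>
    hasDerivAt_comp_clamp (f := fun y => S.vx y (growth τ - 1)) hx
      (S.hvxx _ (clamp_mem _) _ (growth_sub_mem _))
  have h := hasDerivAt_mixed
    (f := fun x τ => S.u (clamp x) (growth τ - 1) / growth τ)
    (fx := fun x τ => S.ux (clamp x) (growth τ - 1) / growth τ)
    (g := fun x τ => S.vx (clamp x) (growth τ - 1) - S.u (clamp x) (growth τ - 1) / growth τ)
    (gx := fun x τ => S.vxx (clamp x) (growth τ - 1) - S.ux (clamp x) (growth τ - 1) / growth τ)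
    ((continuous_comp_clamp_growth S.hvx_cont).sub cu)
    ((continuous_comp_clamp_growth S.hvxx_cont).sub cux) du
    (fun x hx τ => (dv x hx τ).sub (du x hx τ))
    (fun x _ τ hτ => hasDerivAt_scaled_volume S x hτ) hx hτ
  refine h.congr_deriv ?_
  have ds := hasDerivAt_comp_clamp
    (f := fun y => (S.vx y (growth τ - 1) - S.θ y (growth τ - 1)) / S.u y (growth τ - 1)) hx
    (S.momentum _ (clamp_mem _) _ (growth_sub_mem _))
  have dθ := hasDerivAt_comp_clamp (f := fun y => S.θ y (growth τ - 1)) hx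
    (S.hθx _ (clamp_mem _) _ (growth_sub_mem _))
  have dw := hasDerivAt_comp_clamp (f := fun y => S.u y (growth τ - 1)) hx
    (S.hux _ (clamp_mem _) _ (growth_sub_mem _))
  have e : S.vxx (clamp x) (growth τ - 1) = _ := (dv x hx τ).unique
    (((ds.mul dw).add dθ).congr_of_eventuallyEq (Eventually.of_forall fun y => by
      have := (S.hu_pos _ (clamp_mem y) _ (growth_sub_mem τ)).ne'
      simp only [Pi.add_apply, Pi.mul_apply]
      field_simp
      ring))
  rw [e]
  have := growth_ne τ
  have := (S.hu_pos _ (clamp_mem x) _ (growth_sub_mem τ)).ne'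
  field_simp

/-- The solution in logarithmic time, extended to the plane. -/
noncomputable def scaled : ScaledFlow where
  β := S.β
  m := ∫ x in (0:ℝ)..1, S.v x 0
  A := S.A
  β_pos := S.hβ
  A_pos := by
    have h : √(6 ^ 2) < √(36 + 3 * (2 * S.E₀ - (∫ x in (0:ℝ)..1, S.v x 0) ^ 2)) :=
      Real.sqrt_lt_sqrt (by norm_num) (by linarith [mean_sq_lt_energy S])
    rw [Real.sqrt_sq (by norm_num)] at h
    unfold NSOrigSol.A
    linarith
  U x τ := S.u (clamp x) (growth τ - 1) / growth τ
  v x τ := S.v (clamp x) (growth τ - 1)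
  θ x τ := S.θ (clamp x) (growth τ - 1)
  Ux x τ := S.ux (clamp x) (growth τ - 1) / growth τ
  vx x τ := S.vx (clamp x) (growth τ - 1)
  θx x τ := S.θx (clamp x) (growth τ - 1)
  sx x τ := growth τ * S.vt (clamp x) (growth τ - 1)
  qx x τ := growth τ * (S.θt (clamp x) (growth τ - 1)
    + S.θ (clamp x) (growth τ - 1) * S.vx (clamp x) (growth τ - 1)
        / S.u (clamp x) (growth τ - 1)
    - S.vx (clamp x) (growth τ - 1) ^ 2 / S.u (clamp x) (growth τ - 1))
  cU := (continuous_comp_clamp_growth S.hu_cont).div (by fun_prop) fun _ => growth_ne _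
  cv := continuous_comp_clamp_growth S.hv_cont
  cθ := continuous_comp_clamp_growth S.hθ_cont
  cUx := (continuous_comp_clamp_growth S.hux_cont).div (by fun_prop) fun _ => growth_ne _
  cvx := continuous_comp_clamp_growth S.hvx_cont
  cθx := continuous_comp_clamp_growth S.hθx_cont
  csx := Continuous.mul (by fun_prop) (continuous_comp_clamp_growth S.hvt_cont)
  cqx := by
    have hu := continuous_comp_clamp_growth S.hu_cont
    have hvx := continuous_comp_clamp_growth S.hvx_cont
    have hu0 : ∀ p : ℝ × ℝ, S.u (clamp p.1) (growth p.2 - 1) ≠ 0 := fun p =>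
      (S.hu_pos _ (clamp_mem _) _ (growth_sub_mem _)).ne'
    exact Continuous.mul (by fun_prop) (((continuous_comp_clamp_growth S.hθt_cont).add
      (((continuous_comp_clamp_growth S.hθ_cont).mul hvx).div hu hu0)).sub
      ((hvx.pow 2).div hu hu0))
  U_pos x τ := div_pos (S.hu_pos _ (clamp_mem _) _ (growth_sub_mem _)) (growth_pos _)
  θ_pos x τ := S.hθ_pos _ (clamp_mem _) _ (growth_sub_mem _)
  dUx x hx τ := hasDerivAt_comp_clamp (f := fun y => S.u y (growth τ - 1) / growth τ) hx
    ((S.hux _ (clamp_mem _) _ (growth_sub_mem _)).div_const _)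
  dvx x hx τ := hasDerivAt_comp_clamp (f := fun y => S.v y (growth τ - 1)) hx
    (S.hvx _ (clamp_mem _) _ (growth_sub_mem _))
  dθx x hx τ := hasDerivAt_comp_clamp (f := fun y => S.θ y (growth τ - 1)) hx
    (S.hθx _ (clamp_mem _) _ (growth_sub_mem _))
  dsx x hx τ := by
    have h := (hasDerivAt_comp_clamp
      (f := fun y => (S.vx y (growth τ - 1) - S.θ y (growth τ - 1)) / S.u y (growth τ - 1)) hx
      (S.momentum _ (clamp_mem _) _ (growth_sub_mem _))).const_mul (growth τ)
    refine h.congr_of_eventuallyEq (Eventually.of_forall fun y => ?_)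
    simp only
    rw [div_div_eq_mul_div]
    ring
  dqx x hx τ := by
    have h := (hasDerivAt_comp_clamp (f := fun y => S.θ y (growth τ - 1) ^ S.β
        * S.θx y (growth τ - 1) / S.u y (growth τ - 1)) hx
      (S.energyEq _ (clamp_mem _) _ (growth_sub_mem _))).const_mul (growth τ)
    refine h.congr_of_eventuallyEq (Eventually.of_forall fun y => ?_)
    simp only
    rw [div_div_eq_mul_div]
    ring
  bs0 τ := by
    have hu := S.hu_pos 0 (by simp) _ (growth_sub_mem τ)
    have h := S.bc0 _ (growth_sub_mem τ)
    rw [div_eq_zero_iff, or_iff_left hu.ne', sub_eq_zero] at h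
    simpa only [clamp_of_mem (x := 0) (by simp)] using h
  bs1 τ := by
    have hu := S.hu_pos 1 (by simp) _ (growth_sub_mem τ)
    have h := S.bc1 _ (growth_sub_mem τ)
    rw [div_eq_zero_iff, or_iff_left hu.ne', sub_eq_zero] at h
    simpa only [clamp_of_mem (x := 1) (by simp)] using h
  bq0 τ := by
    simpa only [clamp_of_mem (x := 0) (by simp)] using S.bcθ0 _ (growth_sub_mem τ)
  bq1 τ := by
    simpa only [clamp_of_mem (x := 1) (by simp)] using S.bcθ1 _ (growth_sub_mem τ)
  dUτ x τ hτ := hasDerivAt_scaled_volume S x hτ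
  dvτ x τ hτ := (hasDerivAt_comp_growth hτ (S.hvt _ (clamp_mem x) _ (growth_sub_mem _))).congr_deriv
    (mul_comm _ _)
  dθτ x τ hτ := by
    refine (hasDerivAt_comp_growth hτ
      (S.hθt _ (clamp_mem x) _ (growth_sub_mem _))).congr_deriv ?_
    have := growth_ne τ
    have hu := (S.hu_pos _ (clamp_mem x) _ (growth_sub_mem τ)).ne'
    field_simp
    ring
  dUxτ x hx τ hτ := hasDerivAt_scaled_volume_x S hx hτ
  mean_v := int_clamp_growth_zero S fun a _ => a
  energy := by
    have h : 0 ≤ 36 + 3 * (2 * S.E₀ - (∫ x in (0:ℝ)..1, S.v x 0) ^ 2) := by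
      linarith [mean_sq_lt_energy S]
    have h1 := Real.sq_sqrt h
    have h2 := int_clamp_growth_zero S fun a b => a ^ 2 / 2 + b
    refine h2.trans ?_
    change S.E₀ = _
    unfold NSOrigSol.A
    linarith

end NSLargeTime

/-- Large-time behavior for the stress-free problem: uniform two-sided bounds on
`u/(1+t)` and `θ`, and exponential-in-scaled-time (`(1+t)^{-λ}`) convergence of
`(u/(1+t), v − ∫v₀ − A(x−1/2), θ)` to `(A, 0, A)` in `H¹(0,1)`. -/
theorem main_large_time_behavior (S : NSOrigSol) :
    ∃ C > (0:ℝ), ∃ lam > (0:ℝ),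
      (∀ x ∈ Icc (0:ℝ) 1, ∀ t ∈ Ici (0:ℝ),
        C⁻¹ ≤ S.u x t / (1 + t) ∧ S.u x t / (1 + t) ≤ C ∧
        C⁻¹ ≤ S.θ x t ∧ S.θ x t ≤ C) ∧
      ∀ t ∈ Ici (0:ℝ),
        Real.sqrt (∫ x in (0:ℝ)..1,
            ((S.u x t / (1 + t) - S.A) ^ 2 + (S.ux x t / (1 + t)) ^ 2))
        + Real.sqrt (∫ x in (0:ℝ)..1,
            ((S.v x t - (∫ y in (0:ℝ)..1, S.v y 0) - S.A * (x - 1 / 2)) ^ 2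
              + (S.vx x t - S.A) ^ 2))
        + Real.sqrt (∫ x in (0:ℝ)..1, ((S.θ x t - S.A) ^ 2 + (S.θx x t) ^ 2))
        ≤ C * (1 + t) ^ (-lam) := by
  obtain ⟨C₁, hC₁, hb⟩ := (NSLargeTime.scaled S).uniform_bounds
  obtain ⟨C₂, hC₂, lam, hlam, hd⟩ := (NSLargeTime.scaled S).H1_decay
  have time : ∀ t ∈ Ici (0:ℝ), NSLargeTime.growth (log (1 + t)) = 1 + t ∧ 0 ≤ log (1 + t) :=
    fun t ht => ⟨NSLargeTime.growth_log ht, log_nonneg (le_add_of_nonneg_right ht)⟩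
  refine ⟨C₁ + C₂, by positivity, lam, hlam, fun x hx t ht => ?_, fun t ht => ?_⟩
  · obtain ⟨hg, hl⟩ := time t ht
    obtain ⟨h1, h2, h3, h4⟩ := hb _ hl x hx
    simp only [NSLargeTime.scaled, NSLargeTime.clamp_of_mem hx, hg, add_sub_cancel_left]
      at h1 h2 h3 h4
    have h5 : (C₁ + C₂)⁻¹ ≤ C₁⁻¹ := by
      gcongr
      linarith
    exact ⟨h5.trans h1, h2.trans (by linarith), h5.trans h3, h4.trans (by linarith)⟩
  · obtain ⟨hg, hl⟩ := time t ht
    have ht1 : 0 < 1 + t := add_pos_of_pos_of_nonneg one_pos ht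
    have h := hd _ hl
    simp only [NSLargeTime.ScaledFlow.psi, NSLargeTime.scaled, hg, add_sub_cancel_left] at h
    rw [rpow_def_of_pos ht1, mul_comm (log (1 + t))]
    have h5 : C₂ * exp (-lam * log (1 + t)) ≤ (C₁ + C₂) * exp (-lam * log (1 + t)) := by
      gcongr
      linarith
    refine le_trans (le_of_eq ?_) (h.trans h5)
    congr 1
    · congr 1
      all_goals
        congr 1
        exact NSLargeTime.int_congr fun x hx => by
          rw [NSLargeTime.clamp_of_mem (Ioo_subset_Icc_self hx)]
    · congr 1
      exact NSLargeTime.int_congr fun x hx => by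
        rw [NSLargeTime.clamp_of_mem (Ioo_subset_Icc_self hx)]
end

section
/- The specific volume admits the explicit representation: for all (x,t) ∈ [0,1]×[0,∞), u(x,t) = e^{−t} u₀(x) B(x,t) + e^{−t} B(x,t) ∫₀ᵗ (θ(x,s) e^{s} / B(x,s)) ds, where B(x,t) = exp(∫₀ˣ (v(ξ,t) − v₀(ξ)) dξ). -/
open MeasureTheory Real Set Filter Topology

/-- A classical solution on `[0,1] × [0,∞)` of the rescaled stress-free
one-dimensional compressible Navier–Stokes system
`u_t + u = v_x`, `v_t = ((v_x - θ)/u)_x`,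
`θ_t = -θ v_x/u + v_x²/u + (θ^β θ_x/u)_x` (β > 0),
with stress-free, thermally insulated boundary conditions and positive data. -/
structure NSSol where
  β : ℝ
  hβ : 0 < β
  u : ℝ → ℝ → ℝ
  v : ℝ → ℝ → ℝ
  θ : ℝ → ℝ → ℝ
  ux : ℝ → ℝ → ℝ
  ut : ℝ → ℝ → ℝ
  vx : ℝ → ℝ → ℝ
  vt : ℝ → ℝ → ℝ
  vxx : ℝ → ℝ → ℝ
  θx : ℝ → ℝ → ℝ
  θt : ℝ → ℝ → ℝ
  θxx : ℝ → ℝ → ℝ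
  hu_pos : ∀ x ∈ Icc (0:ℝ) 1, ∀ t ∈ Ici (0:ℝ), 0 < u x t
  hθ_pos : ∀ x ∈ Icc (0:ℝ) 1, ∀ t ∈ Ici (0:ℝ), 0 < θ x t
  hux : ∀ x ∈ Icc (0:ℝ) 1, ∀ t ∈ Ici (0:ℝ),
    HasDerivWithinAt (fun y => u y t) (ux x t) (Icc 0 1) x
  hut : ∀ x ∈ Icc (0:ℝ) 1, ∀ t ∈ Ici (0:ℝ),
    HasDerivWithinAt (fun s => u x s) (ut x t) (Ici 0) t
  hvx : ∀ x ∈ Icc (0:ℝ) 1, ∀ t ∈ Ici (0:ℝ),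
    HasDerivWithinAt (fun y => v y t) (vx x t) (Icc 0 1) x
  hvt : ∀ x ∈ Icc (0:ℝ) 1, ∀ t ∈ Ici (0:ℝ),
    HasDerivWithinAt (fun s => v x s) (vt x t) (Ici 0) t
  hvxx : ∀ x ∈ Icc (0:ℝ) 1, ∀ t ∈ Ici (0:ℝ),
    HasDerivWithinAt (fun y => vx y t) (vxx x t) (Icc 0 1) x
  hθx : ∀ x ∈ Icc (0:ℝ) 1, ∀ t ∈ Ici (0:ℝ),
    HasDerivWithinAt (fun y => θ y t) (θx x t) (Icc 0 1) x
  hθt : ∀ x ∈ Icc (0:ℝ) 1, ∀ t ∈ Ici (0:ℝ),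
    HasDerivWithinAt (fun s => θ x s) (θt x t) (Ici 0) t
  hθxx : ∀ x ∈ Icc (0:ℝ) 1, ∀ t ∈ Ici (0:ℝ),
    HasDerivWithinAt (fun y => θx y t) (θxx x t) (Icc 0 1) x
  hu_cont : ContinuousOn (Function.uncurry u) (Icc 0 1 ×ˢ Ici 0)
  hv_cont : ContinuousOn (Function.uncurry v) (Icc 0 1 ×ˢ Ici 0)
  hθ_cont : ContinuousOn (Function.uncurry θ) (Icc 0 1 ×ˢ Ici 0)
  hux_cont : ContinuousOn (Function.uncurry ux) (Icc 0 1 ×ˢ Ici 0)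
  hut_cont : ContinuousOn (Function.uncurry ut) (Icc 0 1 ×ˢ Ici 0)
  hvx_cont : ContinuousOn (Function.uncurry vx) (Icc 0 1 ×ˢ Ici 0)
  hvt_cont : ContinuousOn (Function.uncurry vt) (Icc 0 1 ×ˢ Ici 0)
  hvxx_cont : ContinuousOn (Function.uncurry vxx) (Icc 0 1 ×ˢ Ici 0)
  hθx_cont : ContinuousOn (Function.uncurry θx) (Icc 0 1 ×ˢ Ici 0)
  hθt_cont : ContinuousOn (Function.uncurry θt) (Icc 0 1 ×ˢ Ici 0)
  hθxx_cont : ContinuousOn (Function.uncurry θxx) (Icc 0 1 ×ˢ Ici 0)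
  mass : ∀ x ∈ Icc (0:ℝ) 1, ∀ t ∈ Ici (0:ℝ), ut x t + u x t = vx x t
  momentum : ∀ x ∈ Icc (0:ℝ) 1, ∀ t ∈ Ici (0:ℝ),
    HasDerivWithinAt (fun y => (vx y t - θ y t) / u y t) (vt x t) (Icc 0 1) x
  energyEq : ∀ x ∈ Icc (0:ℝ) 1, ∀ t ∈ Ici (0:ℝ),
    HasDerivWithinAt (fun y => θ y t ^ β * θx y t / u y t)
      (θt x t + θ x t * vx x t / u x t - (vx x t) ^ 2 / u x t) (Icc 0 1) x
  bc0 : ∀ t ∈ Ici (0:ℝ), (vx 0 t - θ 0 t) / u 0 t = 0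
  bc1 : ∀ t ∈ Ici (0:ℝ), (vx 1 t - θ 1 t) / u 1 t = 0
  bcθ0 : ∀ t ∈ Ici (0:ℝ), θx 0 t = 0
  bcθ1 : ∀ t ∈ Ici (0:ℝ), θx 1 t = 0

namespace NSSol

/-- The initial energy `E₀ = ∫₀¹ (v₀²/2 + θ₀) dx`. -/
noncomputable def E₀ (S : NSSol) : ℝ := ∫ x in (0:ℝ)..1, ((S.v x 0) ^ 2 / 2 + S.θ x 0)

/-- The dissipation functional
`V(t) = ∫₀¹ (θ^β θ_x²/(uθ²) + (v_x − θ)²/(uθ)) dx`. -/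
noncomputable def V (S : NSSol) (t : ℝ) : ℝ :=
  ∫ x in (0:ℝ)..1,
    (S.θ x t ^ S.β * (S.θx x t) ^ 2 / (S.u x t * (S.θ x t) ^ 2)
      + (S.vx x t - S.θ x t) ^ 2 / (S.u x t * S.θ x t))

/-- The auxiliary velocity
`w(x,t) = v(x,t) − ∫₀¹ v₀ dξ − ∫₀ˣ u(ξ,t) dξ + ∫₀¹∫₀^ξ u(η,t) dη dξ`,
which satisfies `w_x = v_x − u` and `∫₀¹ w dx = 0`. -/
noncomputable def w (S : NSSol) (x t : ℝ) : ℝ :=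
  S.v x t - (∫ ξ in (0:ℝ)..1, S.v ξ 0) - (∫ ξ in (0:ℝ)..x, S.u ξ t)
    + ∫ ξ in (0:ℝ)..1, ∫ η in (0:ℝ)..ξ, S.u η t

/-- The asymptotic state `A = 2√(36 + 3(2E₀ − (∫₀¹ v₀ dx)²)) − 12`. -/
noncomputable def A (S : NSSol) : ℝ :=
  2 * Real.sqrt (36 + 3 * (2 * S.E₀ - (∫ x in (0:ℝ)..1, S.v x 0) ^ 2)) - 12

end NSSol

/-- The factor `B(x,t) = exp(∫₀ˣ (v(ξ,t) − v₀(ξ)) dξ)`. -/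
noncomputable def NSSol.B (S : NSSol) (x t : ℝ) : ℝ :=
  Real.exp (∫ ξ in (0:ℝ)..x, (S.v ξ t - S.v ξ 0))

namespace NSSol

lemma continuousOn_slice_space {f : ℝ → ℝ → ℝ}
    (hf : ContinuousOn (Function.uncurry f) (Icc 0 1 ×ˢ Ici 0)) {t : ℝ} (ht : 0 ≤ t) :
    ContinuousOn (fun x => f x t) (Icc 0 1) :=
  hf.comp (f := fun x : ℝ => (x, t)) (by fun_prop) fun _ hx => ⟨hx, ht⟩

lemma continuousOn_slice_time {f : ℝ → ℝ → ℝ}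
    (hf : ContinuousOn (Function.uncurry f) (Icc 0 1 ×ˢ Ici 0)) {x : ℝ} (hx : x ∈ Icc (0:ℝ) 1) :
    ContinuousOn (fun t => f x t) (Ici 0) :=
  hf.comp (f := fun t : ℝ => (x, t)) (by fun_prop) fun _ ht => ⟨hx, ht⟩

lemma intervalIntegrable_of_continuousOn_Ici {f : ℝ → ℝ} (hf : ContinuousOn f (Ici 0))
    {t : ℝ} (ht : 0 ≤ t) : IntervalIntegrable f volume 0 t :=
  (hf.mono Icc_subset_Ici_self).intervalIntegrable_of_Icc ht

/-- The effective stress `(v_x − θ)/u`. -/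
noncomputable def stress (S : NSSol) (x t : ℝ) : ℝ := (S.vx x t - S.θ x t) / S.u x t

lemma continuousOn_stress (S : NSSol) {x : ℝ} (hx : x ∈ Icc (0:ℝ) 1) :
    ContinuousOn (S.stress x) (Ici 0) :=
  ((continuousOn_slice_time S.hvx_cont hx).sub (continuousOn_slice_time S.hθ_cont hx)).div
    (continuousOn_slice_time S.hu_cont hx) fun t ht => (S.hu_pos x hx t ht).ne'

lemma velocity_sub_eq_integral (S : NSSol) {x : ℝ} (hx : x ∈ Icc (0:ℝ) 1) {t : ℝ} (ht : 0 ≤ t) :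
    S.v x t - S.v x 0 = ∫ s in (0:ℝ)..t, S.vt x s :=
  (intervalIntegral.integral_eq_sub_of_hasDerivAt_of_le ht
    ((continuousOn_slice_time S.hv_cont hx).mono Icc_subset_Ici_self)
    (fun s hs => (S.hvt x hx s hs.1.le).hasDerivAt (Ici_mem_nhds hs.1))
    (intervalIntegrable_of_continuousOn_Ici (continuousOn_slice_time S.hvt_cont hx) ht)).symm

lemma integral_vt_eq_stress (S : NSSol) {x : ℝ} (hx : x ∈ Icc (0:ℝ) 1) {t : ℝ} (ht : 0 ≤ t) :
    ∫ ξ in (0:ℝ)..x, S.vt ξ t = S.stress x t := by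
  have hsub : Icc 0 x ⊆ Icc (0:ℝ) 1 := Icc_subset_Icc_right hx.2
  have h := intervalIntegral.integral_eq_sub_of_hasDerivAt_of_le
    (f := fun ξ => S.stress ξ t) (f' := fun ξ => S.vt ξ t) hx.1
    (fun ξ hξ => ((S.momentum ξ (hsub hξ) t ht).continuousWithinAt).mono hsub)
    (fun ξ hξ => (S.momentum ξ (hsub (Ioo_subset_Icc_self hξ)) t ht).hasDerivAt
      (Icc_mem_nhds hξ.1 (hξ.2.trans_le hx.2)))
    (((continuousOn_slice_space S.hvt_cont ht).mono hsub).intervalIntegrable_of_Icc hx.1)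
  have h0 : S.stress 0 t = 0 := S.bc0 t ht
  rw [h, h0, sub_zero]

/-- Integrating the momentum equation in space and time: `B = exp (∫₀ᵗ (v_x − θ)/u ds)`. -/
lemma B_eq_exp_integral_stress (S : NSSol) {x : ℝ} (hx : x ∈ Icc (0:ℝ) 1) {t : ℝ} (ht : 0 ≤ t) :
    S.B x t = Real.exp (∫ s in (0:ℝ)..t, S.stress x s) := by
  have hsub : Icc 0 x ⊆ Icc (0:ℝ) 1 := Icc_subset_Icc_right hx.2
  have hint : IntegrableOn (Function.uncurry S.vt) (uIoc 0 x ×ˢ uIoc 0 t) := by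
    rw [uIoc_of_le hx.1, uIoc_of_le ht]
    refine IntegrableOn.mono_set (t := Icc 0 x ×ˢ Icc 0 t) ?_
      (prod_mono Ioc_subset_Icc_self Ioc_subset_Icc_self)
    exact (S.hvt_cont.mono (prod_mono hsub Icc_subset_Ici_self)).integrableOn_compact
      (isCompact_Icc.prod isCompact_Icc)
  have h₁ : ∫ ξ in (0:ℝ)..x, (S.v ξ t - S.v ξ 0) = ∫ ξ in (0:ℝ)..x, ∫ s in (0:ℝ)..t, S.vt ξ s :=
    intervalIntegral.integral_congr fun ξ hξ =>
      S.velocity_sub_eq_integral (hsub (uIcc_of_le hx.1 ▸ hξ)) ht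
  have h₂ : ∫ s in (0:ℝ)..t, ∫ ξ in (0:ℝ)..x, S.vt ξ s = ∫ s in (0:ℝ)..t, S.stress x s :=
    intervalIntegral.integral_congr fun s hs =>
      S.integral_vt_eq_stress hx (uIcc_of_le ht ▸ hs : s ∈ Icc 0 t).1
  rw [B, h₁, intervalIntegral_intervalIntegral_swap hint, h₂]

lemma B_zero (S : NSSol) (x : ℝ) : S.B x 0 = 1 := by simp [B]

lemma continuousOn_B (S : NSSol) {x : ℝ} (hx : x ∈ Icc (0:ℝ) 1) (t : ℝ) (ht : 0 ≤ t) :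
    ContinuousOn (S.B x) (Icc 0 t) := by
  have h := intervalIntegral.continuousOn_primitive_interval (μ := volume) (a := 0) (b := t)
    (f := S.stress x) <| by
      rw [uIcc_of_le ht]
      exact ((S.continuousOn_stress hx).mono Icc_subset_Ici_self).integrableOn_Icc
  rw [uIcc_of_le ht] at h
  exact h.rexp.congr fun s hs => S.B_eq_exp_integral_stress hx hs.1

lemma hasDerivAt_B (S : NSSol) {x : ℝ} (hx : x ∈ Icc (0:ℝ) 1) {t : ℝ} (ht : 0 < t) :
    HasDerivAt (S.B x) (S.B x t * S.stress x t) t := by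
  have hc := S.continuousOn_stress hx
  have h := (intervalIntegral.integral_hasDerivAt_right
    (intervalIntegrable_of_continuousOn_Ici hc ht.le)
    ((hc.mono Ioi_subset_Ici_self).stronglyMeasurableAtFilter isOpen_Ioi t ht)
    (hc.continuousAt (Ici_mem_nhds ht))).exp
  rw [← S.B_eq_exp_integral_stress hx ht.le] at h
  refine h.congr_of_eventuallyEq ?_
  filter_upwards [Ioi_mem_nhds ht] with s hs
  exact S.B_eq_exp_integral_stress hx (le_of_lt hs)

lemma hasDerivAt_exp_mul_u_div_B (S : NSSol) {x : ℝ} (hx : x ∈ Icc (0:ℝ) 1) {t : ℝ} (ht : 0 < t) :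
    HasDerivAt (fun s => Real.exp s * S.u x s / S.B x s) (S.θ x t * Real.exp t / S.B x t) t := by
  have hB : S.B x t ≠ 0 := (Real.exp_pos _).ne'
  have hu : S.u x t ≠ 0 := (S.hu_pos x hx t ht.le).ne'
  have hm : S.ut x t = S.vx x t - S.u x t := eq_sub_of_add_eq (S.mass x hx t ht.le)
  have h := ((Real.hasDerivAt_exp t).mul
    ((S.hut x hx t ht.le).hasDerivAt (Ici_mem_nhds ht))).div (S.hasDerivAt_B hx ht) hB
  refine h.congr_deriv ?_
  rw [stress, hm, Pi.mul_apply]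
  field_simp
  ring

end NSSol

/-- Explicit representation of the specific volume:
`u(x,t) = e^{−t} u₀(x) B(x,t) + e^{−t} B(x,t) ∫₀ᵗ θ(x,s) e^s / B(x,s) ds`. -/
theorem u_explicit_representation (S : NSSol) :
    ∀ x ∈ Icc (0:ℝ) 1, ∀ t ∈ Ici (0:ℝ),
      S.u x t = Real.exp (-t) * S.u x 0 * S.B x t
        + Real.exp (-t) * S.B x t * ∫ s in (0:ℝ)..t, S.θ x s * Real.exp s / S.B x s := by
  intro x hx t ht
  replace ht : 0 ≤ t := ht
  have hB : ∀ s, S.B x s ≠ 0 := fun s => (Real.exp_pos _).ne'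
  have hBc := S.continuousOn_B hx t ht
  have hθ := (NSSol.continuousOn_slice_time S.hθ_cont hx).mono (Icc_subset_Ici_self : Icc 0 t ⊆ _)
  have hu := (NSSol.continuousOn_slice_time S.hu_cont hx).mono (Icc_subset_Ici_self : Icc 0 t ⊆ _)
  have key := intervalIntegral.integral_eq_sub_of_hasDerivAt_of_le ht
    ((Real.continuous_exp.continuousOn.mul hu).div hBc fun s _ => hB s)
    (fun s hs => S.hasDerivAt_exp_mul_u_div_B hx hs.1)
    (((hθ.mul Real.continuous_exp.continuousOn).div hBc fun s _ => hB s).intervalIntegrable_of_Icc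
      ht)
  have hBt := hB t
  simp only [Pi.div_apply, Pi.mul_apply] at key
  rw [key, S.B_zero, Real.exp_zero, Real.exp_neg]
  field_simp
  ring
end
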